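/- (Homogenization in probability for G-equations; Theorem for part (ii).) Assume the G-equation hypotheses on (c,v) over a probability space (Ω,F,P), assume the needed measurability in ω, and assume only lim_{s→∞} φ_H(s) = 0 for H := (c,v). Then there is a convex bounded open set S ⊆ ℝ^d containing 0 such that the following holds. Let u_0 : ℝ^d → ℝ and, for each ε ∈ (0,1), a function u^ε(0,·,ω) : ℝ^d → ℝ be uniformly continuous; let y_ε ∈ ℝ^d (arbitrary) and ρ(ε) → 0 as ε → 0 satisfy sup_ω ‖u^ε(0, · + y_ε, ω) − u_0‖_{L^∞(ℝ^d)} ≤ ρ(ε); and define u^ε(t,x,ω) := sup{ u^ε(0,y,ω) : x ∈ ε Γ(ε^{-1} t, ω; 0, ε^{-1} y) } for t > 0 (the control representation of the unique uniformly continuous viscosity solution of u^ε_t + v(ε^{-1}t, ε^{-1}x, ω)·∇u^ε = c(ε^{-1}t, ε^{-1}x, ω)|∇u^ε|). Then for every δ > 0: lim_{ε→0} P[ |u^ε(t, x + y_ε, ω) − sup_{y ∈ x − tS} u_0(y)| ≤ δ for all (t,x) ∈ [0, δ^{-1})×B_{δ^{-1}}(0) ] = 1. -/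

import Mathlib

open MeasureTheory Filter Metric

noncomputable section

/-- `ℝ^d` with the Euclidean norm. -/
abbrev Euc (d : ℕ) : Type := EuclideanSpace ℝ (Fin d)

/-- `(t₁, x₁)` is reachable from `(t₀, x₀)`: there is an absolutely continuous path
`γ : [t₀,t₁] → ℝ^d` (given by the integral of its a.e. derivative `g`) with `γ(t₀) = x₀`,
`γ(t₁) = x₁`, and `|γ'(t) − v(t,γ(t))| ≤ c(t,γ(t))` for a.e. `t ∈ [t₀,t₁]`. -/
def Reachable {d : ℕ} (c : ℝ → Euc d → ℝ) (v : ℝ → Euc d → Euc d)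
    (t0 : ℝ) (x0 : Euc d) (t1 : ℝ) (x1 : Euc d) : Prop :=
  t0 ≤ t1 ∧ ∃ γ g : ℝ → Euc d,
    IntervalIntegrable g volume t0 t1 ∧
    (∀ t ∈ Set.Icc t0 t1, γ t = x0 + ∫ s in t0..t, g s) ∧
    γ t1 = x1 ∧
    ∀ᵐ s ∂(volume.restrict (Set.Icc t0 t1)), ‖g s - v s (γ s)‖ ≤ c s (γ s)

/-- The reachable set `Γ(t; t₀, x₀)`. -/
def reachSet {d : ℕ} (c : ℝ → Euc d → ℝ) (v : ℝ → Euc d → Euc d)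
    (t t0 : ℝ) (x0 : Euc d) : Set (Euc d) :=
  {x | Reachable c v t0 x0 (t0 + t) x}

/-- The travel time `τ^{t₀}(x₀, x) = inf { t ≥ 0 : x ∈ Γ(t; t₀, x₀) }`. -/
def travelTime {d : ℕ} (c : ℝ → Euc d → ℝ) (v : ℝ → Euc d → Euc d)
    (t0 : ℝ) (x0 x : Euc d) : ℝ :=
  sInf {t | 0 ≤ t ∧ x ∈ reachSet c v t t0 x0}

/-- The σ-algebra `F_t^+(H)` generated by `H(s,x,·) = (c(s,x,·), v(s,x,·))` for `s ≥ t`. -/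
def sigmaPlus {d : ℕ} {Ω : Type*} [MeasurableSpace Ω]
    (c : ℝ → Euc d → Ω → ℝ) (v : ℝ → Euc d → Ω → Euc d) (t : ℝ) : MeasurableSpace Ω :=
  ⨆ (s : ℝ) (_ : t ≤ s) (x : Euc d),
    MeasurableSpace.comap (fun ω => (c s x ω, v s x ω)) inferInstance

/-- The σ-algebra `F_t^-(H)` generated by `H(s,x,·) = (c(s,x,·), v(s,x,·))` for `s ≤ t`. -/
def sigmaMinus {d : ℕ} {Ω : Type*} [MeasurableSpace Ω]
    (c : ℝ → Euc d → Ω → ℝ) (v : ℝ → Euc d → Ω → Euc d) (t : ℝ) : MeasurableSpace Ω :=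
  ⨆ (s : ℝ) (_ : s ≤ t) (x : Euc d),
    MeasurableSpace.comap (fun ω => (c s x ω, v s x ω)) inferInstance

/-- The mixing coefficient `φ_H(s)` of `H = (c,v)`. -/
def phiH {d : ℕ} {Ω : Type*} [MeasurableSpace Ω] (P : Measure Ω)
    (c : ℝ → Euc d → Ω → ℝ) (v : ℝ → Euc d → Ω → Euc d) (s : ℝ) : ℝ :=
  sSup {r | ∃ t : ℝ, ∃ Ev Fv : Set Ω,
    MeasurableSet[sigmaMinus c v t] Ev ∧ MeasurableSet[sigmaPlus c v (t + s)] Fv ∧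
    0 < P Ev ∧ r = |(P (Fv ∩ Ev)).toReal / (P Ev).toReal - (P Fv).toReal|}


theorem reach_refl {d : ℕ} (c : ℝ → Euc d → ℝ) (v : ℝ → Euc d → Euc d) (t : ℝ) (x : Euc d) :
    Reachable c v t x t x := by
  refine ⟨le_rfl, fun _ => x, fun _ => 0, by simp, by simp, rfl, ?_⟩
  simp

theorem reach_trans {d : ℕ} {c : ℝ → Euc d → ℝ} {v : ℝ → Euc d → Euc d} {t0 t1 t2 : ℝ}
    {x0 x1 x2 : Euc d} (h1 : Reachable c v t0 x0 t1 x1) (h2 : Reachable c v t1 x1 t2 x2) :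
    Reachable c v t0 x0 t2 x2 := by
  obtain ⟨l1, γ1, g1, i1, e1, f1, a1⟩ := h1
  obtain ⟨l2, γ2, g2, i2, e2, f2, a2⟩ := h2
  set g : ℝ → Euc d := fun t => if t ≤ t1 then g1 t else g2 t with hg
  set γ : ℝ → Euc d := fun t => if t ≤ t1 then γ1 t else γ2 t with hγ
  have j1 : IntervalIntegrable g volume t0 t1 := by
    refine i1.congr ?_
    intro s hs
    rw [Set.uIoc_of_le l1] at hs
    simp [hg, hs.2]
  have j2 : IntervalIntegrable g volume t1 t2 := by
    refine i2.congr ?_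
    intro s hs
    rw [Set.uIoc_of_le l2] at hs
    simp [hg, not_le.2 hs.1]
  have k1 : ∀ t ∈ Set.Icc t0 t1, ∫ s in t0..t, g s = ∫ s in t0..t, g1 s := by
    intro t ht
    refine intervalIntegral.integral_congr_ae (Eventually.of_forall fun s hs => ?_)
    rw [Set.uIoc_of_le ht.1] at hs
    simp [hg, hs.2.trans ht.2]
  have k2 : ∀ t ∈ Set.Icc t1 t2, ∫ s in t1..t, g s = ∫ s in t1..t, g2 s := by
    intro t ht
    refine intervalIntegral.integral_congr_ae (Eventually.of_forall fun s hs => ?_)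
    rw [Set.uIoc_of_le ht.1] at hs
    simp [hg, not_le.2 hs.1]
  have m1 : ∫ s in t0..t1, g1 s = x1 - x0 := by
    rw [← f1, e1 t1 ⟨l1, le_rfl⟩]; abel
  refine ⟨l1.trans l2, γ, g, j1.trans j2, ?_, ?_, ?_⟩
  · intro t ht
    by_cases h : t ≤ t1
    · simp only [hγ, h, if_true]
      rw [e1 t ⟨ht.1, h⟩, k1 t ⟨ht.1, h⟩]
    · simp only [hγ, h, if_false]
      have h' := (not_le.1 h).le
      rw [e2 t ⟨h', ht.2⟩, ← intervalIntegral.integral_add_adjacent_intervals j1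
        (j2.mono_set (by rw [Set.uIcc_of_le h', Set.uIcc_of_le l2]; exact Set.Icc_subset_Icc le_rfl ht.2)),
        k1 t1 ⟨l1, le_rfl⟩, k2 t ⟨h', ht.2⟩, m1]
      abel
  · by_cases h : t2 ≤ t1
    · have : t2 = t1 := le_antisymm h l2
      subst this
      simp only [hγ, le_refl, if_true]
      rw [f1, ← f2, e2 t2 ⟨le_rfl, le_rfl⟩]; simp
    · simp only [hγ, h, if_false, f2]
  · rw [ae_restrict_iff' measurableSet_Icc] at a1 a2 ⊢
    filter_upwards [a1, a2] with s b1 b2 hs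
    by_cases h : s ≤ t1
    · simp only [hγ, hg, h, if_true]; exact b1 ⟨hs.1, h⟩
    · simp only [hγ, hg, h, if_false]; exact b2 ⟨(not_le.1 h).le, hs.2⟩

theorem reach_rev {d : ℕ} {c : ℝ → Euc d → ℝ} {v : ℝ → Euc d → Euc d} {t0 t1 : ℝ}
    {x0 x1 : Euc d}
    (h : Reachable (fun t x => c (-t) x) (fun t x => - v (-t) x) (-t1) x1 (-t0) x0) :
    Reachable c v t0 x0 t1 x1 := by
  obtain ⟨l, γ, g, i, e, f, a⟩ := h
  have l' : t0 ≤ t1 := neg_le_neg_iff.1 l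
  have i' : IntervalIntegrable (fun s => - g (-s)) volume t0 t1 := by
    have h1 := (i.comp_mul_left (c := -1)).symm
    simp only [neg_mul, one_mul, div_neg, div_one, neg_neg] at h1
    exact h1.neg
  refine ⟨l', fun t => γ (-t), fun s => - g (-s), i', ?_, ?_, ?_⟩
  · intro t ht
    show γ (-t) = _
    rw [intervalIntegral.integral_neg, intervalIntegral.integral_comp_neg (f := g),
      e (-t) ⟨neg_le_neg ht.2, neg_le_neg ht.1⟩, ← f, e (-t0) ⟨neg_le_neg l', le_rfl⟩,
      ← intervalIntegral.integral_add_adjacent_intervals (a := -t1) (b := -t) (c := -t0)]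
    · abel
    · refine i.mono_set ?_
      rw [Set.uIcc_of_le (neg_le_neg ht.2), Set.uIcc_of_le l]
      exact Set.Icc_subset_Icc le_rfl (neg_le_neg ht.1)
    · refine i.mono_set ?_
      rw [Set.uIcc_of_le (neg_le_neg ht.1), Set.uIcc_of_le l]
      exact Set.Icc_subset_Icc (neg_le_neg ht.2) le_rfl
  · simp only
    rw [e (-t1) ⟨le_rfl, l⟩]; simp
  · rw [ae_restrict_iff' measurableSet_Icc] at a ⊢
    have := (Measure.measurePreserving_neg (volume : Measure ℝ)).quasiMeasurePreserving.ae a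
    filter_upwards [this] with s hs hs'
    have := hs ⟨neg_le_neg hs'.2, neg_le_neg hs'.1⟩
    simp only [neg_neg] at this
    have e2 : - g (-s) - v s (γ (-s)) = - (g (-s) - - v s (γ (-s))) := by abel
    show ‖- g (-s) - v s (γ (-s))‖ ≤ _
    rw [e2, norm_neg]
    exact this

theorem reach_segment {d : ℕ} {c : ℝ → Euc d → ℝ} {v : ℝ → Euc d → Euc d} {t0 h : ℝ}
    {x0 g : Euc d} (hh : 0 ≤ h)
    (H : ∀ s, 0 ≤ s → s ≤ h → ‖g - v (t0 + s) (x0 + s • g)‖ ≤ c (t0 + s) (x0 + s • g)) :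
    Reachable c v t0 x0 (t0 + h) (x0 + h • g) := by
  refine ⟨by linarith, fun t => x0 + (t - t0) • g, fun _ => g, by simp, ?_, by simp, ?_⟩
  · intro t ht; simp
  · rw [ae_restrict_iff' measurableSet_Icc]
    refine Eventually.of_forall fun s hs => ?_
    have := H (s - t0) (by linarith [hs.1]) (by linarith [hs.2])
    simpa using this

/-- properties of admissible paths -/
theorem reach_path {d : ℕ} {c : ℝ → Euc d → ℝ} {v : ℝ → Euc d → Euc d} {t0 t1 K : ℝ}
    {x0 x1 : Euc d} (hb : ∀ t x, c t x ≤ K ∧ ‖v t x‖ ≤ K)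
    (h : Reachable c v t0 x0 t1 x1) :
    ∃ γ : ℝ → Euc d, γ t0 = x0 ∧ γ t1 = x1 ∧
      (∀ s s', t0 ≤ s → s ≤ s' → s' ≤ t1 → ‖γ s' - γ s‖ ≤ 2 * K * (s' - s)) ∧
      (∀ s s' A, t0 ≤ s → s ≤ s' → s' ≤ t1 → ∀ w : Euc d,
        (∀ r ∈ Set.Icc s s', ‖v r (γ r) - w‖ + c r (γ r) ≤ A) →
        ‖γ s' - γ s - (s' - s) • w‖ ≤ A * (s' - s)) := by
  obtain ⟨l, γ, g, i, e, f, a⟩ := h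
  have key : ∀ s s' A, t0 ≤ s → s ≤ s' → s' ≤ t1 → ∀ w : Euc d,
        (∀ r ∈ Set.Icc s s', ‖v r (γ r) - w‖ + c r (γ r) ≤ A) →
        ‖γ s' - γ s - (s' - s) • w‖ ≤ A * (s' - s) := by
    intro s s' A h0 h1 h2 w hA
    have j1 : IntervalIntegrable g volume t0 s := i.mono_set (by
      rw [Set.uIcc_of_le h0, Set.uIcc_of_le l]; exact Set.Icc_subset_Icc le_rfl (by linarith))
    have j2 : IntervalIntegrable g volume s s' := i.mono_set (by
      rw [Set.uIcc_of_le h1, Set.uIcc_of_le l]; exact Set.Icc_subset_Icc h0 (by linarith))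
    have : γ s' - γ s - (s' - s) • w = ∫ r in s..s', (g r - w) := by
      rw [e s' ⟨by linarith, h2⟩, e s ⟨h0, by linarith⟩,
        ← intervalIntegral.integral_add_adjacent_intervals j1 j2,
        intervalIntegral.integral_sub j2 (by simp)]
      simp
    rw [this]
    have := intervalIntegral.norm_integral_le_of_norm_le_const_ae (a := s) (b := s') (C := A)
      (f := fun r => g r - w) ?_
    · rwa [abs_of_nonneg (by linarith)] at this
    · rw [ae_restrict_iff' measurableSet_Icc] at a
      filter_upwards [a] with r hr hr'
      rw [Set.uIoc_of_le h1] at hr'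
      have h3 := hr ⟨by linarith [hr'.1], by linarith [hr'.2]⟩
      have h4 := hA r ⟨hr'.1.le, hr'.2⟩
      calc ‖g r - w‖ = ‖(g r - v r (γ r)) + (v r (γ r) - w)‖ := by congr 1; abel
        _ ≤ _ := norm_add_le _ _
        _ ≤ A := by linarith
  refine ⟨γ, ?_, f, ?_, key⟩
  · rw [e t0 ⟨le_rfl, l⟩]; simp
  · intro s s' h0 h1 h2
    have := key s s' (2 * K) h0 h1 h2 0 (fun r _ => by
      have := hb r (γ r)
      rw [sub_zero]; linarith)
    simpa using this

theorem reach_dist {d : ℕ} {c : ℝ → Euc d → ℝ} {v : ℝ → Euc d → Euc d} {t0 t1 K : ℝ}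
    {x0 x1 : Euc d} (hb : ∀ t x, c t x ≤ K ∧ ‖v t x‖ ≤ K)
    (h : Reachable c v t0 x0 t1 x1) : ‖x1 - x0‖ ≤ 2 * K * (t1 - t0) := by
  obtain ⟨γ, h0, h1, h2, -⟩ := reach_path hb h
  rw [← h0, ← h1]
  exact h2 _ _ le_rfl h.1 le_rfl

theorem reach_shift {d : ℕ} {c : ℝ → Euc d → ℝ} {v : ℝ → Euc d → Euc d} {t0 t1 s : ℝ}
    {x0 x1 y : Euc d}
    (h : Reachable c v (t0 + s) (x0 + y) (t1 + s) (x1 + y)) :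
    Reachable (fun t x => c (t + s) (x + y)) (fun t x => v (t + s) (x + y)) t0 x0 t1 x1 := by
  obtain ⟨l, γ, g, i, e, f, a⟩ := h
  refine ⟨by linarith, fun t => γ (t + s) - y, fun t => g (t + s), ?_, ?_, ?_, ?_⟩
  · have := i.comp_add_right s
    simpa using this
  · intro t ht
    have := e (t + s) ⟨by linarith [ht.1], by linarith [ht.2]⟩
    show γ (t + s) - y = _
    rw [this, intervalIntegral.integral_comp_add_right (f := g)]
    abel
  · simp [f]
  · rw [ae_restrict_iff' measurableSet_Icc] at a ⊢
    have := (measurePreserving_add_right (volume : Measure ℝ) s).quasiMeasurePreserving.ae a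
    filter_upwards [this] with r hr hr'
    have := hr ⟨by linarith [hr'.1], by linarith [hr'.2]⟩
    simpa using this

theorem reach_shift_iff {d : ℕ} {c : ℝ → Euc d → ℝ} {v : ℝ → Euc d → Euc d} {t0 t1 s : ℝ}
    {x0 x1 y : Euc d} :
    Reachable (fun t x => c (t + s) (x + y)) (fun t x => v (t + s) (x + y)) t0 x0 t1 x1 ↔
    Reachable c v (t0 + s) (x0 + y) (t1 + s) (x1 + y) := by
  refine ⟨fun h => ?_, reach_shift⟩
  have := reach_shift (c := fun t x => c (t + s) (x + y)) (v := fun t x => v (t + s) (x + y))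
    (t0 := t0 + s) (t1 := t1 + s) (s := -s) (x0 := x0 + y) (x1 := x1 + y) (y := -y)
    (by simpa using h)
  simpa using this


theorem integ_cpt {d : ℕ} {f : Euc d → ℝ} (hf : AEStronglyMeasurable f volume) (C : ℝ)
    (hb : ∀ x, ‖f x‖ ≤ C) {S : Set (Euc d)} (hS : IsCompact S) (hz : ∀ x, x ∉ S → f x = 0) :
    Integrable f := by
  have h1 : IntegrableOn f S := by
    refine Measure.integrableOn_of_bounded (M := C) hS.measure_lt_top.ne hf ?_
    exact Eventually.of_forall hb
  rwa [integrableOn_iff_integrable_of_support_subset] at h1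
  intro x hx
  by_contra h
  exact hx (hz x h)

theorem fderiv_zero_off {d : ℕ} {F : Type*} [NormedAddCommGroup F] [NormedSpace ℝ F]
    {g : Euc d → F} {x : Euc d} (hx : x ∉ tsupport g) :
    fderiv ℝ g x = 0 := by
  by_contra h
  exact hx (support_fderiv_subset ℝ (f := g) h)

theorem wdiv {d : ℕ} {V : Euc d → Euc d} {L D : NNReal} (hV : LipschitzWith L V)
    (hdiv : ∀ᵐ x ∂(volume : Measure (Euc d)),
      LinearMap.trace ℝ (Euc d) (fderiv ℝ V x).toLinearMap = 0)
    {g : Euc d → ℝ} (hg : LipschitzWith D g) (hc : HasCompactSupport g) :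
    ∫ x, fderiv ℝ g x (V x) = 0 := by
  set e := EuclideanSpace.basisFun (Fin d) ℝ with he
  have hVi : ∀ i, LipschitzWith L (fun x => V x i) := by
    intro i
    refine LipschitzWith.of_dist_le_mul fun x y => ?_
    refine le_trans ?_ (hV.dist_le_mul x y)
    rw [dist_eq_norm, dist_eq_norm]
    exact (PiLp.norm_apply_le (V x - V y) i)
  have hae1 : ∀ᵐ x : Euc d, DifferentiableAt ℝ g x := hg.ae_differentiableAt
  have hae2 : ∀ᵐ x : Euc d, DifferentiableAt ℝ V x := hV.ae_differentiableAt
  have h1 : ∀ i, ∫ x, lineDeriv ℝ (fun x => V x i) x (e i) * g x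
      = ∫ x, lineDeriv ℝ g x (-(e i)) * V x i :=
    fun i => (hVi i).integral_lineDeriv_mul_eq hg hc (e i)
  have hL : ∀ᵐ x : Euc d, fderiv ℝ g x (V x) = - ∑ i, lineDeriv ℝ g x (-(e i)) * V x i := by
    filter_upwards [hae1] with x hx
    have : V x = ∑ i, V x i • e i := by
      conv_lhs => rw [← e.sum_repr (V x)]
      simp [he]
    conv_lhs => rw [this]
    rw [map_sum, ← Finset.sum_neg_distrib]
    refine Finset.sum_congr rfl fun i _ => ?_
    rw [hx.lineDeriv_eq_fderiv]
    simp [mul_comm]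
  have hR : ∀ᵐ x : Euc d, ∑ i, lineDeriv ℝ (fun x => V x i) x (e i) * g x = 0 := by
    filter_upwards [hae2, hdiv] with x hx ht
    rw [LinearMap.trace_eq_sum_inner _ e] at ht
    rw [← Finset.sum_mul]
    convert zero_mul _ using 2
    rw [← ht]
    refine Finset.sum_congr rfl fun i _ => ?_
    have hd : HasFDerivAt (fun x => V x i)
        ((EuclideanSpace.proj i : Euc d →L[ℝ] ℝ).comp (fderiv ℝ V x)) x :=
      (EuclideanSpace.proj i : Euc d →L[ℝ] ℝ).hasFDerivAt.comp x hx.hasFDerivAt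
    rw [hd.differentiableAt.lineDeriv_eq_fderiv, hd.fderiv]
    simp [he, EuclideanSpace.inner_single_left]
  have hi1 : ∀ i, Integrable (fun x => lineDeriv ℝ (fun x => V x i) x (e i) * g x) := by
    intro i
    have hgc : ∃ M, ∀ x, ‖g x‖ ≤ M := hc.exists_bound_of_continuous hg.continuous
    obtain ⟨M, hM⟩ := hgc
    refine integ_cpt ?_ (L * ‖e i‖ * M) ?_ hc ?_
    · exact ((measurable_lineDeriv (hVi i).continuous).mul
        hg.continuous.measurable).aestronglyMeasurable
    · intro x
      rw [norm_mul]
      exact mul_le_mul (norm_lineDeriv_le_of_lipschitz ℝ (hVi i)) (hM x) (norm_nonneg _)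
        (by positivity)
    · intro x hx
      rw [image_eq_zero_of_notMem_tsupport hx, mul_zero]
  have hi2 : ∀ i, Integrable (fun x => lineDeriv ℝ g x (-(e i)) * V x i) := by
    intro i
    have h3 : Integrable (fun x => fderiv ℝ g x (-(e i)) * V x i) := by
      have : ∃ M, ∀ x ∈ tsupport g, ‖V x i‖ ≤ M :=
        IsCompact.exists_bound_of_continuousOn hc (hVi i).continuous.continuousOn
      obtain ⟨M, hM⟩ := this
      refine integ_cpt ?_ (D * ‖e i‖ * max M 0) ?_ hc ?_
      · exact ((measurable_fderiv_apply_const ℝ g _).mul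
          (hVi i).continuous.measurable).aestronglyMeasurable
      · intro x
        by_cases hx : x ∈ tsupport g
        · rw [norm_mul]
          refine mul_le_mul ?_ ((hM x hx).trans (le_max_left _ _)) (norm_nonneg _) (by positivity)
          refine ((fderiv ℝ g x).le_opNorm _).trans ?_
          rw [norm_neg]
          exact mul_le_mul_of_nonneg_right (norm_fderiv_le_of_lipschitz ℝ hg) (norm_nonneg _)
        · rw [fderiv_zero_off hx]; simp; positivity
      · intro x hx
        rw [fderiv_zero_off hx]; simp
    refine h3.congr ?_
    filter_upwards [hae1] with x hx
    rw [hx.lineDeriv_eq_fderiv]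
  rw [integral_congr_ae hL, integral_neg, integral_finsetSum _ (fun i _ => hi2 i),
    neg_eq_zero]
  simp_rw [← h1]
  rw [← integral_finsetSum _ (fun i _ => hi1 i), integral_congr_ae hR]
  simp

theorem trans_ineq {d : ℕ} {u : Euc d → ℝ} {D : NNReal} (hu : LipschitzWith D u)
    (p z : Euc d) {R : ℝ} (hz : ‖z‖ ≤ 2 * R) :
    ∫ x in ball p R, |u (x + z) - u x| ≤ ‖z‖ * ∫ x in ball p (3 * R), ‖fderiv ℝ u x‖ := by
  have hm : Measurable (fun x => lineDeriv ℝ u x z) := measurable_lineDeriv hu.continuous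
  have hbd : ∀ x, ‖lineDeriv ℝ u x z‖ ≤ D * ‖z‖ := fun x => norm_lineDeriv_le_of_lipschitz ℝ hu
  have h1 : ∀ x, |u (x + z) - u x| ≤ ∫ s in (0:ℝ)..1, |lineDeriv ℝ u (x + s • z) z| := by
    intro x
    have hl : LipschitzWith (D * ‖z‖₊) (fun s : ℝ => u (x + s • z)) := by
      refine hu.comp (LipschitzWith.of_dist_le_mul fun s t => ?_)
      rw [dist_eq_norm, dist_eq_norm]
      have : x + s • z - (x + t • z) = (s - t) • z := by rw [sub_smul]; abel
      rw [this, norm_smul, mul_comm]; rfl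
    have hac : AbsolutelyContinuousOnInterval (fun s : ℝ => u (x + s • z)) 0 1 :=
      hl.lipschitzOnWith.absolutelyContinuousOnInterval
    have := hac.integral_deriv_eq_sub
    simp only [one_smul, zero_smul, add_zero] at this
    rw [← this]
    have hd : ∀ s : ℝ, deriv (fun s : ℝ => u (x + s • z)) s = lineDeriv ℝ u (x + s • z) z := by
      intro s
      rw [lineDeriv]
      have : (fun t : ℝ => u (x + s • z + t • z)) = fun t => (fun s : ℝ => u (x + s • z)) (s + t) := by
        funext t; simp only; rw [add_smul]; congr 1; abel
      rw [this, deriv_comp_const_add (fun s : ℝ => u (x + s • z)) s 0]; simp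
    simp_rw [hd]
    have := intervalIntegral.abs_integral_le_integral_abs (f := fun s : ℝ => lineDeriv ℝ u (x + s • z) z)
      (μ := volume) (a := 0) (b := 1) zero_le_one
    exact this
  have hball : ∀ (q : Euc d) (r : ℝ), volume (ball q r) ≠ ⊤ := fun q r => measure_ball_lt_top.ne
  have hjm : Measurable (fun q : Euc d × ℝ => |lineDeriv ℝ u (q.1 + q.2 • z) z|) := by
    have h0 : Measurable (fun q : Euc d × ℝ => q.1 + q.2 • z) := by fun_prop
    simpa [Real.norm_eq_abs] using (hm.comp h0).norm
  have hint : Integrable (Function.uncurry fun (x : Euc d) (s : ℝ) => |lineDeriv ℝ u (x + s • z) z|)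
      ((volume.restrict (ball p R)).prod (volume.restrict (Set.Ioc 0 1))) := by
    have : IsFiniteMeasure (volume.restrict (ball p R)) :=
      ⟨by simpa using (hball p R).lt_top⟩
    refine Integrable.of_bound (C := D * ‖z‖) hjm.aestronglyMeasurable ?_
    refine Eventually.of_forall fun q => ?_
    simp only [Function.uncurry, Real.norm_eq_abs, abs_abs]
    exact hbd _
  calc ∫ x in ball p R, |u (x + z) - u x|
      ≤ ∫ x in ball p R, ∫ s in Set.Ioc (0:ℝ) 1, |lineDeriv ℝ u (x + s • z) z| := by
        refine integral_mono_of_nonneg (Eventually.of_forall fun x => abs_nonneg _)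
          hint.integral_prod_left (Eventually.of_forall fun x => ?_)
        have := h1 x
        rwa [intervalIntegral.integral_of_le zero_le_one] at this
    _ = ∫ s in Set.Ioc (0:ℝ) 1, ∫ x in ball p R, |lineDeriv ℝ u (x + s • z) z| :=
        integral_integral_swap hint
    _ ≤ ∫ s in Set.Ioc (0:ℝ) 1, (∫ x in ball p (3 * R), |lineDeriv ℝ u x z|) := by
        refine setIntegral_mono_on hint.integral_prod_right (by simp) measurableSet_Ioc ?_
        intro s hs
        have h2 : ∫ x in ball p R, |lineDeriv ℝ u (x + s • z) z|
            = ∫ x in (fun x => x + s • z) '' ball p R, |lineDeriv ℝ u x z| := by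
          rw [((measurePreserving_add_right (volume : Measure (Euc d)) (s • z))).setIntegral_image_emb
            (measurableEmbedding_addRight _) (fun x => |lineDeriv ℝ u x z|)]
        rw [h2]
        refine setIntegral_mono_set ?_ (Eventually.of_forall fun x => abs_nonneg _) ?_
        · refine Measure.integrableOn_of_bounded (M := D * ‖z‖) (hball _ _)
            hm.norm.aestronglyMeasurable (Eventually.of_forall fun x => ?_)
          exact (abs_abs _).le.trans (hbd x)
        · refine LE.le.eventuallyLE ?_
          rintro _ ⟨x, hx, rfl⟩
          rw [mem_ball, dist_eq_norm] at hx ⊢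
          have h3 : ‖s • z‖ ≤ 2 * R := by
            rw [norm_smul, Real.norm_eq_abs, abs_of_pos hs.1]
            nlinarith [hs.2, hs.1, norm_nonneg z]
          calc ‖x + s • z - p‖ = ‖(x - p) + s • z‖ := by congr 1; abel
            _ ≤ _ := norm_add_le _ _
            _ < 3 * R := by linarith
    _ = ∫ x in ball p (3 * R), |lineDeriv ℝ u x z| := by simp
    _ ≤ ∫ x in ball p (3 * R), ‖z‖ * ‖fderiv ℝ u x‖ := by
        refine integral_mono_ae ?_ ?_ ?_
        · refine Measure.integrableOn_of_bounded (M := D * ‖z‖) (hball _ _)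
            hm.norm.aestronglyMeasurable (Eventually.of_forall fun x => ?_)
          exact (abs_abs _).le.trans (hbd x)
        · refine Measure.integrableOn_of_bounded (M := ‖z‖ * D) (hball _ _)
            ((measurable_fderiv ℝ u).norm.const_mul _).aestronglyMeasurable
            (Eventually.of_forall fun x => ?_)
          rw [norm_mul, norm_norm, norm_norm]
          exact mul_le_mul_of_nonneg_left (norm_fderiv_le_of_lipschitz ℝ hu) (norm_nonneg _)
        · refine ae_restrict_of_ae ?_
          filter_upwards [hu.ae_differentiableAt] with x hx
          rw [hx.lineDeriv_eq_fderiv, mul_comm]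
          exact (fderiv ℝ u x).le_opNorm z
    _ = _ := integral_const_mul _ _

theorem poinc {d : ℕ} {u w : Euc d → ℝ} {D : NNReal} (hu : LipschitzWith D u)
    (hw : Continuous w) (hu0 : ∀ x, 0 ≤ u x) (hw0 : ∀ x, 0 ≤ w x)
    (hw1 : ∀ x, w x ≤ 1) (huw : ∀ x, u x = 0 ∨ w x = 0)
    (p : Euc d) {R : ℝ} (hR : 0 < R) :
    (∫ x in ball p R, u x) * (∫ y in ball p R, w y) ≤
      (2 * R * (volume (ball (0 : Euc d) (2 * R))).toReal) *
        ∫ x in ball p (3 * R), ‖fderiv ℝ u x‖ := by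
  set B := ball p R
  have hball : ∀ (q : Euc d) (r : ℝ), volume (ball q r) ≠ ⊤ := fun q r => measure_ball_lt_top.ne
  have : ∀ (q : Euc d) (r : ℝ), IsFiniteMeasure (volume.restrict (ball q r)) :=
    fun q r => ⟨by simpa using (hball q r).lt_top⟩
  set J := ∫ x in ball p (3 * R), ‖fderiv ℝ u x‖
  have hJ : 0 ≤ J := integral_nonneg fun _ => norm_nonneg _
  have hcont : Continuous (fun q : Euc d × Euc d => |u (q.1 + q.2) - u q.1|) := by
    have := hu.continuous
    fun_prop
  have hint : Integrable (Function.uncurry fun (x z : Euc d) => |u (x + z) - u x|)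
      ((volume.restrict B).prod (volume.restrict (ball 0 (2 * R)))) := by
    refine Integrable.of_bound (C := D * (2 * R)) hcont.aestronglyMeasurable ?_
    have hms : MeasurableSet (B ×ˢ ball (0 : Euc d) (2 * R)) :=
      measurableSet_ball.prod measurableSet_ball
    rw [Measure.prod_restrict, ae_restrict_iff' hms]
    refine Eventually.of_forall fun q hq => ?_
    simp only [Function.uncurry, Real.norm_eq_abs, abs_abs]
    have := hu.dist_le_mul (q.1 + q.2) q.1
    rw [Real.dist_eq, dist_eq_norm, add_sub_cancel_left] at this
    refine this.trans (mul_le_mul_of_nonneg_left ?_ D.2)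
    have h2 := hq.2
    rw [mem_ball_zero_iff] at h2
    exact h2.le
  calc (∫ x in B, u x) * (∫ y in B, w y)
      = ∫ x in B, (∫ y in B, u x * w y) := by
        simp_rw [integral_const_mul]
        rw [integral_mul_const]
    _ ≤ ∫ x in B, ∫ z in ball (0 : Euc d) (2 * R), |u (x + z) - u x| := by
        refine integral_mono_of_nonneg (Eventually.of_forall fun x =>
          integral_nonneg fun y => mul_nonneg (hu0 _) (hw0 _)) hint.integral_prod_left ?_
        rw [EventuallyLE, ae_restrict_iff' measurableSet_ball]
        refine Eventually.of_forall fun x hx => ?_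
        have hc2 : Continuous (fun y => |u y - u x|) := by have := hu.continuous; fun_prop
        have hc3 : Continuous (fun y => |u (x + y) - u x|) := by have := hu.continuous; fun_prop
        have e1 : ∫ y in B, u x * w y ≤ ∫ y in B, |u y - u x| := by
          refine integral_mono_of_nonneg (Eventually.of_forall fun y => mul_nonneg (hu0 _) (hw0 _))
            ((hc2.continuousOn.integrableOn_compact (isCompact_closedBall p R)).mono_set
              ball_subset_closedBall) (Eventually.of_forall fun y => ?_)
          simp only
          rcases huw y with h | h
          · rw [h, zero_sub, abs_neg, abs_of_nonneg (hu0 x)]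
            nlinarith [hu0 x, hw1 y]
          · rw [h, mul_zero]; exact abs_nonneg _
        refine e1.trans ?_
        have e2 : ∫ y in B, |u y - u x| = ∫ z in (fun z => x + z) ⁻¹' B, |u (x + z) - u x| := by
          rw [(measurePreserving_add_left (volume : Measure (Euc d)) x).setIntegral_preimage_emb
            (measurableEmbedding_addLeft x) (fun y => |u y - u x|)]
        rw [e2]
        refine setIntegral_mono_set ?_ (Eventually.of_forall fun x => abs_nonneg _) ?_
        · exact (hc3.continuousOn.integrableOn_compact (isCompact_closedBall 0 (2 * R))).mono_set
              ball_subset_closedBall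
        · refine LE.le.eventuallyLE ?_
          intro z hz
          simp only [Set.mem_preimage, B, mem_ball, dist_eq_norm] at hz hx
          rw [mem_ball_zero_iff]
          calc ‖z‖ = ‖(x + z - p) - (x - p)‖ := by congr 1; abel
            _ ≤ _ := norm_sub_le _ _
            _ < 2 * R := by linarith
    _ = ∫ z in ball (0 : Euc d) (2 * R), ∫ x in B, |u (x + z) - u x| :=
        integral_integral_swap hint
    _ ≤ ∫ z in ball (0 : Euc d) (2 * R), 2 * R * J := by
        refine setIntegral_mono_on hint.integral_prod_right (integrable_const _) measurableSet_ball ?_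
        intro z hz
        rw [mem_ball_zero_iff] at hz
        exact (trans_ineq hu p z hz.le).trans (mul_le_mul_of_nonneg_right hz.le hJ)
    _ = _ := by
        simp [Measure.real]; ring


theorem smul_lip {d : ℕ} {F : Type*} [NormedAddCommGroup F] [NormedSpace ℝ F]
    {u : Euc d → ℝ} {D : NNReal} (hu : LipschitzWith D u) (hc : HasCompactSupport u)
    {ψ : Euc d → F} (hψ : ContDiff ℝ 1 ψ) :
    ∃ C : NNReal, LipschitzWith C (fun x => u x • ψ x) := by
  obtain ⟨R, hR⟩ := hc.isCompact.isBounded.subset_closedBall (0 : Euc d)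
  have hK : IsCompact (closedBall (0 : Euc d) R) := isCompact_closedBall _ _
  obtain ⟨M1, hM1⟩ := hK.exists_bound_of_continuousOn hψ.continuous.continuousOn
  obtain ⟨M2, hM2⟩ := hK.exists_bound_of_continuousOn
    (hψ.continuous_fderiv one_ne_zero).continuousOn
  obtain ⟨M3, hM3⟩ := hc.exists_bound_of_continuous hu.continuous
  have hL : ∀ x ∈ closedBall (0 : Euc d) R, ∀ y ∈ closedBall (0 : Euc d) R,
      ‖ψ y - ψ x‖ ≤ max M2 0 * ‖y - x‖ := by
    intro x hx y hy
    exact Convex.norm_image_sub_le_of_norm_fderiv_le (𝕜 := ℝ)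
      (fun z _ => (hψ.differentiable one_ne_zero) z)
      (fun z hz => (hM2 z hz).trans (le_max_left _ _)) (convex_closedBall _ _) hx hy
  have hM3' : 0 ≤ M3 := (norm_nonneg _).trans (hM3 0)
  have key : ∀ x ∈ tsupport u, ∀ y, ‖u y • ψ y - u x • ψ x‖ ≤
      (D * max M1 0 + M3 * max M2 0) * ‖y - x‖ := by
    intro x hx y
    have hxy : |u y - u x| ≤ D * ‖y - x‖ := by
      have := hu.dist_le_mul y x
      rwa [Real.dist_eq, dist_eq_norm] at this
    have hx1 := (hM1 x (hR hx)).trans (le_max_left _ 0)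
    have hDD : (0:ℝ) ≤ D := D.2
    have e : u y • ψ y - u x • ψ x = (u y - u x) • ψ x + u y • (ψ y - ψ x) := by
      rw [sub_smul, smul_sub]; abel
    rw [e]
    refine (norm_add_le _ _).trans ?_
    rw [norm_smul, norm_smul, add_mul]
    refine add_le_add ?_ ?_
    · calc ‖u y - u x‖ * ‖ψ x‖ ≤ (D * ‖y - x‖) * max M1 0 :=
          mul_le_mul hxy hx1 (norm_nonneg _) (by positivity)
        _ = _ := by ring
    · by_cases hy : y ∈ tsupport u
      · calc ‖u y‖ * ‖ψ y - ψ x‖ ≤ M3 * (max M2 0 * ‖y - x‖) :=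
            mul_le_mul (hM3 y) (hL x (hR hx) y (hR hy)) (norm_nonneg _) hM3'
          _ = _ := by ring
      · rw [image_eq_zero_of_notMem_tsupport hy]
        simp only [norm_zero, zero_mul]
        positivity
  have hC : 0 ≤ D * max M1 0 + M3 * max M2 0 := by
    have hDD : (0:ℝ) ≤ D := D.2
    positivity
  refine ⟨⟨_, hC⟩, LipschitzWith.of_dist_le_mul fun x y => ?_⟩
  rw [dist_eq_norm, dist_eq_norm]
  show _ ≤ (D * max M1 0 + M3 * max M2 0) * ‖x - y‖
  by_cases hy : y ∈ tsupport u
  · exact key y hy x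
  · by_cases hx : x ∈ tsupport u
    · rw [norm_sub_rev, norm_sub_rev x y]; exact key x hx y
    · rw [image_eq_zero_of_notMem_tsupport hy, image_eq_zero_of_notMem_tsupport hx]
      simp only [zero_smul, sub_zero, norm_zero]
      positivity

theorem translate_div {d : ℕ} {V : Euc d → Euc d}
    (hdiv : ∀ᵐ x ∂(volume : Measure (Euc d)),
      LinearMap.trace ℝ (Euc d) (fderiv ℝ V x).toLinearMap = 0) (z : Euc d) :
    ∀ᵐ x ∂(volume : Measure (Euc d)),
      LinearMap.trace ℝ (Euc d) (fderiv ℝ (fun x => V (x + z)) x).toLinearMap = 0 := by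
  have := (measurePreserving_add_right (volume : Measure (Euc d)) z).quasiMeasurePreserving.ae hdiv
  filter_upwards [this] with x hx
  rwa [fderiv_comp_add_right]

theorem translate_lip {d : ℕ} {V : Euc d → Euc d} {L : NNReal} (hV : LipschitzWith L V)
    (z : Euc d) : LipschitzWith L (fun x => V (x + z)) := by
  refine LipschitzWith.of_dist_le_mul fun x y => ?_
  have := hV.dist_le_mul (x + z) (y + z)
  simpa using this

/-- integrability of compactly supported products -/
theorem integ_prod {d : ℕ} {u : Euc d → ℝ} {D : NNReal} (hu : LipschitzWith D u)
    (hc : HasCompactSupport u) {φ : Euc d → ℝ} (hφ : Continuous φ) {V : Euc d → Euc d}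
    (hV : Measurable V) {K : ℝ} (hK : ∀ x, ‖V x‖ ≤ K) :
    Integrable (fun x => φ x * fderiv ℝ u x (V x)) := by
  obtain ⟨M, hM⟩ := hc.isCompact.exists_bound_of_continuousOn hφ.continuousOn
  have hK0 : 0 ≤ K := (norm_nonneg _).trans (hK 0)
  refine integ_cpt ?_ (max M 0 * (D * K)) ?_ hc ?_
  · refine (hφ.measurable.mul ?_).aestronglyMeasurable
    exact isBoundedBilinearMap_apply.continuous.measurable.comp
      ((measurable_fderiv ℝ u).prodMk hV)
  · intro x
    by_cases hx : x ∈ tsupport u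
    · rw [norm_mul]
      refine mul_le_mul ((hM x hx).trans (le_max_left _ _)) ?_ (norm_nonneg _) (by positivity)
      exact ((fderiv ℝ u x).le_opNorm _).trans
        (mul_le_mul (norm_fderiv_le_of_lipschitz ℝ hu) (hK x) (norm_nonneg _) D.2)
    · rw [fderiv_zero_off hx]; simp; positivity
  · intro x hx
    rw [fderiv_zero_off hx]; simp

theorem integ_norm {d : ℕ} {u : Euc d → ℝ} {D : NNReal} (hu : LipschitzWith D u)
    (hc : HasCompactSupport u) {φ : Euc d → ℝ} (hφ : Continuous φ) :
    Integrable (fun x => φ x * ‖fderiv ℝ u x‖) := by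
  obtain ⟨M, hM⟩ := hc.isCompact.exists_bound_of_continuousOn hφ.continuousOn
  refine integ_cpt ?_ (max M 0 * D) ?_ hc ?_
  · exact (hφ.measurable.mul (measurable_fderiv ℝ u).norm).aestronglyMeasurable
  · intro x
    by_cases hx : x ∈ tsupport u
    · rw [norm_mul, norm_norm]
      exact mul_le_mul ((hM x hx).trans (le_max_left _ _)) (norm_fderiv_le_of_lipschitz ℝ hu)
        (norm_nonneg _) (by positivity)
    · rw [fderiv_zero_off hx]; simp; positivity
  · intro x hx
    rw [fderiv_zero_off hx]; simp

theorem flux_ibp {d : ℕ} {V : Euc d → Euc d} {L D : NNReal} {K : ℝ} (hV : LipschitzWith L V)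
    (hK : ∀ x, ‖V x‖ ≤ K)
    (hdiv : ∀ᵐ x ∂(volume : Measure (Euc d)),
      LinearMap.trace ℝ (Euc d) (fderiv ℝ V x).toLinearMap = 0)
    {u : Euc d → ℝ} (hu : LipschitzWith D u) (hc : HasCompactSupport u)
    {φ : Euc d → ℝ} (hφ : ContDiff ℝ 1 φ) :
    ∫ x, φ x * fderiv ℝ u x (V x) = - ∫ x, u x * fderiv ℝ φ x (V x) := by
  obtain ⟨C, hC⟩ := smul_lip hu hc hφ
  have h0 := wdiv hV hdiv hC hc.smul_right
  have hae : ∀ᵐ x : Euc d, DifferentiableAt ℝ u x := hu.ae_differentiableAt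
  have h1 : ∀ᵐ x : Euc d, fderiv ℝ (fun x => u x • φ x) x (V x) =
      φ x * fderiv ℝ u x (V x) + u x * fderiv ℝ φ x (V x) := by
    filter_upwards [hae] with x hx
    have := (hx.hasFDerivAt.smul ((hφ.differentiable one_ne_zero) x).hasFDerivAt).fderiv
    change fderiv ℝ (fun x => u x • φ x) x = _ at this
    rw [this]
    simp; ring
  rw [integral_congr_ae h1, integral_add] at h0
  · linarith
  · exact integ_prod hu hc hφ.continuous hV.continuous.measurable hK
  · refine Continuous.integrable_of_hasCompactSupport ?_ hc.mul_right
    have := hφ.continuous_fderiv one_ne_zero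
    have := hu.continuous
    have := hV.continuous
    fun_prop

theorem flux_deriv {d : ℕ} {V : Euc d → Euc d} {L D : NNReal} {K : ℝ} (hV : LipschitzWith L V)
    (hK : ∀ x, ‖V x‖ ≤ K)
    (hdiv : ∀ᵐ x ∂(volume : Measure (Euc d)),
      LinearMap.trace ℝ (Euc d) (fderiv ℝ V x).toLinearMap = 0)
    {u : Euc d → ℝ} (hu : LipschitzWith D u) (hc : HasCompactSupport u)
    {φ : Euc d → ℝ} (hφ : ContDiff ℝ 2 φ) (y : Euc d) (s0 : ℝ) :
    ∃ N' : ℝ, HasDerivAt (fun s : ℝ => ∫ x, u x * fderiv ℝ φ x (V (x + s • y))) N' s0 ∧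
      ‖N'‖ ≤ 2 * K * ‖y‖ * ∫ x, ‖fderiv ℝ φ x‖ * ‖fderiv ℝ u x‖ := by
  have hK0 : 0 ≤ K := (norm_nonneg _).trans (hK 0)
  have hφ1 : ContDiff ℝ 1 (fderiv ℝ φ) := hφ.fderiv_right (by norm_num)
  set P : Euc d → (Euc d →L[ℝ] ℝ) := fun x => u x • fderiv ℝ φ x with hP
  obtain ⟨C, hC⟩ := smul_lip hu hc hφ1
  change LipschitzWith C P at hC
  have hPc : HasCompactSupport P := hc.smul_right
  have hPz : ∀ x, x ∉ tsupport u → P x = 0 := fun x hx => by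
    simp [hP, image_eq_zero_of_notMem_tsupport hx]
  have hae : ∀ᵐ x : Euc d, DifferentiableAt ℝ u x := hu.ae_differentiableAt
  have hPd : ∀ x, DifferentiableAt ℝ u x → HasFDerivAt P
      (u x • fderiv ℝ (fderiv ℝ φ) x + (fderiv ℝ u x).smulRight (fderiv ℝ φ x)) x :=
    fun x hx => hx.hasFDerivAt.smul ((hφ1.differentiable one_ne_zero) x).hasFDerivAt
  -- translated form
  have htr : ∀ s : ℝ, ∫ x, u x * fderiv ℝ φ x (V (x + s • y)) = ∫ x, P (x - s • y) (V x) := by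
    intro s
    rw [← integral_sub_right_eq_self (fun x => u x * fderiv ℝ φ x (V (x + s • y))) (s • y)]
    simp [hP]
  simp_rw [htr]
  set S : Set (Euc d) := (fun q : Euc d × ℝ => q.1 + q.2 • y) '' (tsupport u ×ˢ closedBall s0 1)
    with hS
  have hScpt : IsCompact S := by
    refine (hc.isCompact.prod (isCompact_closedBall _ _)).image ?_
    fun_prop
  have hSz : ∀ x, x ∉ S → ∀ s ∈ closedBall s0 1, P (x - s • y) = 0 := by
    intro x hx s hs
    refine hPz _ fun h => hx ⟨(x - s • y, s), ⟨h, hs⟩, by simp⟩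
  have hder := hasDerivAt_integral_of_dominated_loc_of_lip (μ := (volume : Measure (Euc d)))
    (F := fun (s : ℝ) x => P (x - s • y) (V x)) (x₀ := s0) (s := closedBall s0 1)
    (bound := S.indicator fun _ => C * ‖y‖ * K)
    (F' := fun x => - (fderiv ℝ P (x - s0 • y) y) (V x))
    (closedBall_mem_nhds _ one_pos) ?_ ?_ ?_ ?_ ?_ ?_
  · refine ⟨_, hder.2, ?_⟩
    have e1 : ∫ x, - (fderiv ℝ P (x - s0 • y) y) (V x) =
        - ∫ x, (fderiv ℝ P x y) (V (x + s0 • y)) := by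
      rw [integral_neg]
      congr 1
      rw [← integral_sub_right_eq_self (fun x => (fderiv ℝ P x y) (V (x + s0 • y))) (s0 • y)]
      simp
    rw [e1, norm_neg]
    set W : Euc d → Euc d := fun x => V (x + s0 • y) with hW
    have hWL : LipschitzWith L W := translate_lip hV _
    have hWK : ∀ x, ‖W x‖ ≤ K := fun x => hK _
    have hWd := translate_div hdiv (s0 • y)
    -- second identity
    have hψ : ContDiff ℝ 1 (fun x => fderiv ℝ φ x y) := hφ1.clm_apply contDiff_const
    have h2 := flux_ibp hWL hWK hWd hu hc hψ
    have h3 : ∀ᵐ x : Euc d, (fderiv ℝ P x y) (W x) =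
        fderiv ℝ u x y * fderiv ℝ φ x (W x) + u x * fderiv ℝ (fun x => fderiv ℝ φ x y) x (W x) := by
      filter_upwards [hae] with x hx
      rw [(hPd x hx).fderiv]
      have h4 : fderiv ℝ (fun x => fderiv ℝ φ x y) x (W x) = fderiv ℝ (fderiv ℝ φ) x (W x) y := by
        rw [fderiv_clm_apply ((hφ1.differentiable one_ne_zero) x) (by fun_prop)]
        simp
      have h5 : fderiv ℝ (fderiv ℝ φ) x (W x) y = fderiv ℝ (fderiv ℝ φ) x y (W x) :=
        (hφ.contDiffAt.isSymmSndFDerivAt (by simp)).eq _ _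
      rw [h4, h5]
      simp; ring
    have i1 : Integrable (fun x => fderiv ℝ u x y * fderiv ℝ φ x (W x)) := by
      have := integ_prod (V := fun _ => y) hu hc (φ := fun x => fderiv ℝ φ x (W x))
        (by have := hφ1.continuous; have := hWL.continuous; fun_prop) measurable_const
        (K := ‖y‖) (fun _ => le_rfl)
      exact this.congr (Eventually.of_forall fun x => mul_comm _ _)
    have i2 : Integrable (fun x => u x * fderiv ℝ (fun x => fderiv ℝ φ x y) x (W x)) := by
      refine Continuous.integrable_of_hasCompactSupport ?_ hc.mul_right
      have := hψ.continuous_fderiv one_ne_zero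
      have := hu.continuous
      have := hWL.continuous
      fun_prop
    have i3 : Integrable (fun x => fderiv ℝ φ x y * fderiv ℝ u x (W x)) :=
      integ_prod hu hc hψ.continuous hWL.continuous.measurable hWK
    have i4 : Integrable (fun x => ‖fderiv ℝ φ x‖ * ‖fderiv ℝ u x‖) :=
      integ_norm hu hc hφ1.continuous.norm
    rw [integral_congr_ae h3, integral_add i1 i2]
    have h6 : ∫ x, u x * fderiv ℝ (fun x => fderiv ℝ φ x y) x (W x) =
      - ∫ x, fderiv ℝ φ x y * fderiv ℝ u x (W x) := by linarith
    rw [h6, ← sub_eq_add_neg, ← integral_sub i1 i3, ← integral_const_mul]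
    refine norm_integral_le_of_norm_le (i4.const_mul _) (Eventually.of_forall fun x => ?_)
    have b1 : ‖fderiv ℝ u x y * fderiv ℝ φ x (W x)‖ ≤ K * ‖y‖ * (‖fderiv ℝ φ x‖ * ‖fderiv ℝ u x‖) := by
      rw [norm_mul]
      calc _ ≤ (‖fderiv ℝ u x‖ * ‖y‖) * (‖fderiv ℝ φ x‖ * K) := by
            refine mul_le_mul ((fderiv ℝ u x).le_opNorm _) ?_ (norm_nonneg _) (by positivity)
            exact ((fderiv ℝ φ x).le_opNorm _).trans
              (mul_le_mul_of_nonneg_left (hWK x) (norm_nonneg _))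
        _ = _ := by ring
    have b2 : ‖fderiv ℝ φ x y * fderiv ℝ u x (W x)‖ ≤ K * ‖y‖ * (‖fderiv ℝ φ x‖ * ‖fderiv ℝ u x‖) := by
      rw [norm_mul]
      calc _ ≤ (‖fderiv ℝ φ x‖ * ‖y‖) * (‖fderiv ℝ u x‖ * K) := by
            refine mul_le_mul ((fderiv ℝ φ x).le_opNorm _) ?_ (norm_nonneg _) (by positivity)
            exact ((fderiv ℝ u x).le_opNorm _).trans
              (mul_le_mul_of_nonneg_left (hWK x) (norm_nonneg _))
        _ = _ := by ring
    refine (norm_sub_le _ _).trans ?_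
    linarith
  · refine Eventually.of_forall fun s => Continuous.aestronglyMeasurable ?_
    have := hC.continuous
    have := hV.continuous
    fun_prop
  · have hs0 : s0 ∈ closedBall s0 1 := mem_closedBall_self zero_le_one
    refine Continuous.integrable_of_hasCompactSupport ?_ ?_
    · have := hC.continuous
      have := hV.continuous
      fun_prop
    · refine HasCompactSupport.intro hScpt fun x hx => ?_
      rw [hSz x hx s0 hs0]; rfl
  · have hm : Measurable fun x => fderiv ℝ P (x - s0 • y) y :=
      (measurable_fderiv_apply_const ℝ P y).comp (measurable_id.sub_const _)
    have h := isBoundedBilinearMap_apply (𝕜 := ℝ) (E := Euc d) (F := ℝ)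
    exact (h.continuous.measurable.comp (hm.prodMk hV.continuous.measurable)).neg.aestronglyMeasurable
  · refine Eventually.of_forall fun x => ?_
    refine LipschitzOnWith.of_dist_le_mul fun s hs s' hs' => ?_
    by_cases hx : x ∈ S
    · simp only [Set.indicator_of_mem hx]
      rw [Real.dist_eq, ← sub_apply]
      have h1 : ‖P (x - s • y) - P (x - s' • y)‖ ≤ C * (|s - s'| * ‖y‖) := by
        have := hC.dist_le_mul (x - s • y) (x - s' • y)
        rw [dist_eq_norm, dist_eq_norm] at this
        refine this.trans (le_of_eq ?_)
        have e : x - s • y - (x - s' • y) = -((s - s') • y) := by rw [sub_smul]; abel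
        rw [e, norm_neg, norm_smul, Real.norm_eq_abs]
      have h2 := (P (x - s • y) - P (x - s' • y)).le_opNorm (V x)
      rw [Real.norm_eq_abs] at h2
      refine h2.trans ?_
      rw [Real.coe_nnabs, abs_of_nonneg (by positivity), Real.dist_eq]
      calc _ ≤ (C * (|s - s'| * ‖y‖)) * K := mul_le_mul h1 (hK x) (norm_nonneg _) (by positivity)
        _ = _ := by ring
    · rw [hSz x hx s hs, hSz x hx s' hs']
      simp [hx]
  · exact (integrable_indicator_iff hScpt.measurableSet).2
      (integrableOn_const hScpt.measure_lt_top.ne)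
  · have h1 := (measurePreserving_sub_right (volume : Measure (Euc d)) (s0 • y)).quasiMeasurePreserving.ae hae
    filter_upwards [h1] with x hx
    have h2 := (hPd _ hx).differentiableAt.hasFDerivAt
    have h3 : HasDerivAt (fun s : ℝ => x - s • y) (-y) s0 := by
      have := ((hasDerivAt_id s0).smul_const y).const_sub x
      simpa using this
    have h4 := h2.comp_hasDerivAt s0 h3
    have h5 := h4.clm_apply (hasDerivAt_const s0 (V x))
    simpa using h5


theorem cube_vol {d : ℕ} {l : ℝ} (hl : 0 < l) :
    (volume {y : Euc d | ∀ i, y i ∈ Set.Icc (0:ℝ) l}).toReal = l ^ d := by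
  have h1 : {y : Euc d | ∀ i, y i ∈ Set.Icc (0:ℝ) l} =
      (WithLp.ofLp : Euc d → (Fin d → ℝ)) ⁻¹' (Set.Icc (0 : Fin d → ℝ) (fun _ => l)) := by
    ext y
    simp [Pi.le_def, forall_and]
  rw [h1, (PiLp.volume_preserving_ofLp (Fin d)).measure_preimage
    measurableSet_Icc.nullMeasurableSet, Real.volume_Icc_pi_toReal]
  · simp
  · intro i; exact hl.le

theorem cube_cpt {d : ℕ} (l : ℝ) : IsCompact {y : Euc d | ∀ i, y i ∈ Set.Icc (0:ℝ) l} := by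
  have h1 : {y : Euc d | ∀ i, y i ∈ Set.Icc (0:ℝ) l} =
      (EuclideanSpace.equiv (Fin d) ℝ).toHomeomorph ⁻¹' (Set.Icc (0 : Fin d → ℝ) (fun _ => l)) := by
    ext y
    simp [Pi.le_def, forall_and]
  rw [h1, Homeomorph.isCompact_preimage]
  exact isCompact_Icc

theorem flux {d : ℕ} {V : Euc d → Euc d} {L D : NNReal} {K : ℝ} (hV : LipschitzWith L V)
    (hK : ∀ x, ‖V x‖ ≤ K)
    (hdiv : ∀ᵐ x ∂(volume : Measure (Euc d)),
      LinearMap.trace ℝ (Euc d) (fderiv ℝ V x).toLinearMap = 0)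
    {u : Euc d → ℝ} (hu : LipschitzWith D u) (hc : HasCompactSupport u)
    {φ : Euc d → ℝ} (hφ : ContDiff ℝ 2 φ) (hφ0 : ∀ x, 0 ≤ φ x) {l a Λ : ℝ} (hl : 0 < l)
    (hΛ : ∀ y : Euc d, (∀ i, y i ∈ Set.Icc (0:ℝ) l) → ‖y‖ ≤ Λ)
    (ha : ∀ x, ‖(l ^ d)⁻¹ • ∫ y in {y : Euc d | ∀ i, y i ∈ Set.Icc (0:ℝ) l}, V (x + y)‖ ≤ a) :
    |∫ x, φ x * fderiv ℝ u x (V x)| ≤ a * (∫ x, φ x * ‖fderiv ℝ u x‖) +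
      2 * K * Λ * ∫ x, ‖fderiv ℝ φ x‖ * ‖fderiv ℝ u x‖ := by
  have hK0 : 0 ≤ K := (norm_nonneg _).trans (hK 0)
  have hφ1 : ContDiff ℝ 1 φ := hφ.of_le (by norm_num)
  set J := ∫ x, ‖fderiv ℝ φ x‖ * ‖fderiv ℝ u x‖ with hJ
  have hJ0 : 0 ≤ J := integral_nonneg fun x => by positivity
  set Q := {y : Euc d | ∀ i, y i ∈ Set.Icc (0:ℝ) l} with hQ
  have hQc : IsCompact Q := cube_cpt l
  have hQv : volume.real Q = l ^ d := cube_vol hl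
  have hld : 0 < l ^ d := by positivity
  set q : Euc d → ℝ := fun y => ∫ x, φ x * fderiv ℝ u x (V (x + y)) with hq
  have hq1 : ∀ y, q y = - ∫ x, u x * fderiv ℝ φ x (V (x + y)) := fun y =>
    flux_ibp (translate_lip hV y) (fun x => hK _) (translate_div hdiv y) hu hc hφ1
  have hmv : ∀ y, |q y - q 0| ≤ 2 * K * ‖y‖ * J := by
    intro y
    choose N' hN1 hN2 using flux_deriv hV hK hdiv hu hc hφ y
    have := Convex.norm_image_sub_le_of_norm_hasDerivWithin_le
      (f := fun s : ℝ => ∫ x, u x * fderiv ℝ φ x (V (x + s • y))) (f' := N')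
      (C := 2 * K * ‖y‖ * J) (s := Set.univ) (x := 0) (y := 1)
      (fun s _ => (hN1 s).hasDerivWithinAt) (fun s _ => hN2 s) convex_univ trivial trivial
    simp only [one_smul, zero_smul, sub_zero, norm_one, mul_one] at this
    rw [hq1, hq1, ← abs_neg]
    simpa [add_comm, sub_eq_add_neg] using this
  have hint : Integrable (Function.uncurry fun (y x : Euc d) => φ x * fderiv ℝ u x (V (x + y)))
      ((volume.restrict Q).prod volume) := by
    have : IsFiniteMeasure (volume.restrict Q) := ⟨by simpa using hQc.measure_lt_top⟩
    have h1 : Integrable (fun z : Euc d × Euc d => (1:ℝ) * ((φ z.2 * ‖fderiv ℝ u z.2‖) * K))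
        ((volume.restrict Q).prod volume) :=
      (integrable_const (1:ℝ)).mul_prod ((integ_norm hu hc hφ.continuous).mul_const K)
    refine h1.mono' ?_ (Eventually.of_forall fun z => ?_)
    · have hm : Measurable fun z : Euc d × Euc d => fderiv ℝ u z.2 :=
        (measurable_fderiv ℝ u).comp measurable_snd
      have hm2 : Measurable fun z : Euc d × Euc d => V (z.2 + z.1) :=
        hV.continuous.measurable.comp (measurable_snd.add measurable_fst)
      have h := isBoundedBilinearMap_apply (𝕜 := ℝ) (E := Euc d) (F := ℝ)
      exact ((hφ.continuous.measurable.comp measurable_snd).mul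
        (h.continuous.measurable.comp (hm.prodMk hm2))).aestronglyMeasurable
    · simp only [Function.uncurry, norm_mul, one_mul]
      rw [Real.norm_of_nonneg (hφ0 _), mul_assoc]
      refine mul_le_mul_of_nonneg_left ?_ (hφ0 _)
      exact ((fderiv ℝ u z.2).le_opNorm _).trans
        (mul_le_mul_of_nonneg_left (hK _) (norm_nonneg _))
  have hVi : ∀ x, IntegrableOn (fun y => V (x + y)) Q := fun x =>
    ContinuousOn.integrableOn_compact hQc
      (hV.continuous.comp (continuous_const.add continuous_id)).continuousOn
  have hav : ∀ x, ‖∫ y in Q, V (x + y)‖ ≤ l ^ d * a := by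
    intro x
    have := ha x
    rw [norm_smul, Real.norm_of_nonneg (by positivity), inv_mul_le_iff₀ hld] at this
    exact this
  have hI : |∫ y in Q, q y| ≤ l ^ d * (a * ∫ x, φ x * ‖fderiv ℝ u x‖) := by
    have h1 : ∫ y in Q, q y = ∫ x, φ x * fderiv ℝ u x (∫ y in Q, V (x + y)) := by
      rw [hq, integral_integral_swap hint]
      refine integral_congr_ae (Eventually.of_forall fun x => ?_)
      simp only
      rw [integral_const_mul, ContinuousLinearMap.integral_comp_comm _ (hVi x)]
    rw [h1, ← mul_assoc, ← integral_const_mul, ← Real.norm_eq_abs]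
    refine norm_integral_le_of_norm_le ((integ_norm hu hc hφ.continuous).const_mul _)
      (Eventually.of_forall fun x => ?_)
    rw [norm_mul, Real.norm_of_nonneg (hφ0 _)]
    calc _ ≤ φ x * (‖fderiv ℝ u x‖ * (l ^ d * a)) := by
          refine mul_le_mul_of_nonneg_left ?_ (hφ0 _)
          exact ((fderiv ℝ u x).le_opNorm _).trans
            (mul_le_mul_of_nonneg_left (hav x) (norm_nonneg _))
      _ = _ := by ring
  have hqi : IntegrableOn q Q := hint.integral_prod_left
  have hd : |(∫ y in Q, q y) - l ^ d * q 0| ≤ l ^ d * (2 * K * Λ * J) := by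
    have h1 : (∫ y in Q, q y) - l ^ d * q 0 = ∫ y in Q, (q y - q 0) := by
      rw [integral_sub hqi (integrableOn_const hQc.measure_lt_top.ne), setIntegral_const, hQv,
        smul_eq_mul]
    rw [h1]
    have := norm_setIntegral_le_of_norm_le_const (μ := volume) (s := Q) (f := fun y => q y - q 0)
      (C := 2 * K * Λ * J) hQc.measure_lt_top (fun y hy => (hmv y).trans (by
        have := hΛ y hy
        gcongr))
    rw [hQv] at this
    rw [mul_comm]; exact this
  have hq0 : ∫ x, φ x * fderiv ℝ u x (V x) = q 0 := by simp [hq]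
  rw [hq0]
  have h3 : l ^ d * |q 0| ≤ l ^ d * (a * (∫ x, φ x * ‖fderiv ℝ u x‖) + 2 * K * Λ * J) := by
    have e : l ^ d * |q 0| = |l ^ d * q 0| := by rw [abs_mul, abs_of_pos hld]
    rw [e, mul_add]
    have e2 : l ^ d * q 0 = (∫ y in Q, q y) - ((∫ y in Q, q y) - l ^ d * q 0) := by ring
    rw [e2]
    exact (abs_sub _ _).trans (add_le_add hI hd)
  exact le_of_mul_le_mul_left h3 hld


structure Env {d : ℕ} (c : ℝ → Euc d → ℝ) (v : ℝ → Euc d → Euc d)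
    (K L a b l b' h0 θ : ℝ) : Prop where
  hK : ∀ t x, c t x ≤ K ∧ ‖v t x‖ ≤ K
  hb : ∀ t x, b ≤ c t x
  hL : ∀ t x x', ‖v t x - v t x'‖ ≤ L * ‖x - x'‖
  hosc : ∀ t t' x, |t - t'| ≤ h0 → ‖v t x - v t' x‖ ≤ θ
  hdiv : ∀ t, ∀ᵐ x ∂(volume : Measure (Euc d)),
      LinearMap.trace ℝ (Euc d) (fderiv ℝ (v t) x).toLinearMap = 0
  havg : ∀ t x, ‖(l ^ d)⁻¹ • ∫ y in {y : Euc d | ∀ i, y i ∈ Set.Icc (0:ℝ) l}, v t (x + y)‖ ≤ a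
  hL0 : 0 ≤ L
  hl0 : 0 < l
  hb0 : 0 < b'
  hh0 : 0 < h0
  hpar : b' + L * (h0 * (K + b')) + θ ≤ b

theorem Env.rev {d : ℕ} {c : ℝ → Euc d → ℝ} {v : ℝ → Euc d → Euc d} {K L a b l b' h0 θ : ℝ}
    (E : Env c v K L a b l b' h0 θ) :
    Env (fun t x => c (-t) x) (fun t x => - v (-t) x) K L a b l b' h0 θ where
  hK t x := by simpa using E.hK (-t) x
  hb t x := E.hb _ _
  hL t x x' := by
    have := E.hL (-t) x x'
    rwa [neg_sub_neg, norm_sub_rev]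
  hosc t t' x h := by
    rw [neg_sub_neg, norm_sub_rev]
    refine E.hosc _ _ x ?_
    rwa [neg_sub_neg, abs_sub_comm]
  hdiv t := by
    filter_upwards [E.hdiv (-t)] with x hx
    have : (fun x => -v (-t) x) = -(v (-t)) := rfl
    rw [this, fderiv_neg]
    simpa using hx
  havg t x := by
    have := E.havg (-t) x
    rwa [integral_neg, smul_neg, norm_neg]
  hL0 := E.hL0
  hl0 := E.hl0
  hb0 := E.hb0
  hh0 := E.hh0
  hpar := E.hpar

inductive PR {d : ℕ} (v : ℝ → Euc d → Euc d) (h0 b' t0 : ℝ) (x0 : Euc d) : ℝ → Euc d → Prop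
  | refl : PR v h0 b' t0 x0 t0 x0
  | step {t : ℝ} {x : Euc d} {h : ℝ} {x' : Euc d} : PR v h0 b' t0 x0 t x → 0 ≤ h → h ≤ h0 →
      ‖x' - x - h • v t x'‖ ≤ h * b' → PR v h0 b' t0 x0 (t + h) x'

section
variable {d : ℕ} {c : ℝ → Euc d → ℝ} {v : ℝ → Euc d → Euc d} {K L a b l b' h0 θ : ℝ}

theorem step_reach (E : Env c v K L a b l b' h0 θ) {t h : ℝ} {x x' z : Euc d} (h1 : 0 ≤ h)
    (h2 : h ≤ h0) (hz : z = x ∨ z = x') (H : ‖x' - x - h • v t z‖ ≤ h * b') :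
    Reachable c v t x (t + h) x' := by
  rcases h1.eq_or_lt with rfl | hpos
  · have : x' = x := by
      simp at H
      exact sub_eq_zero.1 H
    rw [this, add_zero]; exact reach_refl _ _ _ _
  set g := h⁻¹ • (x' - x) with hg
  have hx' : x' = x + h • g := by
    rw [hg, smul_smul, mul_inv_cancel₀ hpos.ne', one_smul]; abel
  have hgv : ‖g - v t z‖ ≤ b' := by
    have e : x' - x - h • v t z = h • (g - v t z) := by
      rw [hx', smul_sub]; abel
    rw [e, norm_smul, Real.norm_of_nonneg h1] at H
    exact le_of_mul_le_mul_left H hpos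
  have hgn : ‖g‖ ≤ K + b' := by
    have : g = v t z + (g - v t z) := by abel
    rw [this]
    exact (norm_add_le _ _).trans (add_le_add (E.hK t z).2 hgv)
  have hKb : 0 ≤ K + b' := (norm_nonneg _).trans hgn
  rw [hx']
  refine reach_segment h1 fun s hs0 hs1 => ?_
  refine le_trans ?_ (E.hb _ _)
  have e : g - v (t + s) (x + s • g) = (g - v t z) + (v t z - v t (x + s • g))
    + (v t (x + s • g) - v (t + s) (x + s • g)) := by abel
  rw [e]
  have hd : ‖z - (x + s • g)‖ ≤ h0 * (K + b') := by
    have : ∃ r : ℝ, |r| ≤ h0 ∧ z - (x + s • g) = r • g := by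
      rcases hz with rfl | rfl
      · exact ⟨-s, by rw [abs_neg, abs_of_nonneg hs0]; linarith, by rw [neg_smul]; abel⟩
      · exact ⟨h - s, by rw [abs_of_nonneg (by linarith)]; linarith, by
          rw [sub_smul]; nth_rewrite 1 [hx']; abel⟩
    obtain ⟨r, hr, e⟩ := this
    rw [e, norm_smul]
    exact mul_le_mul hr hgn (norm_nonneg _) E.hh0.le
  have i1 : ‖v t z - v t (x + s • g)‖ ≤ L * (h0 * (K + b')) :=
    (E.hL _ _ _).trans (mul_le_mul_of_nonneg_left hd E.hL0)
  have i2 : ‖v t (x + s • g) - v (t + s) (x + s • g)‖ ≤ θ := by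
    refine E.hosc _ _ _ ?_
    rw [sub_add_cancel_left, abs_neg, abs_of_nonneg hs0]; linarith
  exact (norm_add₃_le).trans (by linarith [E.hpar])

theorem PR.reach (E : Env c v K L a b l b' h0 θ) {t0 t : ℝ} {x0 x : Euc d}
    (H : PR v h0 b' t0 x0 t x) : Reachable c v t0 x0 t x := by
  induction H with
  | refl => exact reach_refl _ _ _ _
  | step _ h1 h2 h3 ih => exact reach_trans ih (step_reach E h1 h2 (Or.inr rfl) h3)

theorem PR.dist (E : Env c v K L a b l b' h0 θ) {t0 t : ℝ} {x0 x : Euc d}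
    (H : PR v h0 b' t0 x0 t x) : ‖x - x0‖ ≤ (K + b') * (t - t0) := by
  induction H with
  | refl => simp
  | @step t x h x' _ h1 h2 h3 ih =>
    have e : x' - x0 = (x - x0) + h • v t x' + (x' - x - h • v t x') := by abel
    rw [e]
    refine (norm_add₃_le).trans ?_
    have : ‖h • v t x'‖ ≤ h * K := by
      rw [norm_smul, Real.norm_of_nonneg h1]
      exact mul_le_mul_of_nonneg_left (E.hK _ _).2 h1
    linarith

theorem PR.pull (E : Env c v K L a b l b' h0 θ) {t0 t : ℝ} {x0 x : Euc d}
    (H : PR v h0 b' t0 x0 t x) : ∀ y : Euc d, ∃ y0, PR v h0 b' t0 y0 t y ∧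
      ‖y0 - x0‖ ≤ Real.exp (L * (t - t0)) * ‖y - x‖ := by
  induction H with
  | refl => intro y; exact ⟨y, PR.refl, by simp⟩
  | @step t x h x' _ h1 h2 h3 ih =>
    intro y'
    obtain ⟨y0, p, hy0⟩ := ih (x + (y' - x') - h • (v t y' - v t x'))
    refine ⟨y0, p.step h1 h2 ?_, hy0.trans ?_⟩
    · have e : y' - (x + (y' - x') - h • (v t y' - v t x')) - h • v t y' = x' - x - h • v t x' := by
        rw [smul_sub]; abel
      rwa [e]
    · have e : x + (y' - x') - h • (v t y' - v t x') - x = (y' - x') - h • (v t y' - v t x') := by abel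
      rw [e]
      have i1 : ‖(y' - x') - h • (v t y' - v t x')‖ ≤ (1 + L * h) * ‖y' - x'‖ := by
        refine (norm_sub_le _ _).trans ?_
        rw [norm_smul, Real.norm_of_nonneg h1]
        have := mul_le_mul_of_nonneg_left (E.hL t y' x') h1
        linarith
      have i2 : 1 + L * h ≤ Real.exp (L * h) := by
        have := Real.add_one_le_exp (L * h); linarith
      have e2 : Real.exp (L * (t + h - t0)) = Real.exp (L * (t - t0)) * Real.exp (L * h) := by
        rw [← Real.exp_add]; ring_nf
      rw [e2, mul_assoc]
      refine mul_le_mul_of_nonneg_left (i1.trans ?_) (Real.exp_pos _).le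
      exact mul_le_mul_of_nonneg_right i2 (norm_nonneg _)

/-- the subsolution -/
def bump {d : ℕ} (q : Euc d) (r : ℝ) (x : Euc d) : ℝ := max 0 (1 - ‖x - q‖ / r)

def subsol (v : ℝ → Euc d → Euc d) (h0 b' t0 : ℝ) (q : Euc d) (r : ℝ) (t : ℝ) (x : Euc d) : ℝ :=
  sSup {s | ∃ y, PR v h0 b' t0 y t x ∧ s = bump q r y}

theorem bump_nonneg (q : Euc d) (r : ℝ) (x : Euc d) : 0 ≤ bump q r x := le_max_left _ _
theorem bump_le_one (q : Euc d) {r : ℝ} (hr : 0 < r) (x : Euc d) : bump q r x ≤ 1 :=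
  max_le zero_le_one (by have := div_nonneg (norm_nonneg (x - q)) hr.le; linarith)
theorem bump_pos (q : Euc d) {r : ℝ} (hr : 0 < r) (x : Euc d) (h : 0 < bump q r x) :
    ‖x - q‖ < r := by
  by_contra hn
  push Not at hn
  have : bump q r x = 0 := max_eq_left (by
    have : 1 ≤ ‖x - q‖ / r := by rwa [le_div_iff₀ hr, one_mul]
    linarith)
  linarith
theorem bump_sub (q : Euc d) {r : ℝ} (hr : 0 < r) (x y : Euc d) :
    bump q r x ≤ bump q r y + r⁻¹ * ‖x - y‖ := by
  have h1 : ‖y - q‖ ≤ ‖x - q‖ + ‖x - y‖ := by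
    have : y - q = (x - q) - (x - y) := by abel
    rw [this]; exact norm_sub_le _ _
  have h2 : 1 - ‖y - q‖ / r ≤ bump q r y := le_max_right _ _
  have h3 := div_le_div_of_nonneg_right h1 hr.le
  rw [add_div, div_eq_inv_mul ‖x - y‖] at h3
  refine max_le ?_ (by linarith)
  have := bump_nonneg q r y
  positivity

variable {t0 r : ℝ} {q : Euc d}

theorem subsol_bdd (hr : 0 < r) (t : ℝ) (x : Euc d) :
    BddAbove {s | ∃ y, PR v h0 b' t0 y t x ∧ s = bump q r y} :=
  ⟨1, by rintro _ ⟨y, _, rfl⟩; exact bump_le_one q hr y⟩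

theorem subsol_nonneg (t : ℝ) (x : Euc d) : 0 ≤ subsol v h0 b' t0 q r t x :=
  Real.sSup_nonneg (by rintro _ ⟨y, _, rfl⟩; exact bump_nonneg q r y)

theorem subsol_le_one (hr : 0 < r) (t : ℝ) (x : Euc d) : subsol v h0 b' t0 q r t x ≤ 1 :=
  Real.sSup_le (by rintro _ ⟨y, _, rfl⟩; exact bump_le_one q hr y) zero_le_one

theorem subsol_pos (hr : 0 < r) {t : ℝ} {x : Euc d} (h : 0 < subsol v h0 b' t0 q r t x) :
    ∃ y, ‖y - q‖ < r ∧ PR v h0 b' t0 y t x := by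
  by_contra hn
  push Not at hn
  have : subsol v h0 b' t0 q r t x ≤ 0 := by
    refine Real.sSup_le ?_ le_rfl
    rintro _ ⟨y, hy, rfl⟩
    by_contra h'
    push Not at h'
    exact hn y (bump_pos q hr y h') hy
  linarith

theorem subsol_init (hr : 0 < r) (x : Euc d) : bump q r x ≤ subsol v h0 b' t0 q r t0 x :=
  le_csSup (subsol_bdd hr _ _) ⟨x, PR.refl, rfl⟩

theorem subsol_step (hr : 0 < r) {t h : ℝ} (h1 : 0 ≤ h) (h2 : h ≤ h0) {x e : Euc d}
    (he : ‖e‖ ≤ b') : subsol v h0 b' t0 q r t (x - h • (v t x + e)) ≤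
      subsol v h0 b' t0 q r (t + h) x := by
  refine Real.sSup_le ?_ (subsol_nonneg _ _)
  rintro _ ⟨y, hy, rfl⟩
  refine le_csSup (subsol_bdd hr _ _) ⟨y, hy.step h1 h2 ?_, rfl⟩
  have : x - (x - h • (v t x + e)) - h • v t x = h • e := by rw [smul_add]; abel
  rw [this, norm_smul, Real.norm_of_nonneg h1]
  exact mul_le_mul_of_nonneg_left he h1

theorem subsol_lip0 (E : Env c v K L a b l b' h0 θ) (hr : 0 < r) {t : ℝ} (x y : Euc d) :
    subsol v h0 b' t0 q r t x ≤ subsol v h0 b' t0 q r t y +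
      (r⁻¹ * Real.exp (L * (t - t0))) * ‖x - y‖ := by
  refine Real.sSup_le ?_ (by have := subsol_nonneg (v := v) (h0 := h0) (b' := b') (t0 := t0) (q := q) (r := r) t y; positivity)
  rintro _ ⟨x0, hx0, rfl⟩
  obtain ⟨y0, hy0, hd⟩ := hx0.pull E y
  have h1 : bump q r y0 ≤ subsol v h0 b' t0 q r t y := le_csSup (subsol_bdd hr _ _) ⟨y0, hy0, rfl⟩
  have h2 := bump_sub q hr x0 y0
  rw [norm_sub_rev x0 y0] at h2
  rw [norm_sub_rev y x] at hd
  have h3 := mul_le_mul_of_nonneg_left hd (inv_pos.2 hr).le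
  linarith

theorem subsol_lip (E : Env c v K L a b l b' h0 θ) (hr : 0 < r) (t : ℝ) :
    LipschitzWith (Real.toNNReal (r⁻¹ * Real.exp (L * (t - t0)))) (subsol v h0 b' t0 q r t) := by
  refine LipschitzWith.of_dist_le_mul fun x y => ?_
  rw [Real.dist_eq, dist_eq_norm, Real.coe_toNNReal _ (by positivity), abs_le]
  have h1 := subsol_lip0 (q := q) (t0 := t0) E hr (t := t) x y
  have h2 := subsol_lip0 (q := q) (t0 := t0) E hr (t := t) y x
  rw [norm_sub_rev y x] at h2
  constructor <;> linarith

theorem subsol_supp (E : Env c v K L a b l b' h0 θ) (hr : 0 < r) {t T : ℝ} (hT : t ≤ T)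
    {x : Euc d} (hx : x ∉ closedBall q (r + (K + b') * (T - t0))) :
    subsol v h0 b' t0 q r t x = 0 := by
  by_contra h
  obtain ⟨y, hy, hp⟩ := subsol_pos hr (lt_of_le_of_ne (subsol_nonneg _ _) (Ne.symm h))
  apply hx
  have h1 := hp.dist E
  have hK : 0 ≤ K + b' := by
    have := (norm_nonneg _).trans (E.hK 0 0).2
    linarith [E.hb0]
  rw [mem_closedBall, dist_eq_norm]
  have e : x - q = (x - y) + (y - q) := by abel
  rw [e]
  have h2 : (K + b') * (t - t0) ≤ (K + b') * (T - t0) := mul_le_mul_of_nonneg_left (by linarith) hK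
  linarith [norm_add_le (x - y) (y - q)]

theorem subsol_cpt (E : Env c v K L a b l b' h0 θ) (hr : 0 < r) (t : ℝ) :
    HasCompactSupport (subsol v h0 b' t0 q r t) :=
  HasCompactSupport.intro (isCompact_closedBall q (r + (K + b') * (t - t0)))
    fun _ hx => subsol_supp E hr le_rfl hx

end


theorem growth_sup {f : ℝ → ℝ} {t1 T α C h0 : ℝ} (hT : t1 ≤ T) (hh0 : 0 < h0) (hC0 : 0 ≤ C)
    (hC : ∀ s t, t1 ≤ s → s ≤ t → t ≤ T → t - s ≤ h0 → f s - C * (t - s) ≤ f t)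
    (hg : ∀ t, t1 ≤ t → t < T → ∀ e > 0, ∀ᶠ h in nhdsWithin (0:ℝ) (Set.Ioi 0),
      f t + h * (α - e) ≤ f (t + h)) : f t1 + α * (T - t1) ≤ f T := by
  have main : ∀ e > 0, f t1 + (α - e) * (T - t1) ≤ f T := by
    intro e he
    set A := {t | t1 ≤ t ∧ t ≤ T ∧ f t1 + (α - e) * (t - t1) ≤ f t} with hA
    have hA1 : t1 ∈ A := ⟨le_rfl, hT, by simp⟩
    have hAb : BddAbove A := ⟨T, fun t ht => ht.2.1⟩
    set s := sSup A with hs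
    have hs1 : t1 ≤ s := le_csSup hAb hA1
    have hsT : s ≤ T := csSup_le ⟨t1, hA1⟩ fun t ht => ht.2.1
    have hsA : f t1 + (α - e) * (s - t1) ≤ f s := by
      refine le_of_forall_pos_le_add fun κ hκ => ?_
      set B := |α - e| + C + 1 with hB
      have hBp : 0 < B := by positivity
      obtain ⟨t, ht, hlt⟩ := exists_lt_of_lt_csSup ⟨t1, hA1⟩
        (show s - min h0 (κ / B) < s by have : 0 < min h0 (κ / B) := by positivity
                                        linarith)
      have hts : t ≤ s := le_csSup hAb ht
      have h1 := hC t s ht.1 hts hsT (by linarith [min_le_left h0 (κ / B)])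
      have h2 : s - t ≤ κ / B := by linarith [min_le_right h0 (κ / B)]
      have h3 : B * (s - t) ≤ κ := by rwa [le_div_iff₀ hBp, mul_comm] at h2
      have h4 : (α - e) * (s - t) ≤ |α - e| * (s - t) :=
        mul_le_mul_of_nonneg_right (le_abs_self _) (by linarith)
      have h5 := ht.2.2
      have h6 : B * (s - t) = |α - e| * (s - t) + C * (s - t) + (s - t) := by rw [hB]; ring
      nlinarith
    rcases hsT.eq_or_lt with h | h
    · rw [h] at hsA; exact hsA
    · exfalso
      have h1 := hg s hs1 h e he
      have h2 : ∀ᶠ h in nhdsWithin (0:ℝ) (Set.Ioi 0), h < T - s :=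
        nhdsWithin_le_nhds (Iio_mem_nhds (by linarith))
      have h3 : ∀ᶠ h in nhdsWithin (0:ℝ) (Set.Ioi 0), 0 < h := self_mem_nhdsWithin
      obtain ⟨k, hk1, hk2, hk3⟩ := (h1.and (h2.and h3)).exists
      have : s + k ∈ A := ⟨by linarith, by linarith, by nlinarith⟩
      linarith [le_csSup hAb this]
  refine le_of_forall_pos_le_add fun κ hκ => ?_
  have := main (κ / (T - t1 + 1)) (by have : 0 < T - t1 + 1 := by linarith
                                      positivity)
  have h2 : κ / (T - t1 + 1) * (T - t1) ≤ κ := by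
    rw [div_mul_eq_mul_div, div_le_iff₀ (by linarith)]
    nlinarith
  linarith

theorem exists_dir {d : ℕ} (f : Euc d →L[ℝ] ℝ) {b : ℝ} (hb : 0 ≤ b) :
    ∃ e : Euc d, ‖e‖ ≤ b ∧ f e = - (b * ‖f‖) := by
  set g := (InnerProductSpace.toDual ℝ (Euc d)).symm f with hg
  have hn : ‖g‖ = ‖f‖ := by simp [hg]
  have hf : ∀ x, f x = inner ℝ g x := fun x => by simp [hg]
  by_cases h : ‖g‖ = 0
  · exact ⟨0, by simpa using hb, by rw [← hn, h]; simp⟩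
  · refine ⟨-(b / ‖g‖) • g, ?_, ?_⟩
    · rw [norm_smul, norm_neg, norm_div, norm_norm, div_mul_cancel₀ _ h, Real.norm_of_nonneg hb]
    · rw [hf, inner_smul_right, real_inner_self_eq_norm_sq, ← hn]
      field_simp

section
variable {d : ℕ} {c : ℝ → Euc d → ℝ} {v : ℝ → Euc d → Euc d} {K L a b l b' h0 θ : ℝ}
  {t0 r : ℝ} {q : Euc d} {φ : Euc d → ℝ}

theorem int_phi_U (E : Env c v K L a b l b' h0 θ) (hr : 0 < r) (hφi : Integrable φ) (t : ℝ) :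
    Integrable (fun x => φ x * subsol v h0 b' t0 q r t x) := by
  refine hφi.mul_bdd (c := 1) (subsol_lip E hr t).continuous.aestronglyMeasurable
    (Eventually.of_forall fun x => ?_)
  rw [Real.norm_of_nonneg (subsol_nonneg _ _)]
  exact subsol_le_one hr t x

theorem subsol_low (E : Env c v K L a b l b' h0 θ) (hr : 0 < r) {s t : ℝ} (hst : s ≤ t)
    (hh : t - s ≤ h0) (x : Euc d) :
    subsol v h0 b' t0 q r s x - (r⁻¹ * Real.exp (L * (s - t0))) * K * (t - s) ≤
      subsol v h0 b' t0 q r t x := by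
  have h1 := subsol_step (v := v) (t0 := t0) (q := q) hr (t := s) (h := t - s) (x := x) (e := 0) (by linarith) hh
    (by simpa using E.hb0.le)
  rw [add_sub_cancel, add_zero] at h1
  have h2 := subsol_lip0 (t0 := t0) (q := q) E hr (t := s) x (x - (t - s) • v s x)
  have h3 : ‖x - (x - (t - s) • v s x)‖ ≤ K * (t - s) := by
    rw [sub_sub_cancel, norm_smul, Real.norm_of_nonneg (by linarith), mul_comm]
    exact mul_le_mul_of_nonneg_right (E.hK _ _).2 (by linarith)
  have h4 := mul_le_mul_of_nonneg_left h3
    (show 0 ≤ r⁻¹ * Real.exp (L * (s - t0)) by positivity)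
  linarith

theorem mass_low (E : Env c v K L a b l b' h0 θ) (hr : 0 < r) (hφi : Integrable φ)
    (hφ0 : ∀ x, 0 ≤ φ x) {s t T : ℝ} (hst : s ≤ t) (htT : t ≤ T)
    (hh : t - s ≤ h0) :
    (∫ x, φ x * subsol v h0 b' t0 q r s x) -
      ((r⁻¹ * Real.exp (L * (T - t0))) * K * ∫ x, φ x) * (t - s) ≤
      ∫ x, φ x * subsol v h0 b' t0 q r t x := by
  have hK0 : 0 ≤ K := (norm_nonneg _).trans (E.hK 0 0).2
  have e : ((r⁻¹ * Real.exp (L * (T - t0))) * K * ∫ x, φ x) * (t - s) =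
      ∫ x, φ x * ((r⁻¹ * Real.exp (L * (T - t0))) * K * (t - s)) := by
    rw [integral_mul_const]; ring
  rw [e, ← integral_sub (int_phi_U E hr hφi s) (hφi.mul_const _)]
  refine integral_mono ((int_phi_U E hr hφi s).sub (hφi.mul_const _)) (int_phi_U E hr hφi t) ?_
  intro x
  simp only
  rw [← mul_sub]
  refine mul_le_mul_of_nonneg_left ?_ (hφ0 x)
  have h1 := subsol_low (t0 := t0) (q := q) E hr hst hh x
  have h2 : Real.exp (L * (s - t0)) ≤ Real.exp (L * (T - t0)) :=
    Real.exp_le_exp.2 (mul_le_mul_of_nonneg_left (by linarith) E.hL0)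
  have h3 : (r⁻¹ * Real.exp (L * (s - t0))) * K * (t - s) ≤
      (r⁻¹ * Real.exp (L * (T - t0))) * K * (t - s) := by
    have : 0 ≤ t - s := by linarith
    gcongr
  linarith

theorem env_lip (E : Env c v K L a b l b' h0 θ) (t : ℝ) : LipschitzWith (Real.toNNReal L) (v t) := by
  refine LipschitzWith.of_dist_le_mul fun x y => ?_
  rw [dist_eq_norm, dist_eq_norm, Real.coe_toNNReal _ E.hL0]
  exact E.hL t x y

theorem mass_grow (E : Env c v K L a b l b' h0 θ) (hr : 0 < r) (hφi : Integrable φ)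
    (hφc : Continuous φ) (hφ0 : ∀ x, 0 ≤ φ x) (t : ℝ) {e : ℝ} (he : 0 < e) :
    ∀ᶠ h in nhdsWithin (0:ℝ) (Set.Ioi 0),
      (∫ x, φ x * subsol v h0 b' t0 q r t x) +
      h * ((∫ x, φ x * (b' * ‖fderiv ℝ (subsol v h0 b' t0 q r t) x‖ -
          fderiv ℝ (subsol v h0 b' t0 q r t) x (v t x))) - e) ≤
      ∫ x, φ x * subsol v h0 b' t0 q r (t + h) x := by
  have hK0 : 0 ≤ K := (norm_nonneg _).trans (E.hK 0 0).2
  have hb0 := E.hb0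
  set U := subsol v h0 b' t0 q r with hU
  set D := r⁻¹ * Real.exp (L * (t - t0)) with hD
  have hD0 : 0 ≤ D := by positivity
  have hlip : LipschitzWith (Real.toNNReal D) (U t) := subsol_lip E hr t
  have hfd : ∀ x, ‖fderiv ℝ (U t) x‖ ≤ D := fun x => by
    have := norm_fderiv_le_of_lipschitz ℝ (x₀ := x) hlip
    rwa [Real.coe_toNNReal _ hD0] at this
  set G : Euc d → ℝ := fun x => φ x * (b' * ‖fderiv ℝ (U t) x‖ - fderiv ℝ (U t) x (v t x)) with hG
  set F : ℝ → Euc d → ℝ := fun h x => φ x * ((U (t + h) x - U t x) / h) with hF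
  have hGb : ∀ x, ‖G x‖ ≤ φ x * (D * (b' + K)) := by
    intro x
    rw [hG, norm_mul, Real.norm_of_nonneg (hφ0 x)]
    refine mul_le_mul_of_nonneg_left ?_ (hφ0 x)
    refine (norm_sub_le _ _).trans ?_
    have h1 : ‖b' * ‖fderiv ℝ (U t) x‖‖ ≤ b' * D := by
      rw [norm_mul, norm_norm, Real.norm_of_nonneg hb0.le]
      exact mul_le_mul_of_nonneg_left (hfd x) hb0.le
    have h2 : ‖fderiv ℝ (U t) x (v t x)‖ ≤ D * K :=
      ((fderiv ℝ (U t) x).le_opNorm _).trans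
        (mul_le_mul (hfd x) (E.hK t x).2 (norm_nonneg _) hD0)
    linarith
  have hGm : Measurable G := by
    have h := isBoundedBilinearMap_apply (𝕜 := ℝ) (E := Euc d) (F := ℝ)
    have hm := measurable_fderiv ℝ (U t)
    exact hφc.measurable.mul ((hm.norm.const_mul b').sub
      (h.continuous.measurable.comp (hm.prodMk (env_lip E t).continuous.measurable)))
  have hFm : ∀ h, Continuous (F h) := fun h => by
    have h1 : Continuous (U (t + h)) := (subsol_lip E hr _).continuous
    have h2 : Continuous (U t) := hlip.continuous
    exact hφc.mul ((h1.sub h2).div_const h)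
  have hsmall : ∀ᶠ h in nhdsWithin (0:ℝ) (Set.Ioi 0), 0 < h ∧ h ≤ h0 := by
    have h2 : ∀ᶠ h in nhdsWithin (0:ℝ) (Set.Ioi 0), h ≤ h0 :=
      nhdsWithin_le_nhds (Iic_mem_nhds E.hh0)
    have h3 : ∀ᶠ h in nhdsWithin (0:ℝ) (Set.Ioi 0), 0 < h := self_mem_nhdsWithin
    exact h3.and h2
  have hFlow : ∀ h, 0 < h → h ≤ h0 → ∀ x, - (φ x * (D * (b' + K))) ≤ F h x := by
    intro h hh1 hh2 x
    have h1 := subsol_low (t0 := t0) (q := q) E hr (s := t) (t := t + h) (by linarith) (by linarith) x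
    rw [← mul_neg]
    refine mul_le_mul_of_nonneg_left ?_ (hφ0 x)
    rw [le_div_iff₀ hh1]
    have h2 : 0 ≤ D * b' * h := by positivity
    rw [add_sub_cancel_left] at h1
    linarith
  have hmin : Tendsto (fun h => ∫ x, min (F h x) (G x)) (nhdsWithin (0:ℝ) (Set.Ioi 0))
      (nhds (∫ x, G x)) := by
    refine tendsto_integral_filter_of_dominated_convergence (fun x => φ x * (D * (b' + K)))
      ?_ ?_ (hφi.mul_const _) ?_
    · exact Eventually.of_forall fun h =>
        ((hFm h).measurable.min hGm).aestronglyMeasurable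
    · filter_upwards [hsmall] with h hh
      refine Eventually.of_forall fun x => ?_
      rw [Real.norm_eq_abs, abs_le]
      have := abs_le.1 (hGb x)
      exact ⟨le_min (hFlow h hh.1 hh.2 x) this.1, (min_le_right _ _).trans this.2⟩
    · have hae : ∀ᵐ x : Euc d, DifferentiableAt ℝ (U t) x := hlip.ae_differentiableAt
      filter_upwards [hae] with x hx
      obtain ⟨w, hw1, hw2⟩ := exists_dir (fderiv ℝ (U t) x) hb0.le
      have hline : HasDerivAt (fun h : ℝ => x - h • (v t x + w)) (-(v t x + w)) 0 := by
        have := ((hasDerivAt_id (0:ℝ)).smul_const (v t x + w)).const_sub x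
        simpa using this
      have hd : HasDerivAt (fun h : ℝ => U t (x - h • (v t x + w)))
          (fderiv ℝ (U t) x (-(v t x + w))) 0 := by
        have h1 : HasFDerivAt (U t) (fderiv ℝ (U t) x) (x - (0:ℝ) • (v t x + w)) := by
          simpa using hx.hasFDerivAt
        exact h1.comp_hasDerivAt 0 hline
      have hval : fderiv ℝ (U t) x (-(v t x + w)) =
          b' * ‖fderiv ℝ (U t) x‖ - fderiv ℝ (U t) x (v t x) := by
        rw [map_neg, map_add, hw2]; ring
      have hsl := hd.tendsto_slope_zero_right
      simp only [zero_add, zero_smul, sub_zero, hval] at hsl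
      have hsl2 := (hsl.const_mul (φ x)).min (tendsto_const_nhds (x := G x))
      have hGx : φ x * (b' * ‖fderiv ℝ (U t) x‖ - fderiv ℝ (U t) x (v t x)) = G x := rfl
      rw [hGx, min_self] at hsl2
      refine tendsto_of_tendsto_of_tendsto_of_le_of_le' hsl2 tendsto_const_nhds ?_ ?_
      · filter_upwards [hsmall] with h hh
        refine min_le_min_right _ (mul_le_mul_of_nonneg_left ?_ (hφ0 x))
        rw [smul_eq_mul, ← div_eq_inv_mul]
        refine div_le_div_of_nonneg_right ?_ hh.1.le
        have := subsol_step (v := v) (t0 := t0) (q := q) hr (t := t) (x := x) hh.1.le hh.2 hw1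
        simp only [hU]
        linarith
      · exact Eventually.of_forall fun h => min_le_right _ _
  have hev := hmin.eventually (lt_mem_nhds (show (∫ x, G x) - e < ∫ x, G x by linarith))
  filter_upwards [hev, hsmall] with h h1 h2
  have hFi : Integrable (F h) := by
    have := ((int_phi_U (t0 := t0) (q := q) E hr hφi (t + h)).sub (int_phi_U (t0 := t0) (q := q) E hr hφi t)).mul_const h⁻¹
    refine this.congr (Eventually.of_forall fun x => ?_)
    simp only [hF, hU, Pi.sub_apply]
    rw [div_eq_mul_inv]; ring
  have hGi : Integrable G := (hφi.mul_const _).mono' hGm.aestronglyMeasurable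
    (Eventually.of_forall hGb)
  have h3 : ∫ x, min (F h x) (G x) ≤ ∫ x, F h x :=
    integral_mono (hFi.inf hGi) hFi fun x => min_le_left _ _
  have h4 : ∫ x, F h x = ((∫ x, φ x * U (t + h) x) - ∫ x, φ x * U t x) / h := by
    rw [← integral_sub (int_phi_U E hr hφi _) (int_phi_U E hr hφi _), div_eq_mul_inv,
      ← integral_mul_const]
    refine integral_congr_ae (Eventually.of_forall fun x => ?_)
    simp only [hF]
    rw [div_eq_mul_inv]; ring
  have h5 : (∫ x, G x) - e ≤ ((∫ x, φ x * U (t + h) x) - ∫ x, φ x * U t x) / h := by linarith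
  rw [le_div_iff₀ h2.1] at h5
  linarith

theorem mass_main (E : Env c v K L a b l b' h0 θ) (hr : 0 < r) (hφi : Integrable φ)
    (hφ2 : ContDiff ℝ 2 φ) (hφ0 : ∀ x, 0 ≤ φ x) {κ Λ : ℝ}
    (hΛ : ∀ y : Euc d, (∀ i, y i ∈ Set.Icc (0:ℝ) l) → ‖y‖ ≤ Λ)
    (hκ : ∀ x, ‖fderiv ℝ φ x‖ ≤ κ * φ x)
    (hσ : 0 ≤ b' - a - 2 * K * Λ * κ) {s T α : ℝ} (hsT : s ≤ T)
    (hα : ∀ t, s ≤ t → t ≤ T → α ≤ ∫ x, φ x * ‖fderiv ℝ (subsol v h0 b' t0 q r t) x‖) :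
    (∫ x, φ x * subsol v h0 b' t0 q r s x) + (b' - a - 2 * K * Λ * κ) * α * (T - s) ≤
      ∫ x, φ x * subsol v h0 b' t0 q r T x := by
  have hK0 : 0 ≤ K := (norm_nonneg _).trans (E.hK 0 0).2
  have hΛ0 : 0 ≤ Λ := (norm_nonneg _).trans (hΛ 0 fun i => ⟨le_rfl, E.hl0.le⟩)
  have hΦ : 0 ≤ ∫ x, φ x := integral_nonneg hφ0
  refine growth_sup (f := fun t => ∫ x, φ x * subsol v h0 b' t0 q r t x)
    (C := (r⁻¹ * Real.exp (L * (T - t0))) * K * ∫ x, φ x) hsT E.hh0 (by positivity) ?_ ?_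
  · intro s' t' _ h2 h3 h4
    exact mass_low E hr hφi hφ0 h2 h3 h4
  · intro t ht1 ht2 e he
    filter_upwards [mass_grow (t0 := t0) (q := q) E hr hφi hφ2.continuous hφ0 t he, self_mem_nhdsWithin] with h hh hpos
    refine le_trans ?_ hh
    have hpos' : 0 < h := hpos
    refine add_le_add le_rfl (mul_le_mul_of_nonneg_left (sub_le_sub_right ?_ e) hpos'.le)
    set U := subsol v h0 b' t0 q r t with hU
    have hlip := subsol_lip (t0 := t0) (q := q) E hr t
    have hc := subsol_cpt (t0 := t0) (q := q) E hr t
    have i1 := integ_norm hlip hc hφ2.continuous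
    have i2 := integ_prod hlip hc hφ2.continuous (env_lip E t).continuous.measurable
      (fun x => (E.hK t x).2)
    have i3 := integ_norm hlip hc (hφ2.continuous_fderiv two_ne_zero).norm
    have e1 : ∫ x, φ x * (b' * ‖fderiv ℝ U x‖ - fderiv ℝ U x (v t x)) =
        b' * (∫ x, φ x * ‖fderiv ℝ U x‖) - ∫ x, φ x * fderiv ℝ U x (v t x) := by
      rw [← integral_const_mul, ← integral_sub (i1.const_mul b') i2]
      refine integral_congr_ae (Eventually.of_forall fun x => ?_)
      simp only; ring
    have e2 := (abs_le.1 (flux (env_lip E t) (fun x => (E.hK t x).2) (E.hdiv t) hlip hc hφ2 hφ0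
      E.hl0 hΛ (E.havg t))).2
    have e3 : ∫ x, ‖fderiv ℝ φ x‖ * ‖fderiv ℝ U x‖ ≤ κ * ∫ x, φ x * ‖fderiv ℝ U x‖ := by
      rw [← integral_const_mul]
      refine integral_mono i3 (i1.const_mul κ) fun x => ?_
      have := mul_le_mul_of_nonneg_right (hκ x) (norm_nonneg (fderiv ℝ U x))
      simp only; linarith
    have e4 := mul_le_mul_of_nonneg_left e3 (show 0 ≤ 2 * K * Λ by positivity)
    have e5 := mul_le_mul_of_nonneg_left (hα t ht1 ht2.le) hσ
    rw [e1]
    linarith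
end


theorem weight_exists (d : ℕ) {κ : ℝ} (hκ : 0 < κ) : ∃ φ : Euc d → ℝ, ContDiff ℝ 2 φ ∧
    Integrable φ ∧ (∀ x, 0 < φ x) ∧ (∀ x, φ x ≤ 1) ∧ ∀ x, ‖fderiv ℝ φ x‖ ≤ κ * φ x := by
  set ε : ℝ := κ / (d + 1) with hε
  have hεp : 0 < ε := by positivity
  set A : Euc d → ℝ := fun x => 1 + ε ^ 2 * ‖x‖ ^ 2 with hA
  have hA1 : ∀ x, 1 ≤ A x := fun x => by
    have : 0 ≤ ε ^ 2 * ‖x‖ ^ 2 := by positivity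
    simp only [hA]; linarith
  have hA0 : ∀ x, 0 < A x := fun x => by linarith [hA1 x]
  have hAd : ContDiff ℝ 2 A := contDiff_const.add (contDiff_const.mul (contDiff_norm_sq ℝ))
  refine ⟨fun x => (A x ^ (d + 1))⁻¹, ?_, ?_, ?_, ?_, ?_⟩
  · exact (hAd.pow _).inv fun x => (pow_pos (hA0 x) _).ne'
  · have h1 : Integrable (fun x : Euc d => (1 + ‖x‖ ^ 2) ^ (-(2 * ((d:ℝ) + 1)) / 2)) :=
      integrable_rpow_neg_one_add_norm_sq (by simp; linarith [Nat.cast_nonneg (α := ℝ) d])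
    have h2 := h1.comp_smul hεp.ne'
    refine h2.congr (Eventually.of_forall fun x => ?_)
    simp only
    have e1 : -(2 * ((d:ℝ) + 1)) / 2 = -((d + 1 : ℕ) : ℝ) := by push_cast; ring
    have e2 : 1 + ‖ε • x‖ ^ 2 = A x := by
      simp only [hA]
      rw [norm_smul, Real.norm_of_nonneg hεp.le, mul_pow]
    rw [e1, e2, Real.rpow_neg (hA0 x).le, Real.rpow_natCast]
  · intro x; exact inv_pos.2 (pow_pos (hA0 x) _)
  · intro x; exact inv_le_one_of_one_le₀ (one_le_pow₀ (hA1 x))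
  · intro x
    have hAx : HasFDerivAt A (ε ^ 2 • (2 • innerSL ℝ x)) x := by
      have h1 := (hasStrictFDerivAt_norm_sq x).hasFDerivAt
      exact (h1.const_mul (ε ^ 2)).const_add 1
    have hpow := HasFDerivAt.pow hAx (d + 1)
    have hinv := (hasDerivAt_inv (pow_pos (hA0 x) (d + 1)).ne').comp_hasFDerivAt x hpow
    have hf : fderiv ℝ (fun x => (A x ^ (d + 1))⁻¹) x = _ := hinv.fderiv
    rw [hf]
    have hn : ‖(ε ^ 2 • (2 • innerSL ℝ x) : Euc d →L[ℝ] ℝ)‖ ≤ ε * A x := by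
      rw [norm_smul, Real.norm_of_nonneg (by positivity)]
      have h2 : ‖(2 • innerSL ℝ x : Euc d →L[ℝ] ℝ)‖ ≤ 2 * ‖x‖ := by
        refine (norm_nsmul_le).trans ?_
        rw [innerSL_apply_norm]; norm_num
      refine (mul_le_mul_of_nonneg_left h2 (by positivity)).trans ?_
      simp only [hA]
      nlinarith [sq_nonneg (ε * ‖x‖ - 1)]
    have hAp := pow_pos (hA0 x) (d + 1)
    have hAp' := pow_pos (hA0 x) d
    rw [norm_smul, norm_neg, norm_inv, norm_pow, Real.norm_of_nonneg hAp.le]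
    have h3 : ‖(((d + 1 : ℕ) • A x ^ (d + 1 - 1)) • (ε ^ 2 • (2 • innerSL ℝ x)) : Euc d →L[ℝ] ℝ)‖ ≤
        ((d:ℝ) + 1) * A x ^ d * (ε * A x) := by
      rw [norm_smul]
      refine mul_le_mul (le_of_eq ?_) hn (norm_nonneg _) (by positivity)
      rw [Real.norm_of_nonneg (by positivity)]
      simp
    refine (mul_le_mul_of_nonneg_left h3 (by positivity)).trans (le_of_eq ?_)
    have : ε * (d + 1) = κ := by rw [hε]; field_simp
    rw [← this]
    field_simp
    rw [pow_succ]

theorem cont_min {d : ℕ} {φ : Euc d → ℝ} (hc : Continuous φ) (hp : ∀ x, 0 < φ x) (ρ : ℝ) :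
    ∃ m > 0, ∀ x : Euc d, ‖x‖ ≤ ρ → m ≤ φ x := by
  rcases (closedBall (0 : Euc d) ρ).eq_empty_or_nonempty with h | h
  · refine ⟨1, one_pos, fun x hx => ?_⟩
    have : x ∈ closedBall (0 : Euc d) ρ := by simpa using hx
    rw [h] at this; exact absurd this (Set.notMem_empty _)
  · obtain ⟨x, _, hx⟩ := (isCompact_closedBall (0 : Euc d) ρ).exists_isMinOn h hc.continuousOn
    exact ⟨φ x, hp x, fun y hy => hx (by simpa using hy)⟩

theorem tail_small {d : ℕ} {φ : Euc d → ℝ} (hi : Integrable φ) {e : ℝ} (he : 0 < e) :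
    ∃ R > 0, (∫ x, φ x) - e ≤ ∫ x in ball (0 : Euc d) R, φ x := by
  have h := tendsto_setIntegral_of_monotone (μ := volume) (f := φ) (s := fun n : ℕ => ball (0 : Euc d) n)
    (fun n => measurableSet_ball) (fun m n hmn => ball_subset_ball (by exact_mod_cast hmn))
    hi.integrableOn
  rw [iUnion_ball_nat, setIntegral_univ] at h
  have h1 := h.eventually (lt_mem_nhds (show (∫ x, φ x) - e < ∫ x, φ x by linarith))
  obtain ⟨n, hn1, hn2⟩ := (h1.and (eventually_gt_atTop 0)).exists
  exact ⟨n, by exact_mod_cast hn2, hn1.le⟩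

theorem bump_integrable {d : ℕ} (q : Euc d) {r : ℝ} (hr : 0 < r) : Integrable (bump q r) := by
  refine Continuous.integrable_of_hasCompactSupport ?_ ?_
  · unfold bump; fun_prop
  · refine HasCompactSupport.intro (isCompact_closedBall q r) fun x hx => ?_
    by_contra h
    have := bump_pos q hr x (lt_of_le_of_ne (bump_nonneg _ _ _) (Ne.symm h))
    apply hx; rw [mem_closedBall, dist_eq_norm]; exact this.le

theorem bump_int_eq {d : ℕ} (q : Euc d) (r : ℝ) : ∫ x, bump q r x = ∫ x, bump (0 : Euc d) r x := by
  rw [← integral_sub_right_eq_self (bump (0 : Euc d) r) q]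
  simp [bump]

theorem bump_int_pos {d : ℕ} {r : ℝ} (hr : 0 < r) : 0 < ∫ x, bump (0 : Euc d) r x := by
  rw [integral_pos_iff_support_of_nonneg (fun x => bump_nonneg _ _ _) (bump_integrable 0 hr)]
  have hsub : ball (0 : Euc d) r ⊆ Function.support (bump (0 : Euc d) r) := by
    intro x hx
    rw [mem_ball_zero_iff] at hx
    have : 0 < 1 - ‖x - 0‖ / r := by
      rw [sub_zero, sub_pos, div_lt_one hr]; exact hx
    exact (lt_of_lt_of_le this (le_max_right _ _)).ne'
  exact lt_of_lt_of_le (measure_ball_pos _ _ hr) (measure_mono hsub)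

theorem ball_mass {d : ℕ} {φ f : Euc d → ℝ} (hφi : Integrable φ) (hφ0 : ∀ x, 0 ≤ φ x)
    (hφ1 : ∀ x, φ x ≤ 1) (hf : Continuous f) (hf0 : ∀ x, 0 ≤ f x) (hf1 : ∀ x, f x ≤ 1)
    {p : Euc d} {R m0 : ℝ} (hm : m0 ≤ ∫ x, φ x * f x)
    (ht : (∫ x, φ x) - m0 / 2 ≤ ∫ x in ball p R, φ x) : m0 / 2 ≤ ∫ x in ball p R, f x := by
  have hi : Integrable (fun x => φ x * f x) := hφi.mul_bdd (c := 1) hf.aestronglyMeasurable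
    (Eventually.of_forall fun x => by rw [Real.norm_of_nonneg (hf0 x)]; exact hf1 x)
  have h1 := integral_add_compl (μ := volume) (measurableSet_ball (x := p) (ε := R)) hi
  have h2 := integral_add_compl (μ := volume) (measurableSet_ball (x := p) (ε := R)) hφi
  have h3 : ∫ x in (ball p R)ᶜ, φ x * f x ≤ ∫ x in (ball p R)ᶜ, φ x :=
    setIntegral_mono hi.integrableOn hφi.integrableOn fun x =>
      mul_le_of_le_one_right (hφ0 x) (hf1 x)
  have hfi : IntegrableOn f (ball p R) :=
    (hf.continuousOn.integrableOn_compact (isCompact_closedBall p R)).mono_set ball_subset_closedBall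
  have h4 : ∫ x in ball p R, φ x * f x ≤ ∫ x in ball p R, f x :=
    setIntegral_mono hi.integrableOn hfi fun x => mul_le_of_le_one_left (hf0 x) (hφ1 x)
  linarith

section
variable {d : ℕ} {K L a b l b' h0 θ : ℝ}

theorem start_reach {c : ℝ → Euc d → ℝ} {v : ℝ → Euc d → Euc d}
    (E : Env c v K L a b l b' h0 θ) {t0 t : ℝ} {x0 x : Euc d}
    (h : 0 < subsol v h0 b' (t0 + h0) (x0 + h0 • v t0 x0) (h0 * b') t x) :
    Reachable c v t0 x0 t x := by
  obtain ⟨y, hy, hp⟩ := subsol_pos (mul_pos E.hh0 E.hb0) h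
  refine reach_trans (step_reach E (z := x0) E.hh0.le le_rfl (Or.inl rfl) ?_) (hp.reach E)
  rw [sub_sub]; exact hy.le

theorem mass_init {c : ℝ → Euc d → ℝ} {v : ℝ → Euc d → Euc d}
    (E : Env c v K L a b l b' h0 θ) {φ : Euc d → ℝ} (hφi : Integrable φ)
    (hφ2 : ContDiff ℝ 2 φ) (hφ0 : ∀ x, 0 ≤ φ x) {κ Λ : ℝ}
    (hΛ : ∀ y : Euc d, (∀ i, y i ∈ Set.Icc (0:ℝ) l) → ‖y‖ ≤ Λ)
    (hκ : ∀ x, ‖fderiv ℝ φ x‖ ≤ κ * φ x)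
    (hσ : 0 ≤ b' - a - 2 * K * Λ * κ) {m : ℝ} {q : Euc d} {r t1 t : ℝ} (hr : 0 < r)
    (hm : ∀ x, ‖x - q‖ ≤ r → m ≤ φ x) (ht : t1 ≤ t) :
    m * (∫ x, bump (0 : Euc d) r x) ≤ ∫ x, φ x * subsol v h0 b' t1 q r t x := by
  have h1 := mass_main (t0 := t1) (q := q) E hr hφi hφ2 hφ0 hΛ hκ hσ ht (α := 0)
    (fun s _ _ => integral_nonneg fun x => mul_nonneg (hφ0 x) (norm_nonneg _))
  have h2 : m * (∫ x, bump (0 : Euc d) r x) ≤ ∫ x, φ x * subsol v h0 b' t1 q r t1 x := by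
    rw [← bump_int_eq q, ← integral_const_mul]
    refine integral_mono ((bump_integrable q hr).const_mul m) (int_phi_U E hr hφi t1) fun x => ?_
    simp only
    by_cases hb : 0 < bump q r x
    · exact mul_le_mul (hm x (bump_pos q hr x hb).le) (subsol_init hr x) hb.le (hφ0 x)
    · have : bump q r x = 0 := le_antisymm (not_lt.1 hb) (bump_nonneg _ _ _)
      rw [this, mul_zero]
      exact mul_nonneg (hφ0 x) (subsol_nonneg _ _)
  simp only [mul_zero, zero_mul, add_zero] at h1
  linarith

theorem unit_reach (hab : a < b') (hK0 : 0 ≤ K) (hh0 : 0 < h0) (hb0 : 0 < b') : ∃ T0 > 0,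
    ∀ (c : ℝ → Euc d → ℝ) (v : ℝ → Euc d → Euc d), Env c v K L a b l b' h0 θ →
    ∀ t0 x0 x1 T, ‖x1 - x0‖ ≤ 1 → T0 ≤ T → Reachable c v t0 x0 (t0 + T) x1 := by
  obtain ⟨Λ0, hΛ0⟩ := (cube_cpt (d := d) l).isBounded.exists_norm_le
  set Λ := max Λ0 0 with hΛd
  have hΛp : 0 ≤ Λ := le_max_right _ _
  have hΛ : ∀ y : Euc d, (∀ i, y i ∈ Set.Icc (0:ℝ) l) → ‖y‖ ≤ Λ :=
    fun y hy => (hΛ0 y hy).trans (le_max_left _ _)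
  set κ := (b' - a) / (2 * (2 * K * Λ + 1)) with hκd
  have hκp : 0 < κ := div_pos (by linarith) (by positivity)
  set σ := b' - a - 2 * K * Λ * κ with hσd
  have hσ : 0 < σ := by
    have : 2 * K * Λ * κ ≤ (b' - a) / 2 := by
      rw [hκd, mul_div_assoc', div_le_div_iff₀ (by positivity) two_pos]
      have : 0 ≤ 2 * K * Λ := by positivity
      nlinarith
    linarith
  obtain ⟨φ0, hC2, hi, hp, h1, hκ⟩ := weight_exists d hκp
  set r := h0 * b' with hrd
  have hr : 0 < r := mul_pos hh0 hb0
  obtain ⟨mφ, hmφ, hmφ'⟩ := cont_min hC2.continuous hp (1 + h0 * K + r)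
  set m0 := mφ * ∫ x, bump (0 : Euc d) r x with hm0d
  have hm0 : 0 < m0 := mul_pos hmφ (bump_int_pos hr)
  obtain ⟨R, hR, htail⟩ := tail_small hi (half_pos hm0)
  obtain ⟨m3, hm3, hm3'⟩ := cont_min hC2.continuous hp (3 * R)
  set CR := 2 * R * (volume (ball (0 : Euc d) (2 * R))).toReal with hCR
  have hCR0 : 0 ≤ CR := by positivity
  set β := m3 * ((m0 / 2) * (m0 / 2) / (CR + 1)) with hβd
  have hβ : 0 < β := by positivity
  set Φ := ∫ x, φ0 x with hΦ
  have hΦ0 : 0 ≤ Φ := integral_nonneg fun x => (hp x).le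
  refine ⟨2 * h0 + Φ / (σ * β) + 1, by positivity, ?_⟩
  intro c v E t0 x0 x1 T hx hT
  by_contra hn
  have hrec := div_nonneg hΦ0 (mul_pos hσ hβ).le
  -- translated weight
  set φ : Euc d → ℝ := fun x => φ0 (x - x0) with hφd
  have φi : Integrable φ := hi.comp_sub_right x0
  have φ2 : ContDiff ℝ 2 φ := hC2.comp (contDiff_id.sub contDiff_const)
  have φ0' : ∀ x, 0 ≤ φ x := fun x => (hp _).le
  have φ1 : ∀ x, φ x ≤ 1 := fun x => h1 _
  have φκ : ∀ x, ‖fderiv ℝ φ x‖ ≤ κ * φ x := fun x => by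
    have : fderiv ℝ φ x = fderiv ℝ φ0 (x - x0) := by
      rw [hφd]; exact fderiv_comp_sub (f := φ0) x0
    rw [this]; exact hκ _
  have φΦ : ∫ x, φ x = Φ := integral_sub_right_eq_self φ0 x0
  have φtail : (∫ x, φ x) - m0 / 2 ≤ ∫ x in ball x0 R, φ x := by
    rw [φΦ]
    refine htail.trans (le_of_eq ?_)
    rw [← integral_indicator measurableSet_ball, ← integral_indicator measurableSet_ball,
      ← integral_sub_right_eq_self _ x0]
    refine integral_congr_ae (Eventually.of_forall fun x => ?_)
    simp only [Set.indicator, mem_ball, dist_eq_norm, sub_zero, hφd]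
  set E' := E.rev with hE'
  set v' : ℝ → Euc d → Euc d := fun t x => - v (-t) x with hv'
  set q := x0 + h0 • v t0 x0 with hq
  set q' := x1 + h0 • v' (-(t0 + T)) x1 with hq'
  set U := subsol v h0 b' (t0 + h0) q r with hU
  set W := subsol v' h0 b' (-(t0 + T) + h0) q' r with hW
  have hmq : ∀ x, ‖x - q‖ ≤ r → mφ ≤ φ x := by
    intro x hxq
    refine hmφ' _ ?_
    have e : x - x0 = (x - q) + h0 • v t0 x0 := by rw [hq]; abel
    have e2 : ‖h0 • v t0 x0‖ ≤ h0 * K := by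
      rw [norm_smul, Real.norm_of_nonneg hh0.le]
      exact mul_le_mul_of_nonneg_left (E.hK _ _).2 hh0.le
    rw [e]
    linarith [norm_add_le (x - q) (h0 • v t0 x0)]
  have hmq' : ∀ x, ‖x - q'‖ ≤ r → mφ ≤ φ x := by
    intro x hxq
    refine hmφ' _ ?_
    have e : x - x0 = (x - q') + h0 • v' (-(t0 + T)) x1 + (x1 - x0) := by rw [hq']; abel
    have e2 : ‖h0 • v' (-(t0 + T)) x1‖ ≤ h0 * K := by
      rw [norm_smul, Real.norm_of_nonneg hh0.le]
      exact mul_le_mul_of_nonneg_left (E'.hK _ _).2 hh0.le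
    rw [e]
    linarith [norm_add₃_le (a := x - q') (b := h0 • v' (-(t0 + T)) x1) (c := x1 - x0)]
  have hmU : ∀ t, t0 + h0 ≤ t → m0 ≤ ∫ x, φ x * U t x := fun t ht =>
    mass_init E φi φ2 φ0' hΛ φκ hσ.le hr hmq ht
  have hmW : ∀ t, -(t0 + T) + h0 ≤ t → m0 ≤ ∫ x, φ x * W t x := fun t ht =>
    mass_init E' φi φ2 φ0' hΛ φκ hσ.le hr hmq' ht
  have hdisj : ∀ t x, U t x = 0 ∨ W (-t) x = 0 := by
    intro t x
    by_contra hcon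
    push Not at hcon
    have hu : 0 < U t x := lt_of_le_of_ne (subsol_nonneg _ _) (Ne.symm hcon.1)
    have hw : 0 < W (-t) x := lt_of_le_of_ne (subsol_nonneg _ _) (Ne.symm hcon.2)
    have r1 := start_reach E hu
    have r2 := reach_rev (start_reach E' hw)
    exact hn (reach_trans r1 r2)
  have hgrad : ∀ t, t0 + h0 ≤ t → t ≤ t0 + T - h0 → β ≤ ∫ x, φ x * ‖fderiv ℝ (U t) x‖ := by
    intro t ht1 ht2
    have hUl := subsol_lip (t0 := t0 + h0) (q := q) E hr t
    have hWl := subsol_lip (t0 := -(t0 + T) + h0) (q := q') E' hr (-t)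
    have b1 := ball_mass φi φ0' φ1 hUl.continuous (subsol_nonneg t) (subsol_le_one hr t)
      (hmU t ht1) φtail
    have b2 := ball_mass φi φ0' φ1 hWl.continuous (subsol_nonneg (-t)) (subsol_le_one hr (-t))
      (hmW (-t) (by linarith)) φtail
    have b3 := poinc hUl hWl.continuous (subsol_nonneg t) (subsol_nonneg (-t))
      (subsol_le_one hr (-t)) (hdisj t) x0 hR
    have b4 := (mul_le_mul b1 b2 (by positivity) (le_trans (by positivity) b1)).trans b3
    set J := ∫ x in ball x0 (3 * R), ‖fderiv ℝ (U t) x‖ with hJ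
    have hJ0 : 0 ≤ J := integral_nonneg fun x => norm_nonneg _
    have b5 : m0 / 2 * (m0 / 2) / (CR + 1) ≤ J := by
      rw [div_le_iff₀ (by positivity)]
      refine b4.trans ?_
      rw [mul_comm]
      exact mul_le_mul_of_nonneg_left (by linarith) hJ0
    have hUc := subsol_cpt (t0 := t0 + h0) (q := q) E hr t
    have i1 := integ_norm hUl hUc φ2.continuous
    have i2 : Integrable (fun x => m3 * ‖fderiv ℝ (U t) x‖) :=
      integ_norm hUl hUc continuous_const
    calc β ≤ m3 * J := mul_le_mul_of_nonneg_left b5 hm3.le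
      _ = ∫ x in ball x0 (3 * R), m3 * ‖fderiv ℝ (U t) x‖ := by rw [integral_const_mul]
      _ ≤ ∫ x in ball x0 (3 * R), φ x * ‖fderiv ℝ (U t) x‖ := by
          refine setIntegral_mono_on i2.integrableOn i1.integrableOn measurableSet_ball ?_
          intro x hx
          refine mul_le_mul_of_nonneg_right (hm3' _ ?_) (norm_nonneg _)
          rw [mem_ball, dist_eq_norm] at hx
          exact hx.le
      _ ≤ _ := setIntegral_le_integral i1
          (Eventually.of_forall fun x => mul_nonneg (φ0' x) (norm_nonneg _))
  have hfin := mass_main (t0 := t0 + h0) (q := q) E hr φi φ2 φ0' hΛ φκ hσ.le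
    (s := t0 + h0) (T := t0 + T - h0) (by linarith) hgrad
  have hup : ∫ x, φ x * U (t0 + T - h0) x ≤ Φ := by
    rw [← φΦ]
    exact integral_mono (int_phi_U E hr φi _) φi fun x =>
      mul_le_of_le_one_right (φ0' x) (subsol_le_one hr _ x)
  have hm := hmU (t0 + h0) le_rfl
  have hlast : Φ ≤ σ * β * (t0 + T - h0 - (t0 + h0)) := by
    have : Φ / (σ * β) ≤ t0 + T - h0 - (t0 + h0) := by linarith
    rwa [div_le_iff₀ (mul_pos hσ hβ), mul_comm] at this
  linarith

theorem full_reach (hab : a < b') (hK0 : 0 ≤ K) (hh0 : 0 < h0) (hb0 : 0 < b') : ∃ M0 > 0,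
    ∀ (c : ℝ → Euc d → ℝ) (v : ℝ → Euc d → Euc d), Env c v K L a b l b' h0 θ →
    ∀ t0 x0 x1 T, M0 * (1 + ‖x1 - x0‖) ≤ T → Reachable c v t0 x0 (t0 + T) x1 := by
  obtain ⟨T0, hT0, H⟩ := unit_reach (d := d) (K := K) (L := L) (a := a) (b := b) (l := l)
    (b' := b') (h0 := h0) (θ := θ) hab hK0 hh0 hb0
  refine ⟨T0, hT0, fun c v E => ?_⟩
  have key : ∀ n : ℕ, ∀ t0 x0 x1 T, ‖x1 - x0‖ ≤ n + 1 → T0 * (n + 1) ≤ T →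
      Reachable c v t0 x0 (t0 + T) x1 := by
    intro n
    induction n with
    | zero => intro t0 x0 x1 T h1 h2; exact H c v E _ _ _ _ (by simpa using h1) (by simpa using h2)
    | succ n ih =>
      intro t0 x0 x1 T h1 h2
      push_cast at h1 h2
      set z := x0 + (1 / ((n:ℝ) + 1 + 1)) • (x1 - x0) with hz
      have hn : (0:ℝ) < (n:ℝ) + 1 + 1 := by positivity
      have r1 : Reachable c v t0 x0 (t0 + T0) z := by
        refine H c v E _ _ _ _ ?_ le_rfl
        rw [hz, add_sub_cancel_left, norm_smul, Real.norm_of_nonneg (by positivity),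
          div_mul_eq_mul_div, one_mul, div_le_one hn]
        exact h1
      have r2 : Reachable c v (t0 + T0) z (t0 + T0 + (T - T0)) x1 := by
        refine ih _ _ _ _ ?_ (by linarith)
        have e : x1 - z = (((n:ℝ) + 1) / ((n:ℝ) + 1 + 1)) • (x1 - x0) := by
          have : (((n:ℝ) + 1) / ((n:ℝ) + 1 + 1)) = 1 - 1 / ((n:ℝ) + 1 + 1) := by field_simp; ring
          rw [this, hz, sub_smul, one_smul]; abel
        rw [e, norm_smul, Real.norm_of_nonneg (by positivity), div_mul_eq_mul_div,
          div_le_iff₀ hn]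
        exact mul_le_mul_of_nonneg_left h1 (by positivity)
      have := reach_trans r1 r2
      rwa [add_assoc, add_sub_cancel] at this
  intro t0 x0 x1 T hT
  refine key ⌊‖x1 - x0‖⌋₊ t0 x0 x1 T (Nat.lt_floor_add_one _).le (le_trans ?_ hT)
  refine mul_le_mul_of_nonneg_left ?_ hT0.le
  have := Nat.floor_le (norm_nonneg (x1 - x0))
  linarith
end


theorem limit_reach {d : ℕ} {c : ℝ → Euc d → ℝ} {v : ℝ → Euc d → Euc d} {γ : ℝ → Euc d}
    {C : NNReal} (hγ : LipschitzWith C γ) {t0 t1 : ℝ} (h01 : t0 ≤ t1)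
    (H : ∀ s, t0 < s → s < t1 → ∀ η > 0, ∃ δ > 0, ∀ s', s < s' → s' < s + δ → s' < t1 →
      ‖γ s' - γ s - (s' - s) • v s (γ s)‖ ≤ (s' - s) * (c s (γ s) + η)) :
    Reachable c v t0 (γ t0) t1 (γ t1) := by
  have hdm : Measurable (deriv γ) := measurable_deriv γ
  have hii : ∀ a b : ℝ, IntervalIntegrable (deriv γ) volume a b := by
    intro a b
    refine IntervalIntegrable.mono_fun' (g := fun _ => (C : ℝ)) (by simp)
      hdm.aestronglyMeasurable (Eventually.of_forall fun s => ?_)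
    exact norm_deriv_le_of_lipschitz hγ
  have hae : ∀ᵐ s : ℝ, DifferentiableAt ℝ γ s := hγ.ae_differentiableAt
  refine ⟨h01, γ, deriv γ, hii _ _, ?_, rfl, ?_⟩
  · intro t ht
    rw [← sub_eq_iff_eq_add']
    ext i
    have e1 : (∫ s in t0..t, deriv γ s) i = ∫ s in t0..t, (deriv γ s) i := by
      have := (EuclideanSpace.proj i : Euc d →L[ℝ] ℝ).intervalIntegral_comp_comm (hii t0 t)
      exact this.symm
    have hli : LipschitzWith C (fun s => γ s i) := by
      refine LipschitzWith.of_dist_le_mul fun x y => ?_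
      refine le_trans ?_ (hγ.dist_le_mul x y)
      rw [dist_eq_norm, dist_eq_norm]
      exact (PiLp.norm_apply_le (γ x - γ y) i)
    have hac : AbsolutelyContinuousOnInterval (fun s => γ s i) t0 t :=
      hli.lipschitzOnWith.absolutelyContinuousOnInterval
    have e2 := hac.integral_deriv_eq_sub
    rw [e1]
    show γ t i - γ t0 i = _
    rw [← e2]
    refine intervalIntegral.integral_congr_ae ?_
    filter_upwards [hae] with s hs _
    have := (EuclideanSpace.proj i : Euc d →L[ℝ] ℝ).hasFDerivAt.comp_hasDerivAt s hs.hasDerivAt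
    exact this.deriv
  · rw [ae_restrict_iff' measurableSet_Icc]
    have hne : ∀ᵐ s : ℝ, s ≠ t0 ∧ s ≠ t1 := by
      have h1 : ∀ᵐ s : ℝ, s ≠ t0 := by simp [ae_iff]
      have h2 : ∀ᵐ s : ℝ, s ≠ t1 := by simp [ae_iff]
      exact h1.and h2
    filter_upwards [hae, hne] with s hs hne hI
    have hs0 : t0 < s := lt_of_le_of_ne hI.1 (Ne.symm hne.1)
    have hs1 : s < t1 := lt_of_le_of_ne hI.2 hne.2
    refine le_of_forall_pos_le_add fun η hη => ?_
    obtain ⟨δ, hδ, hH⟩ := H s hs0 hs1 η hη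
    have hsl := hs.hasDerivAt.tendsto_slope_zero_right
    have hsl2 := (hsl.sub_const (v s (γ s))).norm
    refine le_of_tendsto hsl2 ?_
    have h2 : ∀ᶠ h in nhdsWithin (0:ℝ) (Set.Ioi 0), h < min δ (t1 - s) :=
      nhdsWithin_le_nhds (Iio_mem_nhds (lt_min hδ (by linarith)))
    filter_upwards [h2, self_mem_nhdsWithin] with h hh hpos
    have hpos' : 0 < h := hpos
    have := hH (s + h) (by linarith) (by linarith [min_le_left δ (t1 - s)])
      (by linarith [min_le_right δ (t1 - s)])
    rw [add_sub_cancel_left] at this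
    have e : γ (s + h) - γ s - h • v s (γ s) = h • (h⁻¹ • (γ (s + h) - γ s) - v s (γ s)) := by
      rw [smul_sub, smul_smul, mul_inv_cancel₀ hpos'.ne', one_smul]
    rw [e, norm_smul, Real.norm_of_nonneg hpos'.le] at this
    exact le_of_mul_le_mul_left this hpos'

section
variable {d : ℕ}

def IsChain' (c : ℝ → Euc d → ℝ) (v : ℝ → Euc d → Euc d) (h e t0 : ℝ) (m : ℕ) (Z : ℕ → Euc d) :
    Prop := ∀ i < m, ‖Z (i + 1) - Z i - h • v (t0 + i * h) (Z i)‖ ≤ h * (c (t0 + i * h) (Z i) + e)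

theorem chain_est {c : ℝ → Euc d → ℝ} {v : ℝ → Euc d → Euc d} {h e t0 : ℝ} {m : ℕ}
    {Z : ℕ → Euc d} (hZ : IsChain' c v h e t0 m Z) (hh : 0 ≤ h) {i i' : ℕ} (hi : i ≤ i')
    (hm : i' ≤ m) {w : Euc d} {A : ℝ}
    (hA : ∀ j, i ≤ j → j < i' → c (t0 + j * h) (Z j) + e + ‖v (t0 + j * h) (Z j) - w‖ ≤ A) :
    ‖Z i' - Z i - (((i':ℝ) - i) * h) • w‖ ≤ ((i':ℝ) - i) * h * A := by
  induction i', hi using Nat.le_induction with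
  | base => simp
  | succ n hn ih =>
    have h1 := ih (by omega) (fun j h1 h2 => hA j h1 (by omega))
    have h2 := hZ n (by omega)
    have h3 := hA n hn (by omega)
    have e1 : Z (n + 1) - Z i - ((((n + 1 : ℕ):ℝ) - i) * h) • w =
        (Z n - Z i - (((n:ℝ) - i) * h) • w) + (Z (n + 1) - Z n - h • v (t0 + n * h) (Z n)) +
          h • (v (t0 + n * h) (Z n) - w) := by
      have : ((((n + 1 : ℕ):ℝ) - i) * h) = ((n:ℝ) - i) * h + h := by push_cast; ring
      rw [this, add_smul, smul_sub]; abel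
    rw [e1]
    refine (norm_add₃_le).trans ?_
    rw [norm_smul, Real.norm_of_nonneg hh]
    push_cast
    have h4 := mul_le_mul_of_nonneg_left h3 hh
    nlinarith

def chainP (c : ℝ → Euc d → ℝ) (v : ℝ → Euc d → Euc d) (h e t0 : ℝ) (x0 : Euc d) :
    ℕ → Euc d → Prop
  | 0, z => ‖z - x0‖ ≤ e
  | i + 1, z' => ∃ j : ℕ, chainP c v h e t0 x0 i (TopologicalSpace.denseSeq (Euc d) j) ∧
      ‖z' - TopologicalSpace.denseSeq (Euc d) j
        - h • v (t0 + i * h) (TopologicalSpace.denseSeq (Euc d) j)‖ ≤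
        h * (c (t0 + i * h) (TopologicalSpace.denseSeq (Euc d) j) + e)

theorem chainP_chain {c : ℝ → Euc d → ℝ} {v : ℝ → Euc d → Euc d} {h e t0 : ℝ} {x0 : Euc d} {m : ℕ}
    {z : Euc d} (H : chainP c v h e t0 x0 m z) :
    ∃ Z : ℕ → Euc d, Z m = z ∧ ‖Z 0 - x0‖ ≤ e ∧ IsChain' c v h e t0 m Z := by
  induction m generalizing z with
  | zero => exact ⟨fun _ => z, rfl, H, fun i hi => absurd hi (by omega)⟩
  | succ m ih =>
    obtain ⟨j, h1, h2⟩ := H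
    obtain ⟨Z, e1, e2, e3⟩ := ih h1
    refine ⟨fun i => if i ≤ m then Z i else z, by simp, by simpa using e2, ?_⟩
    intro i hi
    rcases (Nat.lt_succ_iff.1 hi).eq_or_lt with rfl | hlt
    · simp only [le_refl, if_true]
      rw [if_neg (by omega), e1]; exact h2
    · beta_reduce
      rw [if_pos (by omega), if_pos (by omega)]
      exact e3 i hlt

theorem chainP_meas {Ω : Type*} {c : ℝ → Euc d → Ω → ℝ} {v : ℝ → Euc d → Ω → Euc d}
    {𝒢 : MeasurableSpace Ω} {h e t0 : ℝ} {x0 : Euc d} {m : ℕ}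
    (hG : ∀ i < m, ∀ z, Measurable[𝒢] (c (t0 + i * h) z) ∧ Measurable[𝒢] (v (t0 + i * h) z))
    (z : Euc d) :
    MeasurableSet[𝒢] {ω | chainP (fun a b => c a b ω) (fun a b => v a b ω) h e t0 x0 m z} := by
  induction m generalizing z with
  | zero => simp only [chainP]; exact MeasurableSet.const _
  | succ m ih =>
    simp only [chainP]
    rw [Set.ofPred_exists]
    refine MeasurableSet.iUnion fun j => ?_
    rw [Set.ofPred_and]
    refine (ih (fun i hi z => hG i (by omega) z) _).inter ?_
    obtain ⟨h1, h2⟩ := hG m (by omega) (TopologicalSpace.denseSeq (Euc d) j)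
    refine measurableSet_le ?_ ?_
    · exact (measurable_const.sub (h2.const_smul h)).norm
    · exact (h1.add_const e).const_mul h
end


structure Nice {d : ℕ} (c : ℝ → Euc d → ℝ) (v : ℝ → Euc d → Euc d) (K L : ℝ) : Prop where
  hK : ∀ t x, c t x ≤ K ∧ ‖v t x‖ ≤ K
  hc : ∀ t x, 0 ≤ c t x
  hL : ∀ t x x', |c t x - c t x'| ≤ L * ‖x - x'‖ ∧ ‖v t x - v t x'‖ ≤ L * ‖x - x'‖
  hL0 : 0 ≤ L
  hosc : ∀ ε > 0, ∃ δ > 0, ∀ t t' : ℝ, |t - t'| ≤ δ → ∀ x,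
    |c t x - c t' x| ≤ ε ∧ ‖v t x - v t' x‖ ≤ ε

section
variable {d : ℕ} {c : ℝ → Euc d → ℝ} {v : ℝ → Euc d → Euc d} {K L : ℝ}

theorem Nice.K0 (N : Nice c v K L) : 0 ≤ K := (N.hc 0 0).trans (N.hK 0 0).1

theorem Nice.osc (N : Nice c v K L) {ε : ℝ} (hε : 0 < ε) : ∃ δ > 0, ∀ t t' : ℝ, |t - t'| ≤ δ →
    ∀ x x' : Euc d, c t x + ‖v t x - v t' x'‖ ≤ c t' x' + ε + 2 * L * ‖x - x'‖ := by
  obtain ⟨δ, hδ, H⟩ := N.hosc (ε/2) (by positivity)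
  refine ⟨δ, hδ, fun t t' htt x x' => ?_⟩
  obtain ⟨h1, h2⟩ := H t t' htt x
  obtain ⟨h3, h4⟩ := N.hL t' x x'
  have h5 : ‖v t x - v t' x'‖ ≤ ‖v t x - v t' x‖ + ‖v t' x - v t' x'‖ := norm_sub_le_norm_sub_add_norm_sub _ _ _
  have h6 := (abs_le.1 h1).2
  have h7 := (abs_le.1 h3).2
  linarith

theorem dense_near (x : Euc d) {e : ℝ} (he : 0 < e) :
    ∃ j, ‖TopologicalSpace.denseSeq (Euc d) j - x‖ ≤ e := by
  obtain ⟨j, hy⟩ := (TopologicalSpace.denseRange_denseSeq (Euc d)).exists_dist_lt x he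
  exact ⟨j, by rw [← dist_eq_norm, dist_comm]; exact hy.le⟩

theorem chain_of_reach (N : Nice c v K L) {t0 r : ℝ} {x0 x : Euc d} (hr : 0 < r)
    (H : ∀ e' > 0, ∃ t, 0 ≤ t ∧ t < r + e' ∧ Reachable c v t0 x0 (t0 + t) x) {e : ℝ} (he : 0 < e) :
    ∃ n : ℕ, 1 ≤ n ∧ r / n ≤ e ∧ ∃ m ≤ n, ∃ j : ℕ,
      chainP c v (r / n) e t0 x0 m (TopologicalSpace.denseSeq (Euc d) j) ∧
      ‖TopologicalSpace.denseSeq (Euc d) j - x‖ ≤ e := by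
  have hK0 := N.K0
  have hL0 := N.hL0
  obtain ⟨δ, hδ, hosc⟩ := N.osc (ε := e/4) (by positivity)
  -- choose n
  obtain ⟨n0, hn0⟩ := exists_nat_gt (r / min (min e δ) (e / (16 * (L * K + K + 1))))
  set B := min (min e δ) (e / (16 * (L * K + K + 1))) with hB
  have hB0 : 0 < B := by positivity
  have hn1 : 0 < (n0:ℝ) := lt_of_le_of_lt (by positivity) hn0
  have hn1' : 1 ≤ n0 := by exact_mod_cast hn1
  set h := r / n0 with hh
  have hh0 : 0 < h := by positivity
  have hhB : h ≤ B := by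
    rw [hh, div_le_iff₀ hn1]
    rw [div_lt_iff₀ hB0] at hn0
    linarith [mul_comm B (n0:ℝ)]
  have hhe : h ≤ e := hhB.trans ((min_le_left _ _).trans (min_le_left _ _))
  have hhδ : h ≤ δ := hhB.trans ((min_le_left _ _).trans (min_le_right _ _))
  have hhK : 16 * (L * K + K + 1) * h ≤ e := by
    have := hhB.trans (min_le_right _ _)
    rw [le_div_iff₀ (by positivity)] at this
    linarith
  have hLKh : 0 ≤ L * K * h := by positivity
  have hKh : 0 ≤ K * h := by positivity
  set e' := min (min (e/4) (h * e / 16)) (e / (16 * (L + K + 1))) with he'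
  have he'0 : 0 < e' := by positivity
  have he1 : e' ≤ e / 4 := (min_le_left _ _).trans (min_le_left _ _)
  have he2 : e' ≤ h * e / 16 := (min_le_left _ _).trans (min_le_right _ _)
  have he3 : 16 * (L + K + 1) * e' ≤ e := by
    have : e' ≤ e / (16 * (L + K + 1)) := min_le_right _ _
    rw [le_div_iff₀ (by positivity)] at this
    linarith
  have hLe : 0 ≤ L * e' := by positivity
  have hKe : 0 ≤ K * e' := by positivity
  have h9 : 2 * L * (2 * K * h + e') ≤ e / 2 := by
    have a1 : 2 * L * (2 * K * h + e') = 4 * (L * K * h) + 2 * (L * e') := by ring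
    have a2 : 16 * (L * K + K + 1) * h = 16 * (L * K * h) + 16 * (K * h) + 16 * h := by ring
    have a3 : 16 * (L + K + 1) * e' = 16 * (L * e') + 16 * (K * e') + 16 * e' := by ring
    linarith
  have h9' : 2 * K * (h + e') ≤ e / 2 := by
    have a1 : 2 * K * (h + e') = 2 * (K * h) + 2 * (K * e') := by ring
    have a2 : 16 * (L * K + K + 1) * h = 16 * (L * K * h) + 16 * (K * h) + 16 * h := by ring
    have a3 : 16 * (L + K + 1) * e' = 16 * (L * e') + 16 * (K * e') + 16 * e' := by ring
    linarith
  refine ⟨n0, hn1', hhe, ?_⟩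
  obtain ⟨t, ht0, htr, hreach⟩ := H e' he'0
  obtain ⟨γ, g0, g1, gl, ge⟩ := reach_path N.hK hreach
  set m := ⌊min t r / h⌋₊ with hm
  have hmn : m ≤ n0 := by
    have : min t r / h ≤ n0 := by
      rw [div_le_iff₀ hh0, hh, mul_div_cancel₀ _ hn1.ne']
      exact min_le_right _ _
    exact Nat.floor_le_of_le this
  have hmt0 : (m:ℝ) * h ≤ min t r := by
    rw [← le_div_iff₀ hh0]; exact Nat.floor_le (by positivity)
  have hmt1 : min t r ≤ (m:ℝ) * h + h := by
    have := Nat.lt_floor_add_one (min t r / h)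
    rw [div_lt_iff₀ hh0] at this
    linarith
  have key : ∀ i ≤ m, ∀ z, ‖z - γ (t0 + i * h)‖ ≤ e' → chainP c v h e t0 x0 i z := by
    intro i
    induction i with
    | zero =>
      intro _ z hz
      simp only [chainP]
      simp only [Nat.cast_zero, zero_mul, add_zero, g0] at hz
      linarith
    | succ i ih =>
      intro hi z hz
      obtain ⟨j, hj⟩ := dense_near (γ (t0 + i * h)) he'0
      refine ⟨j, ih (by omega) _ hj, ?_⟩
      set z0 := TopologicalSpace.denseSeq (Euc d) j with hz0
      have hic : ((i:ℝ) + 1) * h ≤ t := by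
        have : ((i:ℝ)+1) ≤ m := by exact_mod_cast hi
        nlinarith [min_le_left t r]
      have hi0 : 0 ≤ (i:ℝ) * h := by positivity
      have hest := ge (t0 + i * h) (t0 + (i + 1) * h)
        (c (t0 + i * h) z0 + e / 4 + 2 * L * (2 * K * h + e')) (by linarith) (by nlinarith)
        (by linarith) (v (t0 + i * h) z0) (by
          intro s hs
          have h1 := hosc s (t0 + i * h) (by
            rw [abs_of_nonneg (by linarith [hs.1])]
            nlinarith [hs.2]) (γ s) z0
          have h2 : ‖γ s - z0‖ ≤ 2 * K * h + e' := by
            have h3 := gl (t0 + i * h) s (by linarith) hs.1 (by linarith [hs.2])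
            have h4 : s - (t0 + i * h) ≤ h := by nlinarith [hs.2]
            have h5 : 2 * K * (s - (t0 + i * h)) ≤ 2 * K * h := by gcongr
            have h6 : ‖γ s - z0‖ ≤ ‖γ s - γ (t0 + i * h)‖ + ‖γ (t0 + i * h) - z0‖ :=
              norm_sub_le_norm_sub_add_norm_sub _ _ _
            rw [norm_sub_rev (γ (t0 + i * h)) z0] at h6
            linarith
          have h7 : 2 * L * ‖γ s - z0‖ ≤ 2 * L * (2 * K * h + e') := by gcongr
          linarith)
      have e1 : t0 + (↑i + 1) * h - (t0 + ↑i * h) = h := by ring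
      rw [e1] at hest
      push_cast at hz
      have e2 : z - z0 - h • v (t0 + i * h) z0 = (z - γ (t0 + (i + 1) * h)) +
          (γ (t0 + (i + 1) * h) - γ (t0 + i * h) - h • v (t0 + i * h) z0)
          - (z0 - γ (t0 + i * h)) := by abel
      rw [e2]
      have h8 : ‖(z - γ (t0 + (i + 1) * h)) +
          (γ (t0 + (i + 1) * h) - γ (t0 + i * h) - h • v (t0 + i * h) z0)
          - (z0 - γ (t0 + i * h))‖ ≤ ‖z - γ (t0 + (i + 1) * h)‖ +
          ‖γ (t0 + (i + 1) * h) - γ (t0 + i * h) - h • v (t0 + i * h) z0‖ +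
          ‖z0 - γ (t0 + i * h)‖ := by
        refine (norm_sub_le _ _).trans ?_
        gcongr
        exact norm_add_le _ _
      have h10 : h * (2 * L * (2 * K * h + e')) ≤ h * (e/2) := by gcongr
      have a4 : (c (t0 + i * h) z0 + e / 4 + 2 * L * (2 * K * h + e')) * h =
        h * c (t0 + i * h) z0 + h * e / 4 + h * (2 * L * (2 * K * h + e')) := by ring
      rw [mul_add h]
      rw [a4] at hest
      linarith
  obtain ⟨j, hj⟩ := dense_near (γ (t0 + m * h)) he'0
  refine ⟨m, hmn, j, key m le_rfl _ hj, ?_⟩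
  have hmm : 0 ≤ (m:ℝ) * h := by positivity
  have h1 := gl (t0 + m * h) (t0 + t) (by linarith) (by linarith [min_le_left t r]) le_rfl
  rw [g1] at h1
  have h2 : t - m * h ≤ h + e' := by
    have : t ≤ min t r + e' := by
      rcases le_total t r with h | h
      · rw [min_eq_left h]; linarith
      · rw [min_eq_right h]; linarith
    linarith
  have h3 : 2 * K * (t0 + t - (t0 + m * h)) ≤ 2 * K * (h + e') := by
    have : t0 + t - (t0 + m * h) ≤ h + e' := by linarith
    gcongr
  have h6 := norm_sub_le_norm_sub_add_norm_sub (TopologicalSpace.denseSeq (Euc d) j) (γ (t0 + m * h)) x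
  rw [norm_sub_rev (γ (t0 + m * h)) x] at h6
  linarith

theorem ultra_lim {E : Type*} [NormedAddCommGroup E] [ProperSpace E] (F : Ultrafilter ℕ)
    (f : ℕ → E) (C : ℝ) (h : ∀ n, ‖f n‖ ≤ C) : ∃ l, Tendsto f F (nhds l) := by
  have h1 : (F.map f : Filter E) ≤ 𝓟 (closedBall 0 C) := by
    simp only [le_principal_iff]
    refine Filter.mem_map.2 (Filter.univ_mem' fun n => ?_)
    simpa using h n
  obtain ⟨l, -, hl⟩ := (isCompact_closedBall (0:E) C).ultrafilter_le_nhds (F.map f) h1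
  exact ⟨l, hl⟩

end

section
variable {d : ℕ} {c : ℝ → Euc d → ℝ} {v : ℝ → Euc d → Euc d} {K L : ℝ}

theorem floor_diff {h a a' : ℝ} (hh : 0 < h) (haa : a ≤ a') (m : ℕ) :
    (((min ⌊a' / h⌋₊ m : ℕ) : ℝ) - ((min ⌊a / h⌋₊ m : ℕ):ℝ)) * h ≤ a' - a + h := by
  have h1 : (((min ⌊a' / h⌋₊ m : ℕ) : ℝ) - ((min ⌊a / h⌋₊ m : ℕ):ℝ)) ≤
      (⌊a' / h⌋₊ : ℝ) - (⌊a / h⌋₊ : ℝ) := by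
    have h0 : ⌊a / h⌋₊ ≤ ⌊a' / h⌋₊ := Nat.floor_mono (by gcongr)
    have : (min ⌊a' / h⌋₊ m) + ⌊a / h⌋₊ ≤ ⌊a' / h⌋₊ + (min ⌊a / h⌋₊ m) := by omega
    have : (((min ⌊a' / h⌋₊ m : ℕ) : ℝ)) + ⌊a / h⌋₊ ≤ ⌊a' / h⌋₊ + ((min ⌊a / h⌋₊ m : ℕ):ℝ) := by
      exact_mod_cast this
    linarith
  have h2 : (⌊a' / h⌋₊ : ℝ) - (⌊a / h⌋₊ : ℝ) ≤ a' / h - a / h + 1 := by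
    have h3 := Nat.lt_floor_add_one (a / h)
    rcases le_total 0 (a' / h) with h4 | h4
    · have := Nat.floor_le h4; linarith
    · rw [Nat.floor_of_nonpos h4]
      have : (0:ℝ) ≤ ⌊a / h⌋₊ := by positivity
      have : a / h ≤ a' / h := by gcongr
      push_cast; linarith
  have h5 : (((min ⌊a' / h⌋₊ m : ℕ) : ℝ) - ((min ⌊a / h⌋₊ m : ℕ):ℝ)) * h ≤ (a' / h - a / h + 1) * h := by
    gcongr; exact h1.trans h2
  have h6 : (a' / h - a / h + 1) * h = a' - a + h := by field_simp
  linarith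

theorem reach_of_chain (N : Nice c v K L) {t0 r : ℝ} {x0 x : Euc d} (hr : 0 < r)
    (H : ∀ k : ℕ, ∃ n : ℕ, 1 ≤ n ∧ r / n ≤ 1 / ((k:ℝ) + 1) ∧ ∃ m ≤ n, ∃ j : ℕ,
      chainP c v (r / n) (1 / ((k:ℝ) + 1)) t0 x0 m (TopologicalSpace.denseSeq (Euc d) j) ∧
      ‖TopologicalSpace.denseSeq (Euc d) j - x‖ ≤ 1 / ((k:ℝ) + 1)) :
    ∃ T, 0 ≤ T ∧ T ≤ r ∧ Reachable c v t0 x0 (t0 + T) x := by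
  have hK0 := N.K0
  have hL0 := N.hL0
  have H' : ∀ k : ℕ, ∃ (h : ℝ) (m : ℕ) (Z : ℕ → Euc d), 0 < h ∧ h ≤ 1 / ((k:ℝ) + 1) ∧ m * h ≤ r ∧
      ‖Z m - x‖ ≤ 1 / ((k:ℝ) + 1) ∧ ‖Z 0 - x0‖ ≤ 1 / ((k:ℝ) + 1) ∧
      IsChain' c v h (1 / ((k:ℝ) + 1)) t0 m Z := by
    intro k
    obtain ⟨n, h1, h2, m, hm, j, h3, h4⟩ := H k
    obtain ⟨Z, e1, e2, e3⟩ := chainP_chain h3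
    have hn : (0:ℝ) < n := by exact_mod_cast h1
    refine ⟨r / n, m, Z, by positivity, h2, ?_, by rw [e1]; exact h4, e2, e3⟩
    have : (m:ℝ) ≤ n := by exact_mod_cast hm
    calc (m:ℝ) * (r / n) ≤ n * (r / n) := by gcongr
      _ = r := by field_simp
  choose h m Z hh0 hhe hmr hZx hZ0 hZ using H'
  set e : ℕ → ℝ := fun k => 1 / ((k:ℝ) + 1) with he
  have he1 : ∀ k, e k ≤ 1 := by
    intro k; simp only [he]; rw [div_le_one (by positivity)]; linarith [(Nat.cast_nonneg k : (0:ℝ) ≤ k)]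
  set F : Ultrafilter ℕ := hyperfilter ℕ
  have hF : (F : Filter ℕ) ≤ atTop := by
    rw [← Nat.cofinite_eq_atTop]; exact hyperfilter_le_cofinite
  have het : Tendsto e F (nhds 0) := tendsto_one_div_add_atTop_nhds_zero_nat.mono_left hF
  have hht : Tendsto h F (nhds 0) :=
    squeeze_zero (fun k => (hh0 k).le) hhe het
  obtain ⟨T, hT⟩ := ultra_lim F (fun k => (m k : ℝ) * h k) r (by
    intro k
    have : 0 ≤ (m k : ℝ) * h k := mul_nonneg (by positivity) (hh0 k).le
    rw [Real.norm_of_nonneg this]; exact hmr k)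
  have hT0 : 0 ≤ T := ge_of_tendsto hT (Eventually.of_forall fun k =>
    mul_nonneg (by positivity) (hh0 k).le)
  have hTr : T ≤ r := le_of_tendsto hT (Eventually.of_forall hmr)
  have hZl : ∀ k i i', i ≤ i' → i' ≤ m k → ‖Z k i' - Z k i‖ ≤ ((i':ℝ) - i) * h k * (2 * K + 1) := by
    intro k i i' hi hi'
    have := chain_est (hZ k) (hh0 k).le hi hi' (w := 0) (A := 2 * K + 1) (by
      intro j _ _
      rw [sub_zero]
      have := N.hK (t0 + j * h k) (Z k j)
      have := he1 k
      simp only [he] at this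
      linarith)
    simpa using this
  set idx : ℕ → ℝ → ℕ := fun k s => min ⌊(s - t0) / h k⌋₊ (m k) with hidx
  have hidxm : ∀ k s, idx k s ≤ m k := fun k s => min_le_right _ _
  have hmono : ∀ k s s', s ≤ s' → idx k s ≤ idx k s' := by
    intro k s s' hs
    simp only [hidx]
    have hk := hh0 k
    have : ⌊(s - t0) / h k⌋₊ ≤ ⌊(s' - t0) / h k⌋₊ := Nat.floor_mono (by gcongr)
    omega
  have hdiff : ∀ k s s', s ≤ s' → ((idx k s' : ℝ) - idx k s) * h k ≤ s' - s + h k := by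
    intro k s s' hs
    have := floor_diff (hh0 k) (sub_le_sub_right hs t0) (m k)
    simp only [hidx]; linarith
  set G : ℕ → ℝ → Euc d := fun k s => Z k (idx k s) with hG
  have hGl : ∀ k s s', s ≤ s' → ‖G k s' - G k s‖ ≤ (s' - s + h k) * (2 * K + 1) := by
    intro k s s' hs
    refine (hZl k _ _ (hmono k s s' hs) (hidxm k s')).trans ?_
    gcongr
    exact hdiff k s s' hs
  have hGb : ∀ k s, ‖G k s‖ ≤ r * (2 * K + 1) + 1 + ‖x0‖ := by
    intro k s
    have h1 := hZl k 0 _ (Nat.zero_le _) (hidxm k s)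
    have h2 : (((idx k s : ℝ)) - (0:ℕ)) * h k ≤ r := by
      refine le_trans ?_ (hmr k)
      have : (idx k s : ℝ) ≤ m k := by exact_mod_cast hidxm k s
      have := hh0 k
      push_cast
      gcongr
      linarith
    have h3 : (((idx k s : ℝ)) - (0:ℕ)) * h k * (2 * K + 1) ≤ r * (2 * K + 1) := by gcongr
    have h4 : ‖Z k (idx k s)‖ ≤ ‖Z k (idx k s) - Z k 0‖ + ‖Z k 0 - x0‖ + ‖x0‖ := by
      have : Z k (idx k s) = Z k (idx k s) - Z k 0 + (Z k 0 - x0) + x0 := by abel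
      conv_lhs => rw [this]
      exact norm_add₃_le
    have h5 := (hZ0 k).trans (he1 k)
    simp only [hG]
    linarith
  have hlim : ∀ s, ∃ l, Tendsto (fun k => G k s) F (nhds l) := fun s =>
    ultra_lim F _ _ (fun k => hGb k s)
  choose γ hγ using hlim
  have hγl : LipschitzWith (2 * K + 1).toNNReal γ := by
    have h1 : ∀ s s', s ≤ s' → ‖γ s' - γ s‖ ≤ (2 * K + 1) * (s' - s) := by
      intro s s' hs
      have a1 : Tendsto (fun k => ‖G k s' - G k s‖) F (nhds ‖γ s' - γ s‖) :=
        ((hγ s').sub (hγ s)).norm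
      have a2 : Tendsto (fun k => (s' - s + h k) * (2 * K + 1)) F (nhds ((s' - s + 0) * (2 * K + 1))) :=
        (hht.const_add _).mul_const _
      have := le_of_tendsto_of_tendsto a1 a2 (Eventually.of_forall fun k => hGl k s s' hs)
      linarith
    refine LipschitzWith.of_dist_le_mul fun s s' => ?_
    rw [Real.coe_toNNReal _ (by positivity), dist_eq_norm, Real.dist_eq]
    rcases le_total s s' with hs | hs
    · rw [norm_sub_rev, abs_sub_comm, abs_of_nonneg (by linarith)]; exact h1 _ _ hs
    · rw [abs_of_nonneg (by linarith)]; exact h1 _ _ hs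
  have hγ0 : γ t0 = x0 := by
    have a1 : Tendsto (fun k => G k t0) F (nhds x0) := by
      rw [tendsto_iff_norm_sub_tendsto_zero]
      refine squeeze_zero (fun k => norm_nonneg _) (fun k => ?_) het
      simp only [hG, hidx, sub_self, zero_div, Nat.floor_zero, Nat.zero_min]
      exact hZ0 k
    exact tendsto_nhds_unique (hγ t0) a1
  have hγT : γ (t0 + T) = x := by
    have a1 : Tendsto (fun k => G k (t0 + T)) F (nhds x) := by
      rw [tendsto_iff_norm_sub_tendsto_zero]
      have a2 : Tendsto (fun k => (|(m k : ℝ) * h k - T| + h k) * (2 * K + 1) + e k) F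
          (nhds ((|T - T| + 0) * (2 * K + 1) + 0)) :=
        ((((hT.sub_const T).abs).add hht).mul_const _).add het
      simp only [sub_self, abs_zero, add_zero, zero_mul] at a2
      refine squeeze_zero (fun k => norm_nonneg _) (fun k => ?_) a2
      have b1 := hZl k _ _ (hidxm k (t0 + T)) le_rfl
      have hk := hh0 k
      have b2 : ((m k : ℝ) - idx k (t0 + T)) * h k ≤ |(m k : ℝ) * h k - T| + h k := by
        simp only [hidx, add_sub_cancel_left]
        rcases le_total ⌊T / h k⌋₊ (m k) with b3 | b3
        · rw [min_eq_left b3]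
          have b4 := Nat.lt_floor_add_one (T / h k)
          rw [div_lt_iff₀ hk] at b4
          have := le_abs_self ((m k : ℝ) * h k - T)
          linarith
        · rw [min_eq_right b3]
          have := abs_nonneg ((m k : ℝ) * h k - T)
          simp only [sub_self, zero_mul]; linarith
      have b5 : ((m k : ℝ) - idx k (t0 + T)) * h k * (2 * K + 1) ≤ (|(m k : ℝ) * h k - T| + h k) * (2 * K + 1) := by
        gcongr
      have b6 := norm_sub_le_norm_sub_add_norm_sub (Z k (idx k (t0 + T))) (Z k (m k)) x
      rw [norm_sub_rev (Z k (idx k (t0 + T))) (Z k (m k))] at b6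
      have b7 := hZx k
      simp only [hG]
      exact b6.trans (add_le_add (b1.trans b5) b7)
    exact tendsto_nhds_unique (hγ _) a1
  refine ⟨T, hT0, hTr, ?_⟩
  rw [← hγ0, ← hγT]
  refine limit_reach hγl (by linarith) ?_
  intro s hs0 hs1 η hη
  obtain ⟨δ, hδ, hosc⟩ := N.osc (ε := η / 4) (by positivity)
  refine ⟨min δ (η / (8 * (L + 1) * (2 * K + 1))), by positivity, ?_⟩
  intro s' hss hsδ hsT
  have hs'1 : s' - s ≤ δ := by linarith [min_le_left δ (η / (8 * (L + 1) * (2 * K + 1)))]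
  have hs'2 : 2 * L * ((s' - s) * (2 * K + 1)) ≤ η / 4 := by
    have a1 : s' - s ≤ η / (8 * (L + 1) * (2 * K + 1)) := by
      linarith [min_le_right δ (η / (8 * (L + 1) * (2 * K + 1)))]
    rw [le_div_iff₀ (by positivity)] at a1
    have a2 : 0 ≤ (s' - s) * (2 * K + 1) := mul_nonneg (by linarith) (by linarith)
    nlinarith
  have hidxs : ∀ᶠ k in (F : Filter ℕ), s' < t0 + m k * h k := by
    have := hT.const_add t0
    exact this.eventually_const_lt (by linarith)
  have hidt : ∀ s, t0 < s → s ≤ s' → ∀ᶠ k in (F : Filter ℕ),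
      (idx k s : ℝ) * h k ≤ s - t0 ∧ s - t0 - h k ≤ (idx k s : ℝ) * h k := by
    intro s hs hs'
    filter_upwards [hidxs] with k hk
    have hk0 := hh0 k
    have b0 := Nat.floor_le (a := (s - t0) / h k) (div_nonneg (by linarith) hk0.le)
    have b1 := Nat.lt_floor_add_one ((s - t0) / h k)
    rw [div_lt_iff₀ hk0] at b1
    rw [le_div_iff₀ hk0] at b0
    have b2 : ⌊(s - t0) / h k⌋₊ ≤ m k := by
      refine Nat.floor_le_of_le ?_
      rw [div_le_iff₀ hk0]; linarith
    simp only [hidx, min_eq_left b2]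
    exact ⟨b0, by linarith⟩
  have hev1 : ∀ᶠ k in (F : Filter ℕ), h k ≤ s' - s := (hht.eventually_le_const (by linarith))
  have hlimdiff : ∀ s, t0 < s → s ≤ s' → Tendsto (fun k => (idx k s : ℝ) * h k) F (nhds (s - t0)) := by
    intro s hs hs'
    have a1 : Tendsto (fun k => s - t0 - h k) F (nhds (s - t0 - 0)) := hht.const_sub _
    rw [sub_zero] at a1
    refine tendsto_of_tendsto_of_tendsto_of_le_of_le' a1 tendsto_const_nhds ?_ ?_
    · filter_upwards [hidt s hs hs'] with k hk using hk.2
    · filter_upwards [hidt s hs hs'] with k hk using hk.1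
  have hd1 : Tendsto (fun k => ((idx k s' : ℝ) - idx k s) * h k) F (nhds (s' - s)) := by
    have := (hlimdiff s' (by linarith) le_rfl).sub (hlimdiff s hs0 hss.le)
    simp only [← sub_mul] at this
    convert this using 2
    ring
  have hA : ∀ᶠ k in (F : Filter ℕ), e k + 2 * L * (h k * (2 * K + 1) + ‖G k s - γ s‖) ≤ η / 4 := by
    have a1 : Tendsto (fun k => e k + 2 * L * (h k * (2 * K + 1) + ‖G k s - γ s‖)) F
        (nhds (0 + 2 * L * (0 * (2 * K + 1) + 0))) :=
      het.add (((hht.mul_const _).add ((tendsto_iff_norm_sub_tendsto_zero).1 (hγ s))).const_mul _)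
    refine a1.eventually_le_const ?_
    simp; positivity
  have hmain : ∀ᶠ k in (F : Filter ℕ),
      ‖G k s' - G k s - (((idx k s' : ℝ) - idx k s) * h k) • v s (γ s)‖ ≤
        ((idx k s' : ℝ) - idx k s) * h k * (c s (γ s) + η) := by
    filter_upwards [hA, hev1, hidt s hs0 hss.le, hidt s' (by linarith) le_rfl] with k hA hev h1 h2
    have hk0 := hh0 k
    refine chain_est (hZ k) hk0.le (hmono k s s' hss.le) (hidxm k s') ?_
    intro j hj1 hj2
    have hj1' : (idx k s : ℝ) * h k ≤ j * h k := by
      have : (idx k s : ℝ) ≤ j := by exact_mod_cast hj1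
      gcongr
    have hj2' : (j:ℝ) * h k ≤ idx k s' * h k := by
      have : (j : ℝ) ≤ idx k s' := by exact_mod_cast hj2.le
      gcongr
    have b1 := hosc (t0 + j * h k) s (by
      rw [abs_le]; constructor <;> linarith) (Z k j) (γ s)
    have b2 := hZl k _ _ hj1 (hj2.le.trans (hidxm k s'))
    have b3 : ((j:ℝ) - idx k s) * h k ≤ s' - s + h k := by linarith
    have b4 : ((j:ℝ) - idx k s) * h k * (2 * K + 1) ≤ (s' - s + h k) * (2 * K + 1) := by gcongr
    have b5 : ‖Z k j - γ s‖ ≤ (s' - s + h k) * (2 * K + 1) + ‖G k s - γ s‖ := by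
      have := norm_sub_le_norm_sub_add_norm_sub (Z k j) (Z k (idx k s)) (γ s)
      simp only [hG]; linarith
    have b6 : 2 * L * ‖Z k j - γ s‖ ≤ 2 * L * ((s' - s + h k) * (2 * K + 1) + ‖G k s - γ s‖) := by gcongr
    have b7 : 2 * L * ((s' - s + h k) * (2 * K + 1) + ‖G k s - γ s‖) =
      2 * L * ((s' - s) * (2 * K + 1)) + 2 * L * (h k * (2 * K + 1) + ‖G k s - γ s‖) := by ring
    simp only [he] at hA
    linarith
  have l1 : Tendsto (fun k => ‖G k s' - G k s - (((idx k s' : ℝ) - idx k s) * h k) • v s (γ s)‖) F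
      (nhds ‖γ s' - γ s - (s' - s) • v s (γ s)‖) :=
    (((hγ s').sub (hγ s)).sub (hd1.smul_const _)).norm
  exact le_of_tendsto_of_tendsto l1 (hd1.mul_const _) hmain

end

section
variable {d : ℕ} {c : ℝ → Euc d → ℝ} {v : ℝ → Euc d → Euc d} {K L : ℝ} {t0 : ℝ} {x0 x : Euc d}

theorem tau_nonneg : 0 ≤ travelTime c v t0 x0 x :=
  Real.sInf_nonneg fun _ ht => ht.1

theorem tau_le {t : ℝ} (h : Reachable c v t0 x0 (t0 + t) x) : travelTime c v t0 x0 x ≤ t :=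
  csInf_le ⟨0, fun _ ht => ht.1⟩ ⟨by linarith [h.1], h⟩

theorem tau_self (t0 : ℝ) (x0 : Euc d) : travelTime c v t0 x0 x0 = 0 :=
  le_antisymm (tau_le (by rw [add_zero]; exact reach_refl c v t0 x0)) tau_nonneg

theorem tau_lt_ex (hne : ∃ t, Reachable c v t0 x0 (t0 + t) x) {s : ℝ}
    (hs : travelTime c v t0 x0 x < s) : ∃ t, 0 ≤ t ∧ t < s ∧ Reachable c v t0 x0 (t0 + t) x := by
  obtain ⟨t, ht⟩ := hne
  have hn : {t | 0 ≤ t ∧ x ∈ reachSet c v t t0 x0}.Nonempty := ⟨t, ⟨by linarith [ht.1], ht⟩⟩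
  obtain ⟨u, hu, hus⟩ := exists_lt_of_csInf_lt hn hs
  exact ⟨u, hu.1, hus, hu.2⟩

theorem tau_lower (N : Nice c v K L) (hne : ∃ t, Reachable c v t0 x0 (t0 + t) x) :
    ‖x - x0‖ ≤ 2 * K * travelTime c v t0 x0 x := by
  refine le_of_forall_pos_le_add fun η hη => ?_
  have hK0 := N.K0
  obtain ⟨t, h0, h1, h2⟩ := tau_lt_ex hne (s := travelTime c v t0 x0 x + η / (2 * K + 1))
    (by have : 0 < η / (2 * K + 1) := by positivity
        linarith)
  have h3 := reach_dist N.hK h2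
  rw [add_sub_cancel_left] at h3
  have h4 : 2 * K * t ≤ 2 * K * (travelTime c v t0 x0 x + η / (2 * K + 1)) := by gcongr
  have h5 : 2 * K * (η / (2 * K + 1)) ≤ η := by
    rw [← mul_div_assoc, div_le_iff₀ (by positivity)]; nlinarith
  linarith

theorem tau_attained (N : Nice c v K L) (hne : ∃ t, Reachable c v t0 x0 (t0 + t) x) :
    Reachable c v t0 x0 (t0 + travelTime c v t0 x0 x) x := by
  rcases (tau_nonneg (c := c) (v := v) (t0 := t0) (x0 := x0) (x := x)).eq_or_lt with h | h
  · have := tau_lower N hne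
    rw [← h, mul_zero] at this
    have hx : x = x0 := sub_eq_zero.1 (norm_le_zero_iff.1 this)
    rw [← h, hx, add_zero]; exact reach_refl c v t0 x0
  · obtain ⟨T, h0, h1, h2⟩ := reach_of_chain N h (x := x) (t0 := t0) (x0 := x0) (fun k =>
      chain_of_reach N h (fun e' he' => tau_lt_ex hne (by linarith)) (by positivity))
    have := tau_le h2
    rwa [le_antisymm h1 this] at h2

theorem tau_meas {Ω : Type*} {c : ℝ → Euc d → Ω → ℝ} {v : ℝ → Euc d → Ω → Euc d}
    {𝒢 : MeasurableSpace Ω} (hN : ∀ ω, Nice (fun a b => c a b ω) (fun a b => v a b ω) K L)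
    (hne : ∀ ω, ∃ t, Reachable (fun a b => c a b ω) (fun a b => v a b ω) t0 x0 (t0 + t) x) (r : ℝ)
    (hG : ∀ s, t0 ≤ s → s ≤ t0 + r → ∀ z, Measurable[𝒢] (c s z) ∧ Measurable[𝒢] (v s z)) :
    MeasurableSet[𝒢] {ω | travelTime (fun a b => c a b ω) (fun a b => v a b ω) t0 x0 x ≤ r} := by
  rcases le_or_gt r 0 with hr | hr
  · have : {ω | travelTime (fun a b => c a b ω) (fun a b => v a b ω) t0 x0 x ≤ r} =
        {ω | x = x0 ∧ 0 ≤ r} := by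
      ext ω
      constructor
      · intro h
        have h' : travelTime (fun a b => c a b ω) (fun a b => v a b ω) t0 x0 x ≤ r := h
        have h1 := tau_nonneg (c := fun a b => c a b ω) (v := fun a b => v a b ω)
          (t0 := t0) (x0 := x0) (x := x)
        have h2 := tau_lower (hN ω) (hne ω)
        refine ⟨?_, h1.trans h'⟩
        rw [le_antisymm (h'.trans hr) h1, mul_zero] at h2
        exact sub_eq_zero.1 (norm_le_zero_iff.1 h2)
      · rintro ⟨rfl, h⟩
        show travelTime (fun a b => c a b ω) (fun a b => v a b ω) t0 x x ≤ r
        rw [tau_self]; exact h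
    rw [this]; exact MeasurableSet.const _
  · have : {ω | travelTime (fun a b => c a b ω) (fun a b => v a b ω) t0 x0 x ≤ r} =
        ⋂ k : ℕ, ⋃ n : ℕ, ⋃ m : ℕ, ⋃ j : ℕ,
          {ω | (1 ≤ n ∧ r / n ≤ 1 / ((k:ℝ) + 1) ∧ m ≤ n ∧
            ‖TopologicalSpace.denseSeq (Euc d) j - x‖ ≤ 1 / ((k:ℝ) + 1)) ∧
            chainP (fun a b => c a b ω) (fun a b => v a b ω) (r / n) (1 / ((k:ℝ) + 1)) t0 x0 m
              (TopologicalSpace.denseSeq (Euc d) j)} := by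
      ext ω
      simp only [Set.mem_iInter, Set.mem_iUnion]
      constructor
      · intro h k
        have h' : travelTime (fun a b => c a b ω) (fun a b => v a b ω) t0 x0 x ≤ r := h
        obtain ⟨n, a1, a2, m, a3, j, a4, a5⟩ := chain_of_reach (hN ω) hr (x := x) (t0 := t0) (x0 := x0)
          (fun e' he' => tau_lt_ex (hne ω) (by linarith)) (e := 1 / ((k:ℝ) + 1)) (by positivity)
        exact ⟨n, m, j, ⟨a1, a2, a3, a5⟩, a4⟩
      · intro h
        obtain ⟨T, h0, h1, h2⟩ := reach_of_chain (hN ω) hr (x := x) (t0 := t0) (x0 := x0) (fun k => by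
          obtain ⟨n, m, j, ⟨a1, a2, a3, a5⟩, a4⟩ := h k
          exact ⟨n, a1, a2, m, a3, j, a4, a5⟩)
        exact (tau_le h2).trans h1
    rw [this]
    refine MeasurableSet.iInter fun k => MeasurableSet.iUnion fun n => MeasurableSet.iUnion fun m =>
      MeasurableSet.iUnion fun j => ?_
    by_cases hp : (1 ≤ n ∧ r / n ≤ 1 / ((k:ℝ) + 1) ∧ m ≤ n ∧
            ‖TopologicalSpace.denseSeq (Euc d) j - x‖ ≤ 1 / ((k:ℝ) + 1))
    · simp only [hp, true_and, and_self]
      refine chainP_meas ?_ _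
      intro i hi z
      have hn : (0:ℝ) < n := by exact_mod_cast hp.1
      have : (i:ℝ) ≤ n := by exact_mod_cast (hi.le.trans hp.2.2.1)
      refine hG _ ?_ ?_ z
      · have : 0 ≤ (i:ℝ) * (r / n) := by positivity
        linarith
      · have : (i:ℝ) * (r / n) ≤ n * (r / n) := by gcongr
        rw [mul_div_cancel₀ _ hn.ne'] at this
        linarith
    · simp only [hp, false_and]
      exact MeasurableSet.const _
end

section

theorem mix_int {Ω : Type*} {m : MeasurableSpace Ω} [MeasurableSpace Ω] {P : Measure Ω} [IsProbabilityMeasure P]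
    {E : Set Ω} {φ B : ℝ} {Y : Ω → ℝ}
    (hB : 0 ≤ B)
    (hY : Measurable Y) (hYm : Measurable[m] Y) (hY0 : ∀ ω, 0 ≤ Y ω) (hYB : ∀ ω, Y ω ≤ B)
    (hmix : ∀ F, MeasurableSet[m] F → MeasurableSet F →
      P.real (F ∩ E) ≤ P.real E * (P.real F + φ)) :
    (∫ ω in E, Y ω ∂P) ≤ P.real E * ((∫ ω, Y ω ∂P) + B * φ) := by
  have hint : Integrable Y P := Integrable.of_bound hY.aestronglyMeasurable B
    (Eventually.of_forall fun ω => by rw [Real.norm_of_nonneg (hY0 ω)]; exact hYB ω)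
  rw [hint.restrict.integral_eq_integral_Ioc_meas_le (M := B) (Eventually.of_forall hY0)
    (Eventually.of_forall hYB), hint.integral_eq_integral_Ioc_meas_le (M := B) (Eventually.of_forall hY0)
    (Eventually.of_forall hYB)]
  have hanti : ∀ μ : Measure Ω, IsFiniteMeasure μ → IntegrableOn (fun t => μ.real {a | t ≤ Y a}) (Set.Ioc 0 B) := by
    intro μ hμ
    refine IntegrableOn.mono_set (t := Set.Icc 0 B) ?_ Set.Ioc_subset_Icc_self
    refine AntitoneOn.integrableOn_isCompact isCompact_Icc ?_
    intro s _ t _ hst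
    refine measureReal_mono ?_
    intro ω hω
    exact hst.trans hω
  have e : P.real E * ((∫ t in Set.Ioc 0 B, P.real {a | t ≤ Y a}) + B * φ) =
      ∫ t in Set.Ioc 0 B, P.real E * (P.real {a | t ≤ Y a} + φ) := by
    rw [integral_const_mul, integral_add (hanti P inferInstance) (by simp)]
    simp [hB]
  rw [e]
  refine integral_mono (hanti _ inferInstance)
    (((hanti P inferInstance).add (by simp)).const_mul _) fun t => ?_
  have hm1 : MeasurableSet[m] {a | t ≤ Y a} := hYm measurableSet_Ici
  have hm2 : MeasurableSet {a | t ≤ Y a} := hY measurableSet_Ici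
  beta_reduce
  rw [measureReal_restrict_apply hm2]
  exact hmix _ hm1 hm2

theorem int_le_fiber {Ω : Type*} [MeasurableSpace Ω] {P : Measure Ω} {k : Ω → ℕ} (hk : Measurable k)
    {F G : Ω → ℝ} (hF : Integrable F P) (hG : Integrable G P)
    (h : ∀ j, (∫ ω in k ⁻¹' {j}, F ω ∂P) ≤ ∫ ω in k ⁻¹' {j}, G ω ∂P) :
    ∫ ω, F ω ∂P ≤ ∫ ω, G ω ∂P := by
  have hm : ∀ j, MeasurableSet (k ⁻¹' {j}) := fun j => hk (measurableSet_singleton j)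
  have hd : Pairwise (Function.onFun Disjoint fun j => k ⁻¹' {j}) := by
    intro i j hij
    refine Set.disjoint_left.2 fun ω h1 h2 => hij ?_
    exact (Set.mem_singleton_iff.1 h1).symm.trans (Set.mem_singleton_iff.1 h2)
  have hu : (⋃ j, k ⁻¹' {j}) = Set.univ := by
    ext ω; simp
  have h1 := hasSum_integral_iUnion hm hd (f := F) (μ := P) hF.integrableOn
  have h2 := hasSum_integral_iUnion hm hd (f := G) (μ := P) hG.integrableOn
  rw [hu, setIntegral_univ] at h1 h2
  exact hasSum_le h h1 h2

theorem int3 {Ω : Type*} [MeasurableSpace Ω] {μ : Measure Ω} [IsFiniteMeasure μ] {F G : Ω → ℝ}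
    (hF : Integrable F μ) (hG : Integrable G μ) (a b : ℝ) :
    (∫ ω, (F ω + a * G ω + b) ∂μ) = (∫ ω, F ω ∂μ) + a * (∫ ω, G ω ∂μ) + μ.real Set.univ * b := by
  have h2 : Integrable (fun ω => a * G ω) μ := hG.const_mul a
  have h1 : Integrable (fun ω => F ω + a * G ω) μ := hF.add h2
  rw [integral_add h1 (integrable_const b), integral_add hF h2, integral_const_mul]
  simp

theorem subadd_abs {Ω : Type*} {m : ℕ → MeasurableSpace Ω} [MeasurableSpace Ω] {P : Measure Ω}
    [IsProbabilityMeasure P] {X T : Ω → ℝ} {k : Ω → ℕ} {Y : ℕ → Ω → ℝ} {B BX BT g φ fy qy : ℝ}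
    (hX : Measurable X) (hX0 : ∀ ω, 0 ≤ X ω) (hXB : ∀ ω, X ω ≤ BX)
    (hT : Measurable T) (hT0 : ∀ ω, 0 ≤ T ω) (hTB : ∀ ω, T ω ≤ BT)
    (hk : Measurable k) (hkX : ∀ ω, (k ω : ℝ) ≤ X ω + 1) (hg : 0 ≤ g) (hB : 0 ≤ B)
    (hY : ∀ j, Measurable (Y j)) (hYm : ∀ j, Measurable[m j] (Y j)) (hY0 : ∀ j ω, 0 ≤ Y j ω)
    (hYB : ∀ j ω, Y j ω ≤ B) (hfy : ∀ j, ∫ ω, Y j ω ∂P = fy) (hqy : ∀ j, ∫ ω, (Y j ω) ^ 2 ∂P = qy)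
    (hφ : 0 ≤ φ)
    (hmix : ∀ j F, MeasurableSet[m j] F → MeasurableSet F →
      P.real (F ∩ k ⁻¹' {j}) ≤ P.real (k ⁻¹' {j}) * (P.real F + φ))
    (hTY : ∀ ω, T ω ≤ k ω + g + Y (k ω) ω) :
    (∫ ω, T ω ∂P) ≤ (∫ ω, X ω ∂P) + (1 + g) + (fy + B * φ) ∧
    (∫ ω, (T ω) ^ 2 ∂P) ≤ (∫ ω, (X ω) ^ 2 ∂P) + 2 * (1 + g) * (∫ ω, X ω ∂P) + (1 + g) ^ 2 +
      2 * ((∫ ω, X ω ∂P) + (1 + g)) * (fy + B * φ) + (qy + B ^ 2 * φ) := by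
  have bi : ∀ (f : Ω → ℝ) (C : ℝ), Measurable f → (∀ ω, 0 ≤ f ω) → (∀ ω, f ω ≤ C) → Integrable f P :=
    fun f C hf h0 hC => Integrable.of_bound hf.aestronglyMeasurable C
      (Eventually.of_forall fun ω => by rw [Real.norm_of_nonneg (h0 ω)]; exact hC ω)
  have iX := bi X BX hX hX0 hXB
  have iX2 := bi (fun ω => X ω ^ 2) (BX ^ 2) (hX.pow_const 2) (fun ω => sq_nonneg _)
    (fun ω => pow_le_pow_left₀ (hX0 ω) (hXB ω) 2)
  have iT := bi T BT hT hT0 hTB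
  have iT2 := bi (fun ω => T ω ^ 2) (BT ^ 2) (hT.pow_const 2) (fun ω => sq_nonneg _)
    (fun ω => pow_le_pow_left₀ (hT0 ω) (hTB ω) 2)
  have hkr : Measurable (fun ω => (k ω : ℝ)) := measurable_from_nat.comp hk
  have ik := bi (fun ω => (k ω : ℝ)) (BX + 1) hkr (fun ω => by positivity)
    (fun ω => (hkX ω).trans (by linarith [hXB ω]))
  have ik2 := bi (fun ω => (k ω : ℝ) ^ 2) ((BX + 1) ^ 2) (hkr.pow_const 2) (fun ω => by positivity)
    (fun ω => pow_le_pow_left₀ (by positivity) ((hkX ω).trans (by linarith [hXB ω])) 2)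
  have iY : ∀ j, Integrable (Y j) P := fun j => bi (Y j) B (hY j) (hY0 j) (hYB j)
  have iY2 : ∀ j, Integrable (fun ω => Y j ω ^ 2) P := fun j =>
    bi (fun ω => Y j ω ^ 2) (B ^ 2) ((hY j).pow_const 2) (fun ω => sq_nonneg _)
    (fun ω => pow_le_pow_left₀ (hY0 j ω) (hYB j ω) 2)
  have hfy0 : 0 ≤ fy := by rw [← hfy 0]; exact integral_nonneg (hY0 0)
  have hE : ∀ j, MeasurableSet (k ⁻¹' {j}) := fun j => hk (measurableSet_singleton j)
  have m1 : ∀ j, (∫ ω in k ⁻¹' {j}, Y j ω ∂P) ≤ P.real (k ⁻¹' {j}) * (fy + B * φ) := by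
    intro j
    rw [← hfy j]
    exact mix_int hB (hY j) (hYm j) (hY0 j) (hYB j) (hmix j)
  have m2 : ∀ j, (∫ ω in k ⁻¹' {j}, Y j ω ^ 2 ∂P) ≤ P.real (k ⁻¹' {j}) * (qy + B ^ 2 * φ) := by
    intro j
    rw [← hqy j]
    refine mix_int (m := m j) (by positivity) ((hY j).pow_const 2) ((hYm j).pow_const 2) (fun ω => sq_nonneg _)
      (fun ω => pow_le_pow_left₀ (hY0 j ω) (hYB j ω) 2) (hmix j)
  have hkint : (∫ ω, (k ω : ℝ) ∂P) ≤ (∫ ω, X ω ∂P) + 1 := by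
    have := integral_mono ik (iX.add (integrable_const 1)) hkX
    rw [integral_add' iX (integrable_const 1)] at this
    simpa using this
  have hk2int : (∫ ω, ((k ω : ℝ)) ^ 2 ∂P) ≤ (∫ ω, X ω ^ 2 ∂P) + 2 * (∫ ω, X ω ∂P) + 1 := by
    have h1 : (∫ ω, ((k ω : ℝ)) ^ 2 ∂P) ≤ ∫ ω, (X ω ^ 2 + 2 * X ω + 1) ∂P := by
      refine integral_mono ik2 ((iX2.add (iX.const_mul 2)).add (integrable_const 1)) fun ω => ?_
      have := pow_le_pow_left₀ (by positivity) (hkX ω) 2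
      linarith
    rw [int3 iX2 iX] at h1
    simpa using h1
  have hM0 : 0 ≤ fy + B * φ := by positivity
  have onE : ∀ j, ∀ᵐ ω ∂(P.restrict (k ⁻¹' {j})), k ω = j := fun j =>
    (ae_restrict_iff' (hE j)).2 (Eventually.of_forall fun ω hω => hω)
  constructor
  · have h1 : (∫ ω, T ω ∂P) ≤ ∫ ω, ((k ω : ℝ) + (g + (fy + B * φ))) ∂P := by
      refine int_le_fiber hk iT (ik.add (integrable_const _)) fun j => ?_
      have a1 : (∫ ω in k ⁻¹' {j}, T ω ∂P) ≤ ∫ ω in k ⁻¹' {j}, ((j + g) + Y j ω) ∂P := by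
        refine integral_mono_ae iT.restrict ((integrable_const _).add (iY j).restrict) ?_
        filter_upwards [onE j] with ω hω
        have := hTY ω
        rw [hω] at this
        exact this
      have a2 : (∫ ω in k ⁻¹' {j}, ((k ω : ℝ) + (g + (fy + B * φ))) ∂P) =
          ∫ ω in k ⁻¹' {j}, ((j : ℝ) + (g + (fy + B * φ))) ∂P := by
        refine integral_congr_ae ?_
        filter_upwards [onE j] with ω hω
        rw [hω]
      rw [a2]
      refine a1.trans ?_
      rw [integral_add (integrable_const _) (iY j).restrict]
      simp only [integral_const, smul_eq_mul, measureReal_restrict_apply_univ]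
      have := m1 j
      linarith
    rw [integral_add ik (integrable_const _)] at h1
    simp at h1
    linarith
  · have h1 : (∫ ω, T ω ^ 2 ∂P) ≤ ∫ ω, ((k ω : ℝ) ^ 2 + (2 * g + 2 * (fy + B * φ)) * k ω +
        (g ^ 2 + 2 * g * (fy + B * φ) + (qy + B ^ 2 * φ))) ∂P := by
      refine int_le_fiber hk iT2 ((ik2.add (ik.const_mul _)).add (integrable_const _)) fun j => ?_
      have a1 : (∫ ω in k ⁻¹' {j}, T ω ^ 2 ∂P) ≤
          ∫ ω in k ⁻¹' {j}, (Y j ω ^ 2 + 2 * (j + g) * Y j ω + (j + g) ^ 2) ∂P := by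
        refine integral_mono_ae iT2.restrict
          (((iY2 j).restrict.add ((iY j).restrict.const_mul _)).add (integrable_const _)) ?_
        filter_upwards [onE j] with ω hω
        have := hTY ω
        rw [hω] at this
        have := pow_le_pow_left₀ (hT0 ω) this 2
        linarith
      have a2 : (∫ ω in k ⁻¹' {j}, ((k ω : ℝ) ^ 2 + (2 * g + 2 * (fy + B * φ)) * k ω +
        (g ^ 2 + 2 * g * (fy + B * φ) + (qy + B ^ 2 * φ))) ∂P) =
          ∫ ω in k ⁻¹' {j}, ((j : ℝ) ^ 2 + (2 * g + 2 * (fy + B * φ)) * j +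
        (g ^ 2 + 2 * g * (fy + B * φ) + (qy + B ^ 2 * φ))) ∂P := by
        refine integral_congr_ae ?_
        filter_upwards [onE j] with ω hω
        rw [hω]
      rw [a2]
      refine a1.trans ?_
      rw [int3 (iY2 j).restrict (iY j).restrict]
      simp only [integral_const, smul_eq_mul, measureReal_restrict_apply_univ]
      have b1 := m1 j
      have b2 := m2 j
      have b3 : 2 * ((j:ℝ) + g) * (∫ ω in k ⁻¹' {j}, Y j ω ∂P) ≤ 2 * (j + g) *
        (P.real (k ⁻¹' {j}) * (fy + B * φ)) := by gcongr
      linarith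
    rw [int3 ik2 ik] at h1
    simp only [probReal_univ, one_mul] at h1
    have b4 : (2 * g + 2 * (fy + B * φ)) * (∫ ω, (k ω : ℝ) ∂P) ≤
      (2 * g + 2 * (fy + B * φ)) * ((∫ ω, X ω ∂P) + 1) := by gcongr
    linarith
end


def tt {d : ℕ} {Ω : Type*} (c : ℝ → Euc d → Ω → ℝ) (v : ℝ → Euc d → Ω → Euc d) (t0 : ℝ)
    (x0 x : Euc d) (ω : Ω) : ℝ := travelTime (fun a b => c a b ω) (fun a b => v a b ω) t0 x0 x

theorem tau_shift {d : ℕ} {c : ℝ → Euc d → ℝ} {v : ℝ → Euc d → Euc d} (t0 : ℝ) (x0 x : Euc d) :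
    travelTime (fun a b => c (a + t0) (b + x0)) (fun a b => v (a + t0) (b + x0)) 0 0 (x - x0) =
    travelTime c v t0 x0 x := by
  have : ∀ t, (x - x0) ∈ reachSet (fun a b => c (a + t0) (b + x0)) (fun a b => v (a + t0) (b + x0)) t 0 0 ↔
      x ∈ reachSet c v t t0 x0 := by
    intro t
    have e1 : (0:ℝ) + t0 = t0 := zero_add _
    have e2 : (0:Euc d) + x0 = x0 := zero_add _
    have e3 : x - x0 + x0 = x := sub_add_cancel _ _
    have e4 : 0 + t + t0 = t0 + t := by ring
    have h := @reach_shift_iff d c v 0 (0 + t) t0 0 (x - x0) x0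
    rw [e1, e2, e3, e4] at h
    exact h
  unfold travelTime
  simp only [this]

structure Sett {d : ℕ} {Ω : Type*} [MeasurableSpace Ω] (P : Measure Ω)
    (c : ℝ → Euc d → Ω → ℝ) (v : ℝ → Euc d → Ω → Euc d) (Υ : ℝ × Euc d → Ω → Ω) (K L M : ℝ) :
    Prop where
  N : ∀ ω, Nice (fun a b => c a b ω) (fun a b => v a b ω) K L
  K0 : 0 < K
  M0 : 0 < M
  A : ∀ ω t0 x0 x1 T, M * (1 + ‖x1 - x0‖) ≤ T →
    Reachable (fun a b => c a b ω) (fun a b => v a b ω) t0 x0 (t0 + T) x1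
  mp : ∀ p, MeasurePreserving (Υ p) P P
  stat : ∀ t s : ℝ, ∀ x y : Euc d, ∀ ω,
      c t x (Υ (s, y) ω) = c (t + s) (x + y) ω ∧ v t x (Υ (s, y) ω) = v (t + s) (x + y) ω
  meas : ∀ t0 x0 x, Measurable (tt c v t0 x0 x)
  mix : Tendsto (phiH P c v) atTop (nhds 0)

theorem phi_nonneg {d : ℕ} {Ω : Type*} [MeasurableSpace Ω] {P : Measure Ω}
    {c : ℝ → Euc d → Ω → ℝ} {v : ℝ → Euc d → Ω → Euc d} (s : ℝ) : 0 ≤ phiH P c v s := by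
  refine Real.sSup_nonneg ?_
  rintro r ⟨t, E, F, -, -, -, rfl⟩
  exact abs_nonneg _

theorem phi_mix {d : ℕ} {Ω : Type*} [MeasurableSpace Ω] {P : Measure Ω} [IsProbabilityMeasure P]
    {c : ℝ → Euc d → Ω → ℝ} {v : ℝ → Euc d → Ω → Euc d} {t s : ℝ} {E F : Set Ω}
    (hE : MeasurableSet[sigmaMinus c v t] E) (hF : MeasurableSet[sigmaPlus c v (t + s)] F) :
    P.real (F ∩ E) ≤ P.real E * (P.real F + phiH P c v s) := by
  by_cases h0 : P E = 0
  · have : P (F ∩ E) = 0 := measure_mono_null Set.inter_subset_right h0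
    simp [measureReal_def, h0, this]
  · have hpos : 0 < P E := pos_iff_ne_zero.2 h0
    have hb : BddAbove {r | ∃ t : ℝ, ∃ Ev Fv : Set Ω,
        MeasurableSet[sigmaMinus c v t] Ev ∧ MeasurableSet[sigmaPlus c v (t + s)] Fv ∧
        0 < P Ev ∧ r = |(P (Fv ∩ Ev)).toReal / (P Ev).toReal - (P Fv).toReal|} := by
      refine ⟨1, ?_⟩
      rintro r ⟨t, E, F, -, -, hE, rfl⟩
      have h1 : 0 ≤ (P F).toReal := ENNReal.toReal_nonneg
      have h2 : (P F).toReal ≤ 1 := measureReal_le_one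
      have h3 : (P (F ∩ E)).toReal ≤ (P E).toReal := measureReal_mono (μ := P) Set.inter_subset_right
      have h4 : 0 ≤ (P (F ∩ E)).toReal / (P E).toReal := by positivity
      have h5 : (P (F ∩ E)).toReal / (P E).toReal ≤ 1 := div_le_one_of_le₀ h3 ENNReal.toReal_nonneg
      rw [abs_le]; constructor <;> linarith
    have h1 : |(P (F ∩ E)).toReal / (P E).toReal - (P F).toReal| ≤ phiH P c v s :=
      le_csSup hb ⟨t, E, F, hE, hF, hpos, rfl⟩
    have h2 := (abs_le.1 h1).2
    have hp : 0 < P.real E := ENNReal.toReal_pos h0 (measure_ne_top P E)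
    have h3 : P.real (F ∩ E) / P.real E ≤ P.real F + phiH P c v s := by
      simp only [measureReal_def]; linarith
    rw [div_le_iff₀ hp] at h3
    linarith

section
variable {d : ℕ} {Ω : Type*} [MeasurableSpace Ω] {P : Measure Ω} [IsProbabilityMeasure P]
    {c : ℝ → Euc d → Ω → ℝ} {v : ℝ → Euc d → Ω → Euc d} {Υ : ℝ × Euc d → Ω → Ω} {K L M : ℝ}

theorem tt_stat (S : Sett P c v Υ K L M) (t0 : ℝ) (x0 x : Euc d) (ω : Ω) :
    tt c v t0 x0 x ω = tt c v 0 0 (x - x0) (Υ (t0, x0) ω) := by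
  have hc : (fun a b => c a b (Υ (t0, x0) ω)) = fun a b => c (a + t0) (b + x0) ω := by
    funext a b; exact (S.stat a t0 b x0 ω).1
  have hv : (fun a b => v a b (Υ (t0, x0) ω)) = fun a b => v (a + t0) (b + x0) ω := by
    funext a b; exact (S.stat a t0 b x0 ω).2
  unfold tt
  rw [hc, hv]
  exact (tau_shift (c := fun a b => c a b ω) (v := fun a b => v a b ω) t0 x0 x).symm

theorem tt_ex (S : Sett P c v Υ K L M) (t0 : ℝ) (x0 x : Euc d) (ω : Ω) :
    ∃ t, Reachable (fun a b => c a b ω) (fun a b => v a b ω) t0 x0 (t0 + t) x :=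
  ⟨_, S.A ω t0 x0 x _ le_rfl⟩

theorem tt_nonneg (t0 : ℝ) (x0 x : Euc d) (ω : Ω) : 0 ≤ tt c v t0 x0 x ω := tau_nonneg

theorem tt_bound (S : Sett P c v Υ K L M) (t0 : ℝ) (x0 x : Euc d) (ω : Ω) :
    tt c v t0 x0 x ω ≤ M * (1 + ‖x - x0‖) := tau_le (S.A ω t0 x0 x _ le_rfl)

theorem tt_reach (S : Sett P c v Υ K L M) (t0 : ℝ) (x0 x : Euc d) (ω : Ω) :
    Reachable (fun a b => c a b ω) (fun a b => v a b ω) t0 x0 (t0 + tt c v t0 x0 x ω) x :=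
  tau_attained (S.N ω) (tt_ex S t0 x0 x ω)

theorem tt_concat (S : Sett P c v Υ K L M) {x y : Euc d} {ω : Ω} {k g : ℝ} (hg : M ≤ g)
    (hk : tt c v 0 0 x ω ≤ k) :
    tt c v 0 0 (x + y) ω ≤ k + g + tt c v (k + g) x (x + y) ω := by
  have h1 := tt_reach S 0 0 x ω
  have h2 := S.A ω (0 + tt c v 0 0 x ω) x x (k + g - tt c v 0 0 x ω) (by simp; linarith)
  rw [show 0 + tt c v 0 0 x ω + (k + g - tt c v 0 0 x ω) = k + g by ring] at h2
  have h3 := tt_reach S (k + g) x (x + y) ω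
  have h4 := reach_trans (reach_trans h1 h2) h3
  refine tau_le (t := k + g + tt c v (k + g) x (x + y) ω) ?_
  rw [zero_add]; exact h4

theorem tt_int_comp (S : Sett P c v Υ K L M) (t0 : ℝ) (x0 x : Euc d) (F : ℝ → ℝ)
    (hF : Measurable F) :
    ∫ ω, F (tt c v t0 x0 x ω) ∂P = ∫ ω, F (tt c v 0 0 (x - x0) ω) ∂P := by
  have h1 : (fun ω => F (tt c v t0 x0 x ω)) = fun ω => F (tt c v 0 0 (x - x0) (Υ (t0, x0) ω)) := by
    funext ω; rw [tt_stat S]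
  rw [h1]
  have h2 : Measurable fun ω => F (tt c v 0 0 (x - x0) ω) := hF.comp (S.meas _ _ _)
  have h3 := integral_map (μ := P) (S.mp (t0, x0)).measurable.aemeasurable
    (f := fun ω => F (tt c v 0 0 (x - x0) ω)) h2.aestronglyMeasurable
  rw [(S.mp (t0, x0)).map_eq] at h3
  exact h3.symm

theorem sigmaPlus_meas {t s : ℝ} (h : t ≤ s) (x : Euc d) :
    Measurable[sigmaPlus c v t] (c s x) ∧ Measurable[sigmaPlus c v t] (v s x) := by
  have h1 : MeasurableSpace.comap (fun ω => (c s x ω, v s x ω)) inferInstance ≤ sigmaPlus c v t :=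
    le_iSup_of_le s (le_iSup_of_le h (le_iSup_of_le x le_rfl))
  have h2 : Measurable[sigmaPlus c v t] (fun ω => (c s x ω, v s x ω)) := by
    rw [measurable_iff_comap_le]; exact h1
  exact ⟨measurable_fst.comp h2, measurable_snd.comp h2⟩

theorem sigmaMinus_meas {t s : ℝ} (h : s ≤ t) (x : Euc d) :
    Measurable[sigmaMinus c v t] (c s x) ∧ Measurable[sigmaMinus c v t] (v s x) := by
  have h1 : MeasurableSpace.comap (fun ω => (c s x ω, v s x ω)) inferInstance ≤ sigmaMinus c v t :=
    le_iSup_of_le s (le_iSup_of_le h (le_iSup_of_le x le_rfl))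
  have h2 : Measurable[sigmaMinus c v t] (fun ω => (c s x ω, v s x ω)) := by
    rw [measurable_iff_comap_le]; exact h1
  exact ⟨measurable_fst.comp h2, measurable_snd.comp h2⟩

theorem tt_plus (S : Sett P c v Υ K L M) (t0 : ℝ) (x0 x : Euc d) :
    Measurable[sigmaPlus c v t0] (tt c v t0 x0 x) :=
  measurable_of_Iic fun r => tau_meas S.N (tt_ex S t0 x0 x) r fun _ h1 _ z => sigmaPlus_meas h1 z

theorem tt_minus (S : Sett P c v Υ K L M) (x : Euc d) {r t : ℝ} (hr : r ≤ t) :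
    MeasurableSet[sigmaMinus c v t] {ω | tt c v 0 0 x ω ≤ r} :=
  tau_meas S.N (tt_ex S 0 0 x) r fun _ _ h1 z => sigmaMinus_meas (by linarith) z

theorem tt_minus_ceil (S : Sett P c v Υ K L M) (x : Euc d) (j : ℕ) :
    MeasurableSet[sigmaMinus c v j] ((fun ω => ⌈tt c v 0 0 x ω⌉₊) ⁻¹' {j}) := by
  rcases j with _ | j
  · have : (fun ω => ⌈tt c v 0 0 x ω⌉₊) ⁻¹' {0} = {ω | tt c v 0 0 x ω ≤ 0} := by
      ext ω; simp
    rw [this]; exact tt_minus S x (by simp)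
  · have : (fun ω => ⌈tt c v 0 0 x ω⌉₊) ⁻¹' {j + 1} =
        {ω | tt c v 0 0 x ω ≤ ((j + 1 : ℕ) : ℝ)} \ {ω | tt c v 0 0 x ω ≤ (j : ℝ)} := by
      ext ω
      simp only [Set.mem_preimage, Set.mem_singleton_iff]
      show _ ↔ (tt c v 0 0 x ω ≤ ((j + 1 : ℕ) : ℝ) ∧ ¬ tt c v 0 0 x ω ≤ (j : ℝ))
      rw [← Nat.ceil_le, ← Nat.ceil_le]; omega
    rw [this]
    exact MeasurableSet.diff (tt_minus S x le_rfl) (tt_minus S x (by push_cast; linarith))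

theorem tt_sub (S : Sett P c v Υ K L M) (x y : Euc d) {g : ℕ} (hg : M ≤ g) :
    (∫ ω, tt c v 0 0 (x + y) ω ∂P) ≤ (∫ ω, tt c v 0 0 x ω ∂P) + (1 + g) +
      ((∫ ω, tt c v 0 0 y ω ∂P) + M * (1 + ‖y‖) * phiH P c v g) ∧
    (∫ ω, (tt c v 0 0 (x + y) ω) ^ 2 ∂P) ≤ (∫ ω, (tt c v 0 0 x ω) ^ 2 ∂P) +
      2 * (1 + g) * (∫ ω, tt c v 0 0 x ω ∂P) + (1 + g) ^ 2 +
      2 * ((∫ ω, tt c v 0 0 x ω ∂P) + (1 + g)) *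
        ((∫ ω, tt c v 0 0 y ω ∂P) + M * (1 + ‖y‖) * phiH P c v g) +
      ((∫ ω, (tt c v 0 0 y ω) ^ 2 ∂P) + (M * (1 + ‖y‖)) ^ 2 * phiH P c v g) := by
  have hM := S.M0
  refine subadd_abs (m := fun j => sigmaPlus c v ((j:ℝ) + g))
    (k := fun ω => ⌈tt c v 0 0 x ω⌉₊) (Y := fun j => tt c v ((j:ℝ) + g) x (x + y))
    (S.meas _ _ _) (tt_nonneg _ _ _) (tt_bound S _ _ _) (S.meas _ _ _) (tt_nonneg _ _ _)
    (tt_bound S _ _ _) (Nat.measurable_ceil.comp (S.meas _ _ _))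
    (fun ω => (Nat.ceil_lt_add_one (tt_nonneg _ _ _ _)).le) (by positivity) (by positivity)
    (fun j => S.meas _ _ _) (fun j => tt_plus S _ _ _) (fun j => tt_nonneg _ _ _)
    ?_ ?_ ?_ (phi_nonneg _) ?_ ?_
  · intro j ω
    have := tt_bound S ((j:ℝ) + g) x (x + y) ω
    rwa [add_sub_cancel_left] at this
  · intro j
    have := tt_int_comp S ((j:ℝ) + g) x (x + y) id measurable_id
    rw [add_sub_cancel_left] at this; exact this
  · intro j
    have := tt_int_comp S ((j:ℝ) + g) x (x + y) (fun r => r ^ 2) (measurable_id.pow_const 2)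
    rw [add_sub_cancel_left] at this; exact this
  · intro j F hF _
    exact phi_mix (tt_minus_ceil S x j) hF
  · intro ω
    exact tt_concat S hg (Nat.le_ceil _)
end


theorem lim_exists {F : ℝ → ℝ} {C0 : ℝ} (h0 : ∀ R, 0 ≤ R → 0 ≤ F R)
    (hC : ∀ R, 0 ≤ R → F R ≤ C0 * (1 + R))
    (hs : ∀ η > 0, ∃ C, 0 ≤ C ∧ ∀ R R', 0 ≤ R → 0 ≤ R' → F (R + R') ≤ F R + F R' + C + η * R') :
    ∃ a, Tendsto (fun R => F R / R) atTop (nhds a) := by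
  have hC0 : 0 ≤ C0 := by have := (h0 0 le_rfl).trans (hC 0 le_rfl); linarith
  have hbel : ∀ᶠ R in atTop, 0 ≤ F R / R := by
    filter_upwards [eventually_ge_atTop 0] with R hR using div_nonneg (h0 R hR) hR
  have habo : ∀ᶠ R in atTop, F R / R ≤ 2 * C0 := by
    filter_upwards [eventually_ge_atTop 1] with R hR
    rw [div_le_iff₀ (by linarith)]
    have := hC R (by linarith)
    nlinarith
  have b1 : IsBoundedUnder (· ≥ ·) atTop (fun R => F R / R) := ⟨0, by simpa using hbel⟩
  have b2 : IsBoundedUnder (· ≤ ·) atTop (fun R => F R / R) := ⟨2 * C0, by simpa using habo⟩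
  set a := liminf (fun R => F R / R) atTop with ha
  have ha0 : 0 ≤ a := le_liminf_of_le b2.isCoboundedUnder_ge hbel
  refine ⟨a, tendsto_of_le_liminf_of_limsup_le le_rfl ?_ b2 b1⟩
  refine le_of_forall_pos_le_add fun η' hη' => ?_
  set η := η' / 4 with hη
  have hη0 : 0 < η := by positivity
  obtain ⟨C, hC1, hs'⟩ := hs η hη0
  have hfr : ∃ᶠ R in atTop, F R / R < a + η :=
    frequently_lt_of_liminf_lt b2.isCoboundedUnder_ge (by linarith)
  obtain ⟨R0, hR0a, hR0b⟩ := (hfr.and_eventually (eventually_ge_atTop (C / η + 1))).exists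
  have hR0 : 0 < R0 := lt_of_lt_of_le (by positivity) hR0b
  have hCR : C ≤ η * R0 := by
    have : C / η ≤ R0 := by linarith
    rw [div_le_iff₀ hη0] at this; linarith
  rw [div_lt_iff₀ hR0] at hR0a
  have hn : ∀ n : ℕ, F (n * R0) ≤ n * (R0 * (a + 3 * η)) + C0 := by
    intro n
    induction n with
    | zero => have := hC 0 le_rfl; simp at this ⊢; exact this
    | succ n ih =>
      have := hs' (n * R0) R0 (by positivity) hR0.le
      push_cast
      rw [show ((n:ℝ) + 1) * R0 = n * R0 + R0 by ring]
      linarith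
  have hup : ∀ R, 0 ≤ R → F R ≤ R * (a + 3 * η) + (2 * C0 * (1 + R0) + C + η * R0) := by
    intro R hR
    set n := ⌊R / R0⌋₊
    have h1 : (n:ℝ) * R0 ≤ R := by
      rw [← le_div_iff₀ hR0]; exact Nat.floor_le (by positivity)
    have h2 : R ≤ n * R0 + R0 := by
      have := Nat.lt_floor_add_one (R / R0)
      rw [div_lt_iff₀ hR0] at this; linarith
    have h3 := hs' (n * R0) (R - n * R0) (by positivity) (by linarith)
    rw [add_sub_cancel] at h3
    have h4 := hC (R - n * R0) (by linarith)
    have h5 : C0 * (1 + (R - n * R0)) ≤ C0 * (1 + R0) := by gcongr; linarith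
    have h6 : η * (R - n * R0) ≤ η * R0 := by gcongr; linarith
    have h7 := hn n
    have h8 : n * R0 * (a + 3 * η) ≤ R * (a + 3 * η) := by gcongr
    nlinarith
  set D := 2 * C0 * (1 + R0) + C + η * R0 with hD
  have hlim : Tendsto (fun R : ℝ => (a + 3 * η) + D / R) atTop (nhds (a + 3 * η + 0)) :=
    tendsto_const_nhds.add (tendsto_const_nhds.div_atTop tendsto_id)
  have hev : ∀ᶠ R in atTop, F R / R ≤ a + η' := by
    filter_upwards [hlim.eventually_le_const (show a + 3 * η + 0 < a + η' by linarith),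
      eventually_gt_atTop 0] with R hR hR0
    refine le_trans ?_ hR
    rw [div_le_iff₀ hR0, add_mul, div_mul_cancel₀ _ hR0.ne']
    linarith [hup R hR0.le]
  exact limsup_le_of_le b1.isCoboundedUnder_le hev

theorem half_decay {W : ℝ → ℝ} {C : ℝ} (hC : ∀ R, 1 ≤ R → W R ≤ C)
    (h : ∀ η > 0, ∀ᶠ R in atTop, W (2 * R) ≤ W R / 2 + η) : ∀ η > 0, ∀ᶠ R in atTop, W R ≤ η := by
  intro η hη
  obtain ⟨R0, hR0⟩ := eventually_atTop.1 (h (η / 4) (by positivity))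
  set R1 := max R0 1
  have hR1 : 1 ≤ R1 := le_max_right _ _
  have hn : ∀ n : ℕ, ∀ R, 2 ^ n * R1 ≤ R → W R ≤ |C| / 2 ^ n + η / 2 := by
    intro n
    induction n with
    | zero =>
      intro R hR
      simp at hR ⊢
      have := hC R (by linarith)
      have := le_abs_self C
      linarith
    | succ n ih =>
      intro R hR
      rw [pow_succ] at hR
      have h1 := ih (R / 2) (by linarith)
      have h2 : (1:ℝ) ≤ 2 ^ n := one_le_pow₀ (by norm_num)
      have h3 := hR0 (R / 2) (by nlinarith [le_max_left R0 1])
      rw [mul_div_cancel₀ _ (two_ne_zero)] at h3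
      rw [pow_succ, ← div_div]
      linarith
  have hl : Tendsto (fun n : ℕ => |C| / 2 ^ n + η / 2) atTop (nhds (0 + η / 2)) :=
    (tendsto_const_nhds.div_atTop (tendsto_pow_atTop_atTop_of_one_lt (by norm_num))).add_const _
  obtain ⟨n, hn1⟩ := (hl.eventually_le_const (show 0 + η / 2 < η by linarith)).exists
  filter_upwards [eventually_ge_atTop (2 ^ n * R1)] with R hR
  exact (hn n R hR).trans hn1

section
variable {d : ℕ} {Ω : Type*} [MeasurableSpace Ω] {P : Measure Ω} [IsProbabilityMeasure P]
    {c : ℝ → Euc d → Ω → ℝ} {v : ℝ → Euc d → Ω → Euc d} {Υ : ℝ × Euc d → Ω → Ω} {K L M : ℝ}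

theorem tt_integrable (S : Sett P c v Υ K L M) (t0 : ℝ) (x0 x : Euc d) :
    Integrable (tt c v t0 x0 x) P :=
  Integrable.of_bound (S.meas _ _ _).aestronglyMeasurable (M * (1 + ‖x - x0‖))
    (Eventually.of_forall fun ω => by
      rw [Real.norm_of_nonneg (tt_nonneg _ _ _ _)]; exact tt_bound S _ _ _ _)

theorem tt_integrable2 (S : Sett P c v Υ K L M) (t0 : ℝ) (x0 x : Euc d) :
    Integrable (fun ω => tt c v t0 x0 x ω ^ 2) P :=
  Integrable.of_bound ((S.meas _ _ _).pow_const 2).aestronglyMeasurable ((M * (1 + ‖x - x0‖)) ^ 2)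
    (Eventually.of_forall fun ω => by
      rw [Real.norm_of_nonneg (sq_nonneg _)]
      exact pow_le_pow_left₀ (tt_nonneg _ _ _ _) (tt_bound S _ _ _ _) 2)

def tf (P : Measure Ω) (c : ℝ → Euc d → Ω → ℝ) (v : ℝ → Euc d → Ω → Euc d) (x : Euc d) : ℝ :=
  ∫ ω, tt c v 0 0 x ω ∂P

theorem tf_nonneg (x : Euc d) : 0 ≤ tf P c v x := integral_nonneg fun ω => tt_nonneg _ _ _ _

theorem tf_upper (S : Sett P c v Υ K L M) (x : Euc d) : tf P c v x ≤ M * (1 + ‖x‖) := by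
  have := integral_mono (tt_integrable S 0 0 x) (integrable_const (M * (1 + ‖x - 0‖)))
    (tt_bound S 0 0 x)
  simpa [tf] using this

theorem tf_lower (S : Sett P c v Υ K L M) (x : Euc d) : ‖x‖ ≤ 2 * K * tf P c v x := by
  have := integral_mono (integrable_const ‖x - 0‖) ((tt_integrable S 0 0 x).const_mul (2 * K))
    (fun ω => tau_lower (S.N ω) (tt_ex S 0 0 x ω))
  rw [integral_const_mul] at this
  simpa [tf] using this

theorem exists_gap (S : Sett P c v Υ K L M) {η : ℝ} (hη : 0 < η) :
    ∃ g : ℕ, M ≤ g ∧ phiH P c v g ≤ η := by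
  have h1 := (S.mix.comp tendsto_natCast_atTop_atTop).eventually_le_const hη
  have h2 := (tendsto_natCast_atTop_atTop (R := ℝ)).eventually_ge_atTop M
  obtain ⟨g, h3, h4⟩ := (h2.and h1).exists
  exact ⟨g, h3, h4⟩

theorem tf_sub (S : Sett P c v Υ K L M) {η : ℝ} (hη : 0 < η) :
    ∃ C, 0 ≤ C ∧ ∀ x y, tf P c v (x + y) ≤ tf P c v x + tf P c v y + C + η * ‖y‖ := by
  have hM := S.M0
  obtain ⟨g, hg, hφ⟩ := exists_gap S (η := η / M) (by positivity)
  refine ⟨1 + g + η, by positivity, fun x y => ?_⟩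
  have h1 := (tt_sub S x y hg).1
  have h2 : M * (1 + ‖y‖) * phiH P c v g ≤ M * (1 + ‖y‖) * (η / M) := by gcongr
  have h3 : M * (1 + ‖y‖) * (η / M) = η * (1 + ‖y‖) := by field_simp
  simp only [tf]
  linarith

theorem tbar_exists (S : Sett P c v Υ K L M) (x : Euc d) :
    ∃ a, Tendsto (fun R : ℝ => tf P c v (R • x) / R) atTop (nhds a) := by
  have hM := S.M0
  refine lim_exists (C0 := M * (1 + ‖x‖)) (fun R hR => tf_nonneg _) ?_ ?_
  · intro R hR
    refine (tf_upper S _).trans ?_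
    rw [norm_smul, Real.norm_of_nonneg hR, mul_assoc]
    have := norm_nonneg x
    gcongr
    nlinarith
  · intro η hη
    obtain ⟨C, hC, h⟩ := tf_sub S (η := η / (‖x‖ + 1)) (by positivity)
    refine ⟨C, hC, fun R R' hR hR' => ?_⟩
    have h1 := h (R • x) (R' • x)
    rw [← add_smul, norm_smul, Real.norm_of_nonneg hR'] at h1
    have h2 : η / (‖x‖ + 1) * (R' * ‖x‖) ≤ η * R' := by
      rw [div_mul_eq_mul_div, div_le_iff₀ (by positivity)]
      have : 0 ≤ η * R' := by positivity
      nlinarith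
    linarith

def tbar (P : Measure Ω) (c : ℝ → Euc d → Ω → ℝ) (v : ℝ → Euc d → Ω → Euc d) (x : Euc d) : ℝ :=
  limUnder atTop (fun R : ℝ => tf P c v (R • x) / R)

theorem tbar_lim (S : Sett P c v Υ K L M) (x : Euc d) :
    Tendsto (fun R : ℝ => tf P c v (R • x) / R) atTop (nhds (tbar P c v x)) :=
  tendsto_nhds_limUnder (tbar_exists S x)

theorem tbar_hom (S : Sett P c v Υ K L M) {r : ℝ} (hr : 0 < r) (x : Euc d) :
    tbar P c v (r • x) = r * tbar P c v x := by
  have h1 := tbar_lim S (r • x)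
  have h2 := ((tbar_lim S x).comp (tendsto_id.atTop_mul_const hr)).const_mul r
  refine tendsto_nhds_unique h1 (h2.congr fun R => ?_)
  simp only [Function.comp, id, smul_smul]
  field_simp

theorem tbar_sub (S : Sett P c v Υ K L M) (x y : Euc d) :
    tbar P c v (x + y) ≤ tbar P c v x + tbar P c v y := by
  refine le_of_forall_pos_le_add fun η' hη' => ?_
  set η := η' / (‖y‖ + 1)
  obtain ⟨C, hC, h⟩ := tf_sub S (η := η) (by positivity)
  have hη : η * ‖y‖ ≤ η' := by
    simp only [η]
    rw [div_mul_eq_mul_div, div_le_iff₀ (by positivity)]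
    nlinarith
  have h1 : Tendsto (fun R : ℝ => tf P c v (R • x) / R + tf P c v (R • y) / R + C / R + η') atTop
      (nhds (tbar P c v x + tbar P c v y + 0 + η')) :=
    (((tbar_lim S x).add (tbar_lim S y)).add (tendsto_const_nhds.div_atTop tendsto_id)).add_const _
  rw [add_zero] at h1
  refine le_of_tendsto_of_tendsto (tbar_lim S (x + y)) h1 ?_
  filter_upwards [eventually_gt_atTop 0] with R hR
  have h2 := h (R • x) (R • y)
  rw [← smul_add, norm_smul, Real.norm_of_nonneg hR.le] at h2
  rw [← add_div, ← add_div, div_add' _ _ _ hR.ne']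
  gcongr
  nlinarith

theorem tbar_upper (S : Sett P c v Υ K L M) (x : Euc d) : tbar P c v x ≤ M * ‖x‖ := by
  have h1 : Tendsto (fun R : ℝ => M / R + M * ‖x‖) atTop (nhds (0 + M * ‖x‖)) :=
    (tendsto_const_nhds.div_atTop tendsto_id).add_const _
  rw [zero_add] at h1
  refine le_of_tendsto_of_tendsto (tbar_lim S x) h1 ?_
  filter_upwards [eventually_gt_atTop 0] with R hR
  rw [div_add' _ _ _ hR.ne']
  gcongr
  have := tf_upper S (R • x)
  rw [norm_smul, Real.norm_of_nonneg hR.le] at this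
  linarith

theorem tbar_lower (S : Sett P c v Υ K L M) (x : Euc d) : ‖x‖ ≤ 2 * K * tbar P c v x := by
  refine le_of_tendsto_of_tendsto tendsto_const_nhds ((tbar_lim S x).const_mul (2 * K)) ?_
  filter_upwards [eventually_gt_atTop 0] with R hR
  have := tf_lower S (R • x)
  rw [norm_smul, Real.norm_of_nonneg hR.le] at this
  rw [← mul_div_assoc, le_div_iff₀ hR]
  linarith

theorem tbar_nonneg (S : Sett P c v Υ K L M) (x : Euc d) : 0 ≤ tbar P c v x := by
  have h1 := (norm_nonneg x).trans (tbar_lower S x)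
  have := S.K0
  by_contra hn
  push Not at hn
  nlinarith

theorem tt_L2 (S : Sett P c v Υ K L M) (z : Euc d) : ∀ η > 0, ∀ᶠ R : ℝ in atTop,
    (∫ ω, (tt c v 0 0 (R • z) ω / R - tbar P c v z) ^ 2 ∂P) ≤ η := by
  set a := tbar P c v z with ha
  set F : ℝ → ℝ := fun R => tf P c v (R • z) with hF
  set Q : ℝ → ℝ := fun R => ∫ ω, tt c v 0 0 (R • z) ω ^ 2 ∂P with hQ
  set β := M * (1 + ‖z‖) with hβ
  have hM := S.M0
  have hβ0 : 0 < β := by positivity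
  have hb : ∀ R : ℝ, 1 ≤ R → M * (1 + ‖R • z‖) ≤ β * R := by
    intro R hR
    rw [norm_smul, Real.norm_of_nonneg (by linarith), hβ, mul_assoc]
    have := norm_nonneg z
    gcongr
    nlinarith
  have hFb : ∀ R, 1 ≤ R → F R ≤ β * R := fun R hR => (tf_upper S _).trans (hb R hR)
  have hF0 : ∀ R, 0 ≤ F R := fun R => tf_nonneg _
  have hQb : ∀ R, 1 ≤ R → Q R ≤ (β * R) ^ 2 := by
    intro R hR
    have h1 : Q R ≤ ∫ ω, (β * R) ^ 2 ∂P := by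
      refine integral_mono (tt_integrable2 S 0 0 (R • z)) (integrable_const _) fun ω => ?_
      refine pow_le_pow_left₀ (tt_nonneg _ _ _ _) ((tt_bound S _ _ _ _).trans ?_) 2
      rw [sub_zero]; exact hb R hR
    simpa using h1
  have hW : ∀ η > 0, ∀ᶠ R : ℝ in atTop, Q R / R ^ 2 - a ^ 2 ≤ η := by
    refine half_decay (C := β ^ 2) ?_ ?_
    · intro R hR
      have h1 : Q R / R ^ 2 ≤ β ^ 2 := by
        rw [div_le_iff₀ (by positivity), ← mul_pow]; exact hQb R hR
      linarith [sq_nonneg a]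
    · intro η hη
      obtain ⟨g, hg, hφ⟩ := exists_gap S (η := η / β ^ 2) (by positivity)
      set φ := phiH P c v g with hφd
      have hφ0 : 0 ≤ φ := phi_nonneg _
      have hφ1 : φ * β ^ 2 ≤ η := by rwa [le_div_iff₀ (by positivity)] at hφ
      set A := (1 + (g:ℝ)) * β * (1 + φ) + (1 + (g:ℝ)) ^ 2 with hA
      have hlim : Tendsto (fun R : ℝ => ((F R / R) ^ 2 - a ^ 2) / 2 + A / R + 3 / 4 * η) atTop
          (nhds ((a ^ 2 - a ^ 2) / 2 + 0 + 3 / 4 * η)) :=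
        ((((((tbar_lim S z).pow 2)).sub_const _).div_const 2).add
          (tendsto_const_nhds.div_atTop tendsto_id)).add_const _
      filter_upwards [hlim.eventually_le_const (show (a ^ 2 - a ^ 2) / 2 + 0 + 3 / 4 * η < η by linarith),
        eventually_ge_atTop 1] with R hR hR1
      have hR0 : 0 < R := by linarith
      have h1 := (tt_sub S (R • z) (R • z) hg).2
      rw [← two_smul ℝ (R • z), smul_smul] at h1
      change Q (2 * R) ≤ Q R + 2 * (1 + g) * F R + (1 + g) ^ 2 + 2 * (F R + (1 + g)) *
        (F R + M * (1 + ‖R • z‖) * φ) + (Q R + (M * (1 + ‖R • z‖)) ^ 2 * φ) at h1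
      set b := M * (1 + ‖R • z‖) with hbd
      have hb0 : 0 ≤ b := by positivity
      have hbR : b ≤ β * R := hb R hR1
      have hFR := hFb R hR1
      have hFR0 := hF0 R
      have g0 : (0:ℝ) ≤ 1 + g := by positivity
      have e1 : (1 + (g:ℝ)) * F R ≤ (1 + g) * (β * R) := by gcongr
      have e2 : F R * (b * φ) ≤ (β * R) * ((β * R) * φ) := by gcongr
      have e3 : (1 + (g:ℝ)) * (b * φ) ≤ (1 + g) * (β * R * φ) := by gcongr
      have e4 : b ^ 2 * φ ≤ (β * R) ^ 2 * φ := by gcongr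
      have e5 : (1 + (g:ℝ)) ^ 2 ≤ (1 + (g:ℝ)) ^ 2 * R := by
        have : 0 ≤ (1 + (g:ℝ)) ^ 2 := by positivity
        nlinarith
      have e6 : φ * β ^ 2 * R ^ 2 ≤ η * R ^ 2 := by gcongr
      have e7 : 0 ≤ (1 + (g:ℝ)) * (β * R * φ) := by positivity
      have e8 : 0 ≤ (1 + (g:ℝ)) ^ 2 * R := by positivity
      have h2 : Q (2 * R) ≤ 2 * Q R + 2 * (F R) ^ 2 + 4 * A * R + 3 * (η * R ^ 2) := by
        have h3 : Q R + 2 * (1 + g) * F R + (1 + g) ^ 2 + 2 * (F R + (1 + g)) *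
          (F R + b * φ) + (Q R + b ^ 2 * φ) = 2 * Q R + 2 * (F R) ^ 2 + 4 * ((1 + g) * F R) +
            (1 + g) ^ 2 + 2 * (F R * (b * φ)) + 2 * ((1 + g) * (b * φ)) + b ^ 2 * φ := by ring
        have h4 : 4 * A * R = 4 * ((1 + g) * (β * R)) + 4 * ((1 + g) * (β * R * φ)) +
          4 * ((1 + (g:ℝ)) ^ 2 * R) := by simp only [hA]; ring
        have h5 : (β * R) * ((β * R) * φ) = φ * β ^ 2 * R ^ 2 := by ring
        have h6 : (β * R) ^ 2 * φ = φ * β ^ 2 * R ^ 2 := by ring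
        linarith
      have h7 : Q (2 * R) / (2 * R) ^ 2 ≤
          (2 * Q R + 2 * (F R) ^ 2 + 4 * A * R + 3 * (η * R ^ 2)) / (2 * R) ^ 2 := by gcongr
      have h8 : (2 * Q R + 2 * (F R) ^ 2 + 4 * A * R + 3 * (η * R ^ 2)) / (2 * R) ^ 2 =
        Q R / R ^ 2 / 2 + (F R / R) ^ 2 / 2 + A / R + 3 / 4 * η := by field_simp; ring
      linarith
  intro η hη
  have hlim : Tendsto (fun R : ℝ => 2 * a * (a - F R / R)) atTop (nhds (2 * a * (a - a))) :=
    ((tbar_lim S z).const_sub _).const_mul _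
  filter_upwards [hW (η / 2) (by positivity),
    hlim.eventually_le_const (show 2 * a * (a - a) < η / 2 by simp; positivity),
    eventually_gt_atTop 0] with R h1 h2 hR
  have e1 : ∀ ω, (tt c v 0 0 (R • z) ω / R - a) ^ 2 = (R ^ 2)⁻¹ * tt c v 0 0 (R • z) ω ^ 2 +
      (-(2 * a / R)) * tt c v 0 0 (R • z) ω + a ^ 2 := by
    intro ω; field_simp; ring
  simp only [e1]
  rw [int3 ((tt_integrable2 S 0 0 (R • z)).const_mul _) (tt_integrable S 0 0 (R • z)),
    integral_const_mul]
  simp only [probReal_univ, one_mul]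
  change (R ^ 2)⁻¹ * Q R + (-(2 * a / R)) * F R + a ^ 2 ≤ η
  have e2 : (R ^ 2)⁻¹ * Q R + (-(2 * a / R)) * F R + a ^ 2 =
    (Q R / R ^ 2 - a ^ 2) + 2 * a * (a - F R / R) := by field_simp; ring
  linarith

theorem tt_prob (S : Sett P c v Υ K L M) (z : Euc d) {η : ℝ} (hη : 0 < η) :
    Tendsto (fun R : ℝ => P.real {ω | η ≤ |tt c v 0 0 (R • z) ω / R - tbar P c v z|}) atTop
      (nhds 0) := by
  rw [Metric.tendsto_nhds]
  intro e he
  filter_upwards [tt_L2 S z (η ^ 2 * (e / 2)) (by positivity)] with R hR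
  rw [Real.dist_eq, sub_zero, abs_of_nonneg measureReal_nonneg]
  have hm : Measurable fun ω => (tt c v 0 0 (R • z) ω / R - tbar P c v z) ^ 2 :=
    (((S.meas 0 0 (R • z)).div_const R).sub_const _).pow_const 2
  have hi : Integrable (fun ω => (tt c v 0 0 (R • z) ω / R - tbar P c v z) ^ 2) P := by
    refine Integrable.of_bound hm.aestronglyMeasurable
      ((|M * (1 + ‖R • z - 0‖)| / |R| + |tbar P c v z|) ^ 2) (Eventually.of_forall fun ω => ?_)
    rw [Real.norm_of_nonneg (sq_nonneg _), ← sq_abs]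
    refine pow_le_pow_left₀ (abs_nonneg _) ?_ 2
    refine (abs_sub _ _).trans ?_
    rw [abs_div]
    gcongr
    · exact tt_nonneg _ _ _ _
    · exact tt_bound S _ _ _ _
  have h1 := mul_meas_ge_le_integral_of_nonneg (μ := P) (Eventually.of_forall fun ω => sq_nonneg _) hi (η ^ 2)
  have h2 : {ω | η ≤ |tt c v 0 0 (R • z) ω / R - tbar P c v z|} ⊆
      {ω | η ^ 2 ≤ (tt c v 0 0 (R • z) ω / R - tbar P c v z) ^ 2} := by
    intro ω hω
    have hω' : η ≤ |tt c v 0 0 (R • z) ω / R - tbar P c v z| := hω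
    show η ^ 2 ≤ (tt c v 0 0 (R • z) ω / R - tbar P c v z) ^ 2
    rw [← sq_abs (_ - _)]
    exact pow_le_pow_left₀ hη.le hω' 2
  have h3 := measureReal_mono (μ := P) h2
  have h4 := le_of_mul_le_mul_left (h1.trans hR) (by positivity)
  linarith
end


theorem reach_split {d : ℕ} {c : ℝ → Euc d → ℝ} {v : ℝ → Euc d → Euc d} {t0 t t1 : ℝ}
    {x0 x1 : Euc d} (h0 : t0 ≤ t) (h1 : t ≤ t1) (h : Reachable c v t0 x0 t1 x1) :
    ∃ y, Reachable c v t y t1 x1 := by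
  obtain ⟨l, γ, g, i, e, f, a⟩ := h
  have i1 : IntervalIntegrable g volume t0 t :=
    i.mono_set (by rw [Set.uIcc_of_le h0, Set.uIcc_of_le l]; exact Set.Icc_subset_Icc_right h1)
  have i2 : IntervalIntegrable g volume t t1 :=
    i.mono_set (by rw [Set.uIcc_of_le h1, Set.uIcc_of_le l]; exact Set.Icc_subset_Icc_left h0)
  refine ⟨γ t, h1, γ, g, i2, ?_, f, ?_⟩
  · intro s hs
    have i3 : IntervalIntegrable g volume t s :=
      i2.mono_set (by
        rw [Set.uIcc_of_le hs.1, Set.uIcc_of_le h1]; exact Set.Icc_subset_Icc_right hs.2)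
    rw [e s ⟨h0.trans hs.1, hs.2⟩, e t ⟨h0, h1⟩, add_assoc,
      intervalIntegral.integral_add_adjacent_intervals i1 i3]
  · exact ae_mono (Measure.restrict_mono (Set.Icc_subset_Icc_left h0) le_rfl) a

theorem sSup_close {A B : Set ℝ} {e : ℝ} (hB : B.Nonempty) (hbB : BddAbove B)
    (h1 : ∀ a ∈ A, ∃ b ∈ B, a ≤ b + e) (h2 : ∀ b ∈ B, ∃ a ∈ A, b ≤ a + e) :
    |sSup A - sSup B| ≤ e := by
  have hA : A.Nonempty := by
    obtain ⟨b, hb⟩ := hB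
    obtain ⟨a, ha, -⟩ := h2 b hb
    exact ⟨a, ha⟩
  have h3 : ∀ a ∈ A, a ≤ sSup B + e := by
    intro a ha
    obtain ⟨b, hb, hab⟩ := h1 a ha
    have := le_csSup hbB hb
    linarith
  have hbA : BddAbove A := ⟨_, h3⟩
  have h4 : ∀ b ∈ B, b ≤ sSup A + e := by
    intro b hb
    obtain ⟨a, ha, hab⟩ := h2 b hb
    have := le_csSup hbA ha
    linarith
  have h5 := csSup_le hA h3
  have h6 := csSup_le hB h4
  rw [abs_le]; constructor <;> linarith

section
variable {d : ℕ} {Ω : Type*} [MeasurableSpace Ω] {P : Measure Ω} [IsProbabilityMeasure P]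
    {c : ℝ → Euc d → Ω → ℝ} {v : ℝ → Euc d → Ω → Euc d} {Υ : ℝ × Euc d → Ω → Ω} {K L M : ℝ}

theorem back_ex (S : Sett P c v Υ K L M) (ω : Ω) (x : Euc d) {T : ℝ} (hT : 0 ≤ T) :
    ∃ y, Reachable (fun a b => c a b ω) (fun a b => v a b ω) 0 y T x := by
  have h := S.A ω (-M) x x (T + M) (by simp; exact hT)
  have e : -M + (T + M) = T := by ring
  rw [e] at h
  exact reach_split (by linarith [S.M0]) hT h

/-- good event -/
def Good (P : Measure Ω) (c : ℝ → Euc d → Ω → ℝ) (v : ℝ → Euc d → Ω → Euc d) (M : ℝ)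
    (F : Finset (Euc d)) (η R : ℝ) (Y : Euc d) (ω : Ω) : Prop :=
  ∀ p ∈ F, ∀ q ∈ F,
    |tt c v 0 (R • (p + Y)) (R • (q + Y)) ω / R - tbar P c v (q - p)| < η ∧
    |tt c v (-(R * (2 * M * η))) (R • (p + Y)) (R • (q + Y)) ω / R - tbar P c v (q - p)| < η

theorem link (S : Sett P c v Υ K L M) (ω : Ω) {η R T t0 : ℝ} (hR : 0 < R) (hRη : 1 ≤ R * η)
    {x y Y : Euc d} (hxy : ‖y - x‖ ≤ η) (hT : R * (2 * M * η) ≤ T) :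
    Reachable (fun a b => c a b ω) (fun a b => v a b ω) t0 (R • (x + Y)) (t0 + T) (R • (y + Y)) := by
  refine S.A ω _ _ _ _ ?_
  rw [← smul_sub, add_sub_add_right_eq_sub, norm_smul, Real.norm_of_nonneg hR.le]
  have h1 : R * ‖y - x‖ ≤ R * η := mul_le_mul_of_nonneg_left hxy hR.le
  have h2 : M * (1 + R * ‖y - x‖) ≤ M * (2 * (R * η)) :=
    mul_le_mul_of_nonneg_left (by linarith) S.M0.le
  linarith

theorem tbar_near (S : Sett P c v Υ K L M) {x z q p : Euc d} {η : ℝ} (h1 : ‖x - q‖ ≤ η)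
    (h2 : ‖p - z‖ ≤ η) : tbar P c v (x - z) ≤ tbar P c v (q - p) + 2 * M * η := by
  have e : x - z = (q - p) + ((x - q) + (p - z)) := by abel
  rw [e]
  have a1 := tbar_sub S (q - p) ((x - q) + (p - z))
  have a2 := tbar_sub S (x - q) (p - z)
  have a3 := (tbar_upper S (x - q)).trans (mul_le_mul_of_nonneg_left h1 S.M0.le)
  have a4 := (tbar_upper S (p - z)).trans (mul_le_mul_of_nonneg_left h2 S.M0.le)
  linarith

theorem good_upper (S : Sett P c v Υ K L M) {F : Finset (Euc d)} {η R t : ℝ} {Y x z : Euc d} {ω : Ω}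
    (hR : 0 < R) (hRη : 1 ≤ R * η) (G : Good P c v M F η R Y ω)
    (hx : ∃ q ∈ F, ‖x - q‖ ≤ η) (hz : ∃ p ∈ F, ‖z - p‖ ≤ η)
    (h : Reachable (fun a b => c a b ω) (fun a b => v a b ω) 0 (R • (z + Y)) (R * t) (R • (x + Y))) :
    tbar P c v (x - z) ≤ t + (6 * M + 1) * η := by
  obtain ⟨q, hq, hxq⟩ := hx
  obtain ⟨p, hp, hzp⟩ := hz
  have l1 := link S ω (t0 := -(R * (2 * M * η))) (Y := Y) hR hRη hzp le_rfl
  rw [neg_add_cancel] at l1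
  have l2 := link S ω (t0 := R * t) (Y := Y) hR hRη (by rw [norm_sub_rev]; exact hxq) le_rfl
  have l3 := reach_trans (reach_trans l1 h) l2
  have e : R * t + R * (2 * M * η) = -(R * (2 * M * η)) + R * (t + 4 * M * η) := by ring
  rw [e] at l3
  have l4 : tt c v (-(R * (2 * M * η))) (R • (p + Y)) (R • (q + Y)) ω ≤ R * (t + 4 * M * η) :=
    tau_le l3
  have l5 := (abs_lt.1 (G p hp q hq).2).1
  have l6 : tt c v (-(R * (2 * M * η))) (R • (p + Y)) (R • (q + Y)) ω / R ≤ t + 4 * M * η := by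
    rw [div_le_iff₀ hR]; linarith
  have l7 := tbar_near S hxq (by rw [norm_sub_rev]; exact hzp)
  linarith

theorem good_lower (S : Sett P c v Υ K L M) {F : Finset (Euc d)} {η R t : ℝ} {Y x z : Euc d} {ω : Ω}
    (hR : 0 < R) (hRη : 1 ≤ R * η) (G : Good P c v M F η R Y ω)
    (hx : ∃ q ∈ F, ‖x - q‖ ≤ η) (hz : ∃ p ∈ F, ‖z - p‖ ≤ η)
    (h : tbar P c v (x - z) ≤ t - (6 * M + 1) * η) :
    ∃ p, ‖p - z‖ ≤ η ∧
    Reachable (fun a b => c a b ω) (fun a b => v a b ω) 0 (R • (p + Y)) (R * t) (R • (x + Y)) := by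
  obtain ⟨q, hq, hxq⟩ := hx
  obtain ⟨p, hp, hzp⟩ := hz
  have hη : 0 < η := by
    by_contra hh
    have := mul_nonpos_of_nonneg_of_nonpos hR.le (not_lt.1 hh)
    linarith
  have hMη := mul_pos S.M0 hη
  refine ⟨p, by rw [norm_sub_rev]; exact hzp, ?_⟩
  have l7 := tbar_near S (x := q) (q := x) (z := p) (p := z) (by rw [norm_sub_rev]; exact hxq) hzp
  have l1 := tt_reach S 0 (R • (p + Y)) (R • (q + Y)) ω
  have l5 := (abs_lt.1 (G p hp q hq).1).2
  have l6 : tt c v 0 (R • (p + Y)) (R • (q + Y)) ω / R ≤ t - 2 * M * η := by linarith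
  rw [div_le_iff₀ hR] at l6
  have l2 := link S ω (t0 := 0 + tt c v 0 (R • (p + Y)) (R • (q + Y)) ω)
    (T := R * t - tt c v 0 (R • (p + Y)) (R • (q + Y)) ω) (Y := Y) hR hRη hxq (by linarith)
  have l3 := reach_trans l1 l2
  have e : 0 + tt c v 0 (R • (p + Y)) (R • (q + Y)) ω +
    (R * t - tt c v 0 (R • (p + Y)) (R • (q + Y)) ω) = R * t := by ring
  rw [e] at l3
  exact l3

theorem bad_prob (S : Sett P c v Υ K L M) (F : Finset (Euc d)) {η : ℝ} (hη : 0 < η)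
    (Y : ℝ → Euc d) :
    Tendsto (fun R : ℝ => P.real {ω | ¬ Good P c v M F η R (Y R) ω}) atTop (nhds 0) := by
  have key : ∀ (R b : ℝ) (p q y : Euc d),
      P.real {ω | η ≤ |tt c v b (R • (p + y)) (R • (q + y)) ω / R - tbar P c v (q - p)|} =
      P.real {ω | η ≤ |tt c v 0 0 (R • (q - p)) ω / R - tbar P c v (q - p)|} := by
    intro R b p q y
    have hm : Measurable fun ω => |tt c v 0 0 (R • (q - p)) ω / R - tbar P c v (q - p)| :=
      (((S.meas 0 0 (R • (q - p))).div_const R).sub_const _).abs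
    have hs : MeasurableSet {ω | η ≤ |tt c v 0 0 (R • (q - p)) ω / R - tbar P c v (q - p)|} :=
      measurableSet_le measurable_const hm
    have h1 := (S.mp (b, R • (p + y))).measureReal_preimage hs.nullMeasurableSet
    rw [← h1]
    congr 1
    ext ω
    simp only [Set.mem_setOf_eq, Set.mem_preimage]
    rw [tt_stat S b, ← smul_sub, add_sub_add_right_eq_sub]
  have hlim : Tendsto (fun R : ℝ => ∑ p ∈ F, ∑ q ∈ F,
      (P.real {ω | η ≤ |tt c v 0 0 (R • (q - p)) ω / R - tbar P c v (q - p)|} +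
       P.real {ω | η ≤ |tt c v 0 0 (R • (q - p)) ω / R - tbar P c v (q - p)|})) atTop (nhds 0) := by
    have := tendsto_finsetSum F fun p _ => tendsto_finsetSum F fun q _ =>
      (tt_prob S (q - p) hη).add (tt_prob S (q - p) hη)
    simpa using this
  refine squeeze_zero (fun _ => measureReal_nonneg) (fun R => ?_) hlim
  have hsub : {ω | ¬ Good P c v M F η R (Y R) ω} ⊆ ⋃ p ∈ F, ⋃ q ∈ F,
      ({ω | η ≤ |tt c v 0 (R • (p + Y R)) (R • (q + Y R)) ω / R - tbar P c v (q - p)|} ∪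
       {ω | η ≤ |tt c v (-(R * (2 * M * η))) (R • (p + Y R)) (R • (q + Y R)) ω / R
          - tbar P c v (q - p)|}) := by
    intro ω hω
    simp only [Set.mem_iUnion, Set.mem_union, Set.mem_setOf_eq]
    by_contra hcon
    apply hω
    intro p hp q hq
    by_contra h2
    apply hcon
    refine ⟨p, hp, q, hq, ?_⟩
    by_contra h3
    push Not at h3
    exact h2 h3
  refine (measureReal_mono hsub (measure_ne_top P _)).trans ?_
  refine (measureReal_biUnion_finset_le _ _).trans (Finset.sum_le_sum fun p _ => ?_)
  refine (measureReal_biUnion_finset_le _ _).trans (Finset.sum_le_sum fun q _ => ?_)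
  refine (measureReal_union_le _ _).trans ?_
  rw [key, key]
end


section
variable {d : ℕ} {Ω : Type*} [MeasurableSpace Ω] {P : Measure Ω} [IsProbabilityMeasure P]
    {c : ℝ → Euc d → Ω → ℝ} {v : ℝ → Euc d → Ω → Euc d} {Υ : ℝ × Euc d → Ω → Ω} {K L M : ℝ}

theorem tbar_zero (S : Sett P c v Υ K L M) : tbar P c v 0 = 0 := by
  have h1 := tbar_upper S 0
  have h2 := tbar_nonneg S 0
  rw [norm_zero, mul_zero] at h1
  linarith

theorem tbar_hom0 (S : Sett P c v Υ K L M) {r : ℝ} (hr : 0 ≤ r) (x : Euc d) :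
    tbar P c v (r • x) = r * tbar P c v x := by
  rcases hr.eq_or_lt with h | h
  · rw [← h, zero_smul, zero_mul, tbar_zero S]
  · exact tbar_hom S h x

theorem S_convex (S : Sett P c v Υ K L M) : Convex ℝ {x | tbar P c v x < 1} := by
  intro x hx y hy a b ha hb hab
  have hx' : tbar P c v x < 1 := hx
  have hy' : tbar P c v y < 1 := hy
  show tbar P c v (a • x + b • y) < 1
  have h := tbar_sub S (a • x) (b • y)
  rw [tbar_hom0 S ha, tbar_hom0 S hb] at h
  rcases ha.eq_or_lt with h0 | h0
  · subst h0
    have : b = 1 := by linarith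
    subst this
    linarith
  · have := mul_lt_mul_of_pos_left hx' h0
    have := mul_le_mul_of_nonneg_left hy'.le hb
    linarith

theorem S_open (S : Sett P c v Υ K L M) : IsOpen {x | tbar P c v x < 1} := by
  have hl : ∀ x y, tbar P c v x - tbar P c v y ≤ M * ‖x - y‖ := by
    intro x y
    have h1 := tbar_sub S y (x - y)
    rw [add_sub_cancel] at h1
    have h2 := tbar_upper S (x - y)
    linarith
  have hc : Continuous (tbar P c v) := by
    refine (LipschitzWith.of_dist_le_mul (K := M.toNNReal) fun x y => ?_).continuous
    rw [Real.coe_toNNReal _ S.M0.le, Real.dist_eq, dist_eq_norm, abs_le]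
    have h1 := hl x y
    have h2 := hl y x
    rw [norm_sub_rev] at h2
    constructor <;> linarith
  exact isOpen_lt hc continuous_const

theorem S_norm (S : Sett P c v Υ K L M) {s : Euc d} (h : tbar P c v s < 1) : ‖s‖ ≤ 2 * K := by
  have h1 := tbar_lower S s
  have h2 := mul_le_mul_of_nonneg_left h.le (by linarith [S.K0] : 0 ≤ 2 * K)
  linarith

/-- the deterministic comparison -/
theorem det_close (S : Sett P c v Υ K L M) {F : Finset (Euc d)} {η ε t r0 δ m ρ R0 : ℝ}
    {Y x : Euc d} {ω : Ω} {u0 w : Euc d → ℝ}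
    (hε : 0 < ε) (hη : 0 < η) (hεη : 1 ≤ ε⁻¹ * η) (G : Good P c v M F η ε⁻¹ Y ω)
    (hF : ∀ z : Euc d, ‖z‖ ≤ R0 → ∃ q ∈ F, ‖z - q‖ ≤ η)
    (hu : UniformContinuous u0)
    (hm : ∀ a b, ‖a - b‖ ≤ m → u0 a ≤ u0 b + δ / 2)
    (hmη : η + 4 * K * (6 * M + 1) * η ≤ m)
    (hw : ∀ x, |w (x + Y) - u0 x| ≤ ρ) (hρ : ρ ≤ δ / 2)
    (ht : 0 ≤ t) (htr : t ≤ r0) (hx : ‖x‖ ≤ r0) (hR0 : r0 + 2 * K * r0 ≤ R0) :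
    |sSup {r | ∃ y : Euc d, r = w y ∧
                    ε⁻¹ • (x + Y) ∈ reachSet (fun a b => c a b ω) (fun a b => v a b ω)
                      (ε⁻¹ * t) 0 (ε⁻¹ • y)} -
                  sSup (u0 '' {y | ∃ s ∈ {x | tbar P c v x < 1}, y = x - t • s})| ≤ δ := by
  have hR : 0 < ε⁻¹ := inv_pos.2 hε
  have hK := S.K0
  have hM := S.M0
  set C := 6 * M + 1 with hC
  have hCη : 0 < C * η := by positivity
  have hKr : 2 * K * t ≤ 2 * K * r0 := by gcongr
  have hKt : 0 ≤ 2 * K * t := by positivity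
  have hxF := hF x (by linarith)
  have hnear : ∀ z : Euc d, ‖x - z‖ ≤ 2 * K * t → ‖z‖ ≤ R0 := by
    intro z hz
    have : ‖z‖ ≤ ‖x‖ + ‖x - z‖ := by
      have h := norm_sub_le x (x - z)
      rwa [sub_sub_cancel] at h
    linarith
  have hdist : ∀ z : Euc d, Reachable (fun a b => c a b ω) (fun a b => v a b ω) 0 (ε⁻¹ • (z + Y))
      (ε⁻¹ * t) (ε⁻¹ • (x + Y)) → ‖x - z‖ ≤ 2 * K * t := by
    intro z h
    have h1 := reach_dist (S.N ω).hK h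
    rw [← smul_sub, add_sub_add_right_eq_sub, norm_smul, Real.norm_of_nonneg hR.le] at h1
    have h2 : ε⁻¹ * ‖x - z‖ ≤ ε⁻¹ * (2 * K * t) := by linarith
    exact le_of_mul_le_mul_left h2 hR
  have hmemA : ∀ z : Euc d, Reachable (fun a b => c a b ω) (fun a b => v a b ω) 0 (ε⁻¹ • (z + Y))
      (ε⁻¹ * t) (ε⁻¹ • (x + Y)) → w (z + Y) ∈ {r | ∃ y : Euc d, r = w y ∧
                    ε⁻¹ • (x + Y) ∈ reachSet (fun a b => c a b ω) (fun a b => v a b ω)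
                      (ε⁻¹ * t) 0 (ε⁻¹ • y)} := by
    intro z h
    refine ⟨z + Y, rfl, ?_⟩
    unfold reachSet
    rw [Set.mem_setOf_eq, zero_add]
    exact h
  refine sSup_close ?_ ?_ ?_ ?_
  · exact ⟨_, _, ⟨0, by show tbar P c v 0 < 1; rw [tbar_zero S]; exact one_pos, rfl⟩, rfl⟩
  · refine BddAbove.mono (Set.image_mono ?_)
      ((isCompact_closedBall (0 : Euc d) R0).image hu.continuous).bddAbove
    rintro y ⟨s, hs, rfl⟩
    rw [mem_closedBall_zero_iff]
    apply hnear
    rw [sub_sub_cancel, norm_smul, Real.norm_of_nonneg ht]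
    have := mul_le_mul_of_nonneg_left (S_norm S hs) ht
    linarith
  · rintro a ⟨y, rfl, hy⟩
    obtain ⟨z, rfl⟩ : ∃ z, y = z + Y := ⟨y - Y, by abel⟩
    unfold reachSet at hy
    rw [Set.mem_setOf_eq, zero_add] at hy
    have h1 := good_upper S hR hεη G hxF (hF z (hnear z (hdist z hy))) hy
    rw [← hC] at h1
    have hp : 0 < t + 2 * (C * η) := by linarith
    have hp' := inv_pos.2 hp
    set s : Euc d := (t + 2 * (C * η))⁻¹ • (x - z) with hs
    have hts : tbar P c v s < 1 := by
      rw [hs, tbar_hom S hp', inv_mul_lt_iff₀ hp]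
      linarith
    refine ⟨u0 (x - t • s), ⟨_, ⟨s, hts, rfl⟩, rfl⟩, ?_⟩
    have hxz : x - z = (t + 2 * (C * η)) • s := by
      rw [hs, smul_smul, mul_inv_cancel₀ hp.ne', one_smul]
    have hd : z - (x - t • s) = -((2 * (C * η)) • s) := by
      have : z = x - (t + 2 * (C * η)) • s := by rw [← hxz]; abel
      rw [this, add_smul]; abel
    have h2 := hm z (x - t • s) (by
      rw [hd, norm_neg, norm_smul, Real.norm_of_nonneg (by linarith)]
      have := mul_le_mul_of_nonneg_left (S_norm S hts) (by linarith : 0 ≤ 2 * (C * η))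
      nlinarith)
    have h3 := (abs_le.1 (hw z)).2
    linarith
  · rintro b ⟨y, ⟨s, hs, rfl⟩, rfl⟩
    have hsK := S_norm S hs
    have hs' : tbar P c v s < 1 := hs
    have main : ∃ z, Reachable (fun a b => c a b ω) (fun a b => v a b ω) 0 (ε⁻¹ • (z + Y))
      (ε⁻¹ * t) (ε⁻¹ • (x + Y)) ∧ ‖(x - t • s) - z‖ ≤ m := by
      rcases le_total t (C * η) with h | h
      · obtain ⟨y, hy⟩ := back_ex S ω (ε⁻¹ • (x + Y)) (mul_nonneg hR.le ht)
        obtain ⟨z, rfl⟩ : ∃ z, y = ε⁻¹ • (z + Y) := ⟨ε • y - Y, by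
          rw [sub_add_cancel, smul_smul, inv_mul_cancel₀ hε.ne', one_smul]⟩
        refine ⟨z, hy, ?_⟩
        have h1 := hdist z hy
        have e : x - t • s - z = (x - z) - t • s := by abel
        rw [e]
        refine (norm_sub_le _ _).trans ?_
        rw [norm_smul, Real.norm_of_nonneg ht]
        have h2 := mul_le_mul_of_nonneg_left hsK ht
        have h3 : 4 * K * t ≤ 4 * K * (C * η) := by gcongr
        linarith
      · have h0 : 0 ≤ t - C * η := by linarith
        obtain ⟨p, hp, hr⟩ := good_lower S (z := x - (t - C * η) • s) hR hεη G hxF (t := t)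
          (hF _ (hnear _ (by
            rw [sub_sub_cancel, norm_smul, Real.norm_of_nonneg h0]
            have h1 := mul_le_mul_of_nonneg_left hsK h0
            have h2 : 0 ≤ C * η * (2 * K) := by positivity
            linarith))) (by
            rw [sub_sub_cancel, tbar_hom0 S h0, ← hC]
            have := mul_le_mul_of_nonneg_left hs'.le h0
            linarith)
        refine ⟨p, hr, ?_⟩
        have e : x - t • s - p = -(p - (x - (t - C * η) • s)) - (C * η) • s := by
          rw [sub_smul]; abel
        rw [e]
        refine (norm_sub_le _ _).trans ?_
        rw [norm_neg, norm_smul, Real.norm_of_nonneg hCη.le]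
        have h1 := mul_le_mul_of_nonneg_left hsK hCη.le
        have h2 : 0 ≤ C * η * (2 * K) := by positivity
        linarith
    obtain ⟨z, hz, hzm⟩ := main
    refine ⟨_, hmemA z hz, ?_⟩
    have h1 := hm _ _ hzm
    have h3 := (abs_le.1 (hw z)).1
    linarith

theorem main_sett (S : Sett P c v Υ K L M) (u0 : Euc d → ℝ) (u0ε : ℝ → Ω → Euc d → ℝ)
    (yε : ℝ → Euc d) (ρ : ℝ → ℝ) (hu : UniformContinuous u0)
    (hρ : Tendsto ρ (nhdsWithin 0 (Set.Ioi 0)) (nhds 0))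
    (hw : ∀ ε ∈ Set.Ioo (0:ℝ) 1, ∀ ω1, ∀ x : Euc d, |u0ε ε ω1 (x + yε ε) - u0 x| ≤ ρ ε)
    (δ : ℝ) (hδ : 0 < δ) :
          Tendsto (fun ε : ℝ => P {ω | ∀ t ∈ Set.Ico (0:ℝ) δ⁻¹,
              ∀ x ∈ Metric.ball (0 : Euc d) δ⁻¹,
                |sSup {r | ∃ y : Euc d, r = u0ε ε ω y ∧
                    ε⁻¹ • (x + yε ε) ∈ reachSet (fun a b => c a b ω) (fun a b => v a b ω)
                      (ε⁻¹ * t) 0 (ε⁻¹ • y)} -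
                  sSup (u0 '' {y | ∃ s ∈ {x | tbar P c v x < 1}, y = x - t • s})| ≤ δ})
            (nhdsWithin 0 (Set.Ioi 0)) (nhds 1) := by
  have hK := S.K0
  have hM := S.M0
  obtain ⟨m0, hm0, hm0'⟩ := Metric.uniformContinuous_iff.1 hu (δ / 2) (by positivity)
  have hm : ∀ a b, ‖a - b‖ ≤ m0 / 2 → u0 a ≤ u0 b + δ / 2 := by
    intro a b hab
    have h1 := hm0' (a := a) (b := b) (by rw [dist_eq_norm]; linarith)
    rw [Real.dist_eq] at h1
    have := (abs_lt.1 h1).2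
    linarith
  set D := 1 + 4 * K * (6 * M + 1) with hD
  have hDpos : 0 < D := by positivity
  set η := m0 / 2 / D with hη
  have hηpos : 0 < η := by positivity
  have hmη : η + 4 * K * (6 * M + 1) * η ≤ m0 / 2 := by
    have : D * η = m0 / 2 := by rw [hη]; field_simp
    rw [hD] at this
    linarith
  set R0 := δ⁻¹ + 2 * K * δ⁻¹ with hR0
  obtain ⟨F, -, hFf, hFc⟩ := (isCompact_closedBall (0 : Euc d) R0).finite_cover_balls hηpos
  have hF : ∀ z : Euc d, ‖z‖ ≤ R0 → ∃ q ∈ hFf.toFinset, ‖z - q‖ ≤ η := by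
    intro z hz
    have h1 := hFc (mem_closedBall_zero_iff.2 hz)
    simp only [Set.mem_iUnion] at h1
    obtain ⟨q, hq, hzq⟩ := h1
    refine ⟨q, hFf.mem_toFinset.2 hq, ?_⟩
    rw [mem_ball, dist_eq_norm] at hzq
    exact hzq.le
  have hb := bad_prob S hFf.toFinset hηpos (fun R => yε R⁻¹)
  have hb2 := hb.comp (tendsto_inv_nhdsGT_zero (𝕜 := ℝ))
  have hb3 : Tendsto (fun ε : ℝ => 1 - ENNReal.ofReal
      (P.real {ω | ¬ Good P c v M hFf.toFinset η ε⁻¹ (yε ε) ω})) (nhdsWithin 0 (Set.Ioi 0))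
      (nhds 1) := by
    have h1 := ENNReal.tendsto_ofReal hb2
    have h2 := ENNReal.Tendsto.sub (tendsto_const_nhds (x := (1 : ENNReal))
      (f := nhdsWithin (0:ℝ) (Set.Ioi 0))) h1 (Or.inl ENNReal.one_ne_top)
    simpa [Function.comp_def] using h2
  refine tendsto_of_tendsto_of_tendsto_of_le_of_le' hb3 tendsto_const_nhds ?_
    (Eventually.of_forall fun ε => prob_le_one)
  have e1 : ∀ᶠ ε in nhdsWithin (0:ℝ) (Set.Ioi 0), ρ ε ≤ δ / 2 :=
    hρ.eventually_le_const (by positivity)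
  have e2 : ∀ᶠ ε in nhdsWithin (0:ℝ) (Set.Ioi 0), ε ∈ Set.Ioo (0:ℝ) (min 1 η) :=
    Ioo_mem_nhdsGT (lt_min one_pos hηpos)
  filter_upwards [e1, e2] with ε h1 h2
  have hε : 0 < ε := h2.1
  have hε1 : ε < 1 := h2.2.trans_le (min_le_left _ _)
  have hεη : ε < η := h2.2.trans_le (min_le_right _ _)
  have hεη' : 1 ≤ ε⁻¹ * η := by
    rw [← div_eq_inv_mul, one_le_div hε]; exact hεη.le
  have hcompl : (1 : ENNReal) ≤ P {ω | Good P c v M hFf.toFinset η ε⁻¹ (yε ε) ω} +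
      P {ω | ¬ Good P c v M hFf.toFinset η ε⁻¹ (yε ε) ω} := by
    rw [← measure_univ (μ := P)]
    refine (measure_mono ?_).trans (measure_union_le _ _)
    intro ω _
    exact em _
  rw [ofReal_measureReal (measure_ne_top P _)]
  refine (tsub_le_iff_right.2 hcompl).trans (measure_mono ?_)
  intro ω hG t ht x hx
  rw [mem_ball_zero_iff] at hx
  exact det_close S hε hηpos hεη' hG hF hu hm hmη (fun x => hw ε ⟨hε, hε1⟩ ω x) h1 ht.1 ht.2.le
    hx.le le_rfl
end

/-- **Homogenization in probability for G-equations.**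
Under the G-equation hypotheses and mere decay of `φ_H`, there is a convex bounded open set
`S ∋ 0` such that: for any uniformly continuous data `u₀`, `u^ε(0,·,ω)` with arbitrary shifts
`y_ε ∈ ℝ^d` and `sup_ω ‖u^ε(0,·+y_ε,ω) − u₀‖_∞ ≤ ρ(ε) → 0`, the solutions
`u^ε(t,x,ω) = sup{ u^ε(0,y,ω) : x ∈ εΓ(ε⁻¹t,ω;0,ε⁻¹y) }` satisfy, for every `δ > 0`,
`P[ |u^ε(t, x+y_ε, ·) − sup_{y ∈ x−tS} u₀(y)| ≤ δ on [0,δ⁻¹) × B_{δ⁻¹}(0) ] → 1` as `ε → 0⁺`. -/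
theorem gequation_homogenization_in_probability
    {d : ℕ} {Ω : Type*} [MeasurableSpace Ω] (P : Measure Ω) [IsProbabilityMeasure P]
    (c : ℝ → Euc d → Ω → ℝ) (v : ℝ → Euc d → Ω → Euc d)
    -- `c` is positive, `(c,v)` are bounded
    (hc_pos : ∀ t x ω, 0 < c t x ω)
    (hbdd : ∃ K : ℝ, ∀ t x ω, c t x ω ≤ K ∧ ‖v t x ω‖ ≤ K)
    -- uniform continuity in `t`, uniformly in `(x,ω)`
    (huct : ∀ ε : ℝ, 0 < ε → ∃ δ : ℝ, 0 < δ ∧ ∀ t t' : ℝ, |t - t'| ≤ δ → ∀ x ω,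
      |c t x ω - c t' x ω| ≤ ε ∧ ‖v t x ω - v t' x ω‖ ≤ ε)
    -- uniform Lipschitz continuity in `x`
    (hlip : ∃ L : ℝ, ∀ t : ℝ, ∀ x x' : Euc d, ∀ ω,
      |c t x ω - c t x' ω| ≤ L * ‖x - x'‖ ∧ ‖v t x ω - v t x' ω‖ ≤ L * ‖x - x'‖)
    -- `v(t,·,ω)` is divergence-free (a.e. vanishing trace of the a.e. derivative)
    (hdiv : ∀ t : ℝ, ∀ ω, ∀ᵐ x ∂(volume : Measure (Euc d)),
      LinearMap.trace ℝ (Euc d) (fderiv ℝ (fun y => v t y ω) x).toLinearMap = 0)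
    -- the averaged smallness condition (1.14): inf_L sup |avg of v over L-boxes| < inf c
    (hGc4 : ∃ L : ℝ, 0 < L ∧ ∃ a b : ℝ, a < b ∧
      (∀ t x ω,
        ‖(L ^ d)⁻¹ • ∫ y in {y : Euc d | ∀ i, y i ∈ Set.Icc (0:ℝ) L}, v t (x + y) ω‖ ≤ a) ∧
      (∀ t x ω, b ≤ c t x ω))
    -- space-time stationarity with respect to a measure-preserving group
    (Υ : ℝ × Euc d → Ω → Ω)
    (hmp : ∀ p, MeasurePreserving (Υ p) P P)
    (hid : Υ 0 = id)
    (hgrp : ∀ p q, Υ p ∘ Υ q = Υ (p + q))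
    (hstat : ∀ t s : ℝ, ∀ x y : Euc d, ∀ ω,
      c t x (Υ (s, y) ω) = c (t + s) (x + y) ω ∧ v t x (Υ (s, y) ω) = v (t + s) (x + y) ω)
    -- measurability in ω of the travel times
    (hτmeas : ∀ t0 : ℝ, ∀ x0 x : Euc d,
      Measurable fun ω => travelTime (fun a b => c a b ω) (fun a b => v a b ω) t0 x0 x)
    -- decay of the mixing coefficient
    (hmix : Tendsto (phiH P c v) atTop (nhds 0)) :
    ∃ S : Set (Euc d), Convex ℝ S ∧ IsOpen S ∧ Bornology.IsBounded S ∧ (0 : Euc d) ∈ S ∧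
      ∀ (u0 : Euc d → ℝ) (u0ε : ℝ → Ω → Euc d → ℝ) (yε : ℝ → Euc d) (ρ : ℝ → ℝ),
        UniformContinuous u0 →
        (∀ ε ∈ Set.Ioo (0:ℝ) 1, ∀ ω1, UniformContinuous (u0ε ε ω1)) →
        Tendsto ρ (nhdsWithin 0 (Set.Ioi 0)) (nhds 0) →
        (∀ ε ∈ Set.Ioo (0:ℝ) 1, ∀ ω1, ∀ x : Euc d, |u0ε ε ω1 (x + yε ε) - u0 x| ≤ ρ ε) →
        ∀ δ : ℝ, 0 < δ →
          Tendsto (fun ε : ℝ => P {ω | ∀ t ∈ Set.Ico (0:ℝ) δ⁻¹,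
              ∀ x ∈ Metric.ball (0 : Euc d) δ⁻¹,
                |sSup {r | ∃ y : Euc d, r = u0ε ε ω y ∧
                    ε⁻¹ • (x + yε ε) ∈ reachSet (fun a b => c a b ω) (fun a b => v a b ω)
                      (ε⁻¹ * t) 0 (ε⁻¹ • y)} -
                  sSup (u0 '' {y | ∃ s ∈ S, y = x - t • s})| ≤ δ})
            (nhdsWithin 0 (Set.Ioi 0)) (nhds 1) := by
  obtain ⟨K', hK'⟩ := hbdd
  obtain ⟨L', hL'⟩ := hlip
  obtain ⟨l, hl, a, b, hab, havg, hb⟩ := hGc4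
  obtain ⟨ω0⟩ : Nonempty Ω := nonempty_of_isProbabilityMeasure P
  have ha : 0 ≤ a := (norm_nonneg _).trans (havg 0 0 ω0)
  set K := max K' 1 with hKdef
  set L := max L' 0 with hLdef
  have hK0 : 0 < K := lt_of_lt_of_le one_pos (le_max_right _ _)
  have hL0 : 0 ≤ L := le_max_right _ _
  have hK : ∀ t x ω, c t x ω ≤ K ∧ ‖v t x ω‖ ≤ K := fun t x ω =>
    ⟨(hK' t x ω).1.trans (le_max_left _ _), (hK' t x ω).2.trans (le_max_left _ _)⟩
  have hL : ∀ t x x' ω,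
      |c t x ω - c t x' ω| ≤ L * ‖x - x'‖ ∧ ‖v t x ω - v t x' ω‖ ≤ L * ‖x - x'‖ := by
    intro t x x' ω
    have h1 : L' * ‖x - x'‖ ≤ L * ‖x - x'‖ :=
      mul_le_mul_of_nonneg_right (le_max_left _ _) (norm_nonneg _)
    exact ⟨(hL' t x x' ω).1.trans h1, (hL' t x x' ω).2.trans h1⟩
  set b' := (a + b) / 2 with hb'
  have hb0 : 0 < b' := by rw [hb']; linarith
  have hab' : a < b' := by rw [hb']; linarith
  set θ := (b - b') / 2 with hθ
  have hθ0 : 0 < θ := by rw [hθ, hb']; linarith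
  obtain ⟨h1, hh1, hosc⟩ := huct θ hθ0
  set D := L * (K + b') + 1 with hD
  have hD0 : 0 < D := by positivity
  set h0 := min h1 (θ / D) with hh0def
  have hh0 : 0 < h0 := lt_min hh1 (by positivity)
  have hpar : b' + L * (h0 * (K + b')) + θ ≤ b := by
    have e1 : h0 * D ≤ θ := by
      rw [← le_div_iff₀ hD0]; exact min_le_right _ _
    have e2 : h0 * D = L * (h0 * (K + b')) + h0 := by rw [hD]; ring
    have e3 : θ + θ = b - b' := by rw [hθ]; ring
    linarith
  obtain ⟨M, hM, hA⟩ := full_reach (d := d) (K := K) (L := L) (a := a) (b := b) (l := l)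
    (b' := b') (h0 := h0) (θ := θ) hab' hK0.le hh0 hb0
  have S : Sett P c v Υ K L M :=
    { N := fun ω =>
        { hK := fun t x => hK t x ω
          hc := fun t x => (hc_pos t x ω).le
          hL := fun t x x' => hL t x x' ω
          hL0 := hL0
          hosc := fun ε hε => by
            obtain ⟨δ, hδ, h⟩ := huct ε hε
            exact ⟨δ, hδ, fun t t' htt x => h t t' htt x ω⟩ }
      K0 := hK0
      M0 := hM
      A := fun ω => hA _ _
        { hK := fun t x => hK t x ω
          hb := fun t x => hb t x ω
          hL := fun t x x' => (hL t x x' ω).2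
          hosc := fun t t' x h => (hosc t t' (h.trans (min_le_left _ _)) x ω).2
          hdiv := fun t => hdiv t ω
          havg := fun t x => havg t x ω
          hL0 := hL0
          hl0 := hl
          hb0 := hb0
          hh0 := hh0
          hpar := hpar }
      mp := hmp
      stat := hstat
      meas := hτmeas
      mix := hmix }
  refine ⟨{x | tbar P c v x < 1}, S_convex S, S_open S, ?_, ?_, ?_⟩
  · refine (Metric.isBounded_closedBall (x := (0 : Euc d)) (r := 2 * K)).subset ?_
    intro x hx
    rw [mem_closedBall_zero_iff]
    exact S_norm S hx
  · show tbar P c v 0 < 1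
    rw [tbar_zero S]; exact one_pos
  · intro u0 u0ε yε ρ hu _ hρ hw δ hδ
    exact main_sett S u0 u0ε yε ρ hu hρ hw δ hδ
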